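/- Let p, s ∈ ℕ and let (r, k, m₁, m₂, m₃) belong to the set {(0,2,0,0,0), (1,3,0,0,0), (1,2,0,1,0), (2,3,1,1,1)} ∪ {(2j, k, 2j-1, 2j-2, 2j-1) : j, k ∈ ℕ} ∪ {(2j+1, k, 2j-1, 2j, 2j) : j ∈ ℕ₀, k ∈ ℕ}. Then there exists a constant c > 0 depending only on k, r, s, p, and for every Y_s ∈ 𝕐_s and A_p ∈ 𝔸_p with Y_s ∩ A_p = ∅ there exists N ∈ ℕ depending only on d(Y_s, A_p), such that for every f ∈ C^r ∩ Δ^(0)(Y_s) and every n ≥ N there exists a polynomial P_n of degree ≤ n satisfying: (1) P_n ∈ Δ^(0)(Y_s) (copositivity with f); (2) if m₁ ≥ 0 then P_n^(i)(α) = f^(i)(α) for all α ∈ A_p and 0 ≤ i ≤ m₁ (no condition if m₁ = -1); (3) P_n^(i)(y) = f^(i)(y) for all y ∈ Y_s and 0 ≤ i ≤ m₂; (4) P_n^(i)(±1) = f^(i)(±1) for 0 ≤ i ≤ m₃; and (5) |f(x) - P_n(x)| ≤ c ρ_n^r(x) ω_k(f^(r), ρ_n(x)) for all x ∈ I. -/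

import Mathlib

/-- The `k`-th modulus of smoothness of `g` with step bound `t` on `[a,b]`. -/
noncomputable def omegaK (g : ℝ → ℝ) (k : ℕ) (t a b : ℝ) : ℝ :=
  sSup {v : ℝ | ∃ h x : ℝ, 0 < h ∧ h ≤ t ∧ a ≤ x ∧ x + (k : ℝ) * h ≤ b ∧
    v = |∑ i ∈ Finset.range (k + 1),
      (-1 : ℝ) ^ (k - i) * (k.choose i : ℝ) * g (x + (i : ℝ) * h)|}

/-- `ρ_n(x) = n⁻¹ √(1 - x²) + n⁻²`. -/
noncomputable def rho (n : ℕ) (x : ℝ) : ℝ :=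
  Real.sqrt (1 - x ^ 2) / n + 1 / (n : ℝ) ^ 2

/-- The smallest positive distance between two distinct points of `S`. -/
noncomputable def minGap (S : Set ℝ) : ℝ :=
  sInf {d : ℝ | ∃ u ∈ S, ∃ v ∈ S, u ≠ v ∧ d = |u - v|}

/-- `g ∈ Δ^(0)(Y_s)`, where `Y_s` is encoded by the extended decreasing sequence
`y : Fin (s+2) → ℝ` with `y 0 = 1`, `y (s+1) = -1`:
`(-1)^i g ≥ 0` on `[y (i+1), y i]` for `0 ≤ i ≤ s`. -/
def Delta0 {s : ℕ} (y : Fin (s + 2) → ℝ) (g : ℝ → ℝ) : Prop :=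
  ∀ i : Fin (s + 1), ∀ x ∈ Set.Icc (y i.succ) (y i.castSucc),
    0 ≤ (-1 : ℝ) ^ (i : ℕ) * g x

namespace CopositiveApprox

open Polynomial Real

/-- The distance of `x` and `u` on the scale `ρ_m`, measured in the angular variable. -/
noncomputable def relDist (m : ℕ) (x u : ℝ) : ℝ := 1 + m * |arccos x - arccos u|

lemma one_le_relDist (m : ℕ) (x u : ℝ) : 1 ≤ relDist m x u := by
  unfold relDist; have : 0 ≤ (m : ℝ) * |arccos x - arccos u| := by positivity
  linarith

lemma relDist_pos (m : ℕ) (x u : ℝ) : 0 < relDist m x u :=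
  lt_of_lt_of_le one_pos (one_le_relDist m x u)

lemma relDist_comm (m : ℕ) (x u : ℝ) : relDist m x u = relDist m u x := by
  unfold relDist; rw [abs_sub_comm]

lemma relDist_triangle (m : ℕ) (x v u : ℝ) :
    relDist m x u ≤ relDist m x v * relDist m v u := by
  unfold relDist
  have h := abs_sub_le (arccos x) (arccos v) (arccos u)
  have hm : (0 : ℝ) ≤ m := by positivity
  have h1 : 0 ≤ (m : ℝ) * |arccos x - arccos v| := by positivity
  have h2 : 0 ≤ (m : ℝ) * |arccos v - arccos u| := by positivity
  nlinarith [mul_le_mul_of_nonneg_left h hm, mul_nonneg h1 h2]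

lemma rho_eq_sin (m : ℕ) (x : ℝ) : rho m x = sin (arccos x) / m + 1 / (m : ℝ) ^ 2 := by
  rw [sin_arccos, rho]

lemma rho_pos {m : ℕ} (hm : 0 < m) (x : ℝ) : 0 < rho m x := by
  unfold rho; positivity

lemma rho_le_two_div {m : ℕ} (hm : 0 < m) (x : ℝ) : rho m x ≤ 2 / m := by
  rw [rho_eq_sin]
  have h1 : (1 : ℝ) ≤ m := by exact_mod_cast hm
  have h2 : sin (arccos x) / m ≤ 1 / m := by gcongr; exact sin_le_one _
  have h3 : 1 / (m : ℝ) ^ 2 ≤ 1 / m := by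
    apply one_div_le_one_div_of_le (by positivity); nlinarith
  have : (2 : ℝ) / m = 1 / m + 1 / m := by ring
  linarith

lemma sin_arccos_nonneg (x : ℝ) : 0 ≤ sin (arccos x) :=
  sin_nonneg_of_nonneg_of_le_pi (arccos_nonneg x) (arccos_le_pi x)

lemma rho_le_relDist_mul {m : ℕ} (hm : 0 < m) (x u : ℝ) :
    rho m x ≤ relDist m x u * rho m u := by
  rw [rho_eq_sin, rho_eq_sin, relDist]
  set θ := arccos x
  set φ := arccos u
  have hm' : (0 : ℝ) < m := by exact_mod_cast hm
  have h1 : sin θ ≤ sin φ + |θ - φ| := by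
    have : |sin θ - sin φ| ≤ |θ - φ| := by
      have e : sin θ - sin φ = 2 * sin ((θ - φ) / 2) * cos ((θ + φ) / 2) := sin_sub_sin θ φ
      rw [e, abs_mul, abs_mul, abs_two]
      have a1 : |sin ((θ - φ) / 2)| ≤ |(θ - φ) / 2| := abs_sin_le_abs
      have a2 : |cos ((θ + φ) / 2)| ≤ 1 := abs_cos_le_one _
      rw [abs_div, abs_two] at a1
      nlinarith [abs_nonneg (sin ((θ - φ) / 2)), abs_nonneg (cos ((θ + φ) / 2))]
    linarith [le_abs_self (sin θ - sin φ)]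
  have hs : 0 ≤ sin φ := sin_arccos_nonneg u
  have e : (1 + m * |θ - φ|) * (sin φ / m + 1 / (m : ℝ) ^ 2)
      = (sin φ + |θ - φ|) / m + 1 / (m : ℝ) ^ 2 + |θ - φ| * sin φ := by
    field_simp; ring
  rw [e]
  have h2 : sin θ / m ≤ (sin φ + |θ - φ|) / m := by gcongr
  have h3 : 0 ≤ |θ - φ| * sin φ := by positivity
  linarith

lemma abs_sub_eq_sin {x u : ℝ} (hx : x ∈ Set.Icc (-1 : ℝ) 1) (hu : u ∈ Set.Icc (-1 : ℝ) 1) :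
    |x - u| = 2 * sin ((arccos x + arccos u) / 2) * sin (|arccos x - arccos u| / 2) := by
  have h1 := arccos_nonneg x
  have h2 := arccos_le_pi x
  have h3 := arccos_nonneg u
  have h4 := arccos_le_pi u
  have hd1 := abs_nonneg (arccos x - arccos u)
  have hd2 : |arccos x - arccos u| ≤ π := by rw [abs_le]; constructor <;> linarith
  have s1 : 0 ≤ sin ((arccos x + arccos u) / 2) :=
    sin_nonneg_of_nonneg_of_le_pi (by linarith) (by linarith)
  have s2 : 0 ≤ sin (|arccos x - arccos u| / 2) :=
    sin_nonneg_of_nonneg_of_le_pi (by linarith) (by linarith)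
  have e : x - u = cos (arccos x) - cos (arccos u) := by
    rw [cos_arccos hx.1 hx.2, cos_arccos hu.1 hu.2]
  rw [e, cos_sub_cos, abs_mul, abs_mul, abs_neg, abs_two, abs_of_nonneg s1]
  congr 1
  rcases le_total 0 (arccos x - arccos u) with h | h
  · rw [abs_of_nonneg h, abs_of_nonneg]; rwa [abs_of_nonneg h] at s2
  · rw [abs_of_nonpos h] at s2 ⊢
    rw [neg_div, sin_neg] at s2 ⊢
    rw [abs_of_nonpos (by linarith)]

lemma sin_half_sum_bounds {x u : ℝ} :
    sin (|arccos x - arccos u| / 2) ≤ sin ((arccos x + arccos u) / 2) ∧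
    sin (arccos x) ≤ 2 * sin ((arccos x + arccos u) / 2) ∧
    |arccos x - arccos u| / π ≤ sin (|arccos x - arccos u| / 2) := by
  have h1 := arccos_nonneg x
  have h2 := arccos_le_pi x
  have h3 := arccos_nonneg u
  have h4 := arccos_le_pi u
  set θ := arccos x
  set φ := arccos u
  have hd1 := abs_nonneg (θ - φ)
  have hd2 : |θ - φ| ≤ π := by rw [abs_le]; constructor <;> linarith
  have hpi := pi_pos
  have A : sin (|θ - φ| / 2) ≤ sin ((θ + φ) / 2) := by
    have e : sin ((θ + φ) / 2) - sin (|θ - φ| / 2)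
        = 2 * sin (((θ + φ) / 2 - |θ - φ| / 2) / 2) * cos (((θ + φ) / 2 + |θ - φ| / 2) / 2) :=
      sin_sub_sin _ _
    have k1 : |θ - φ| ≤ θ + φ := by rw [abs_le]; constructor <;> linarith
    have k2 : θ + φ + |θ - φ| ≤ 2 * π := by
      rcases le_total 0 (θ - φ) with h | h
      · rw [abs_of_nonneg h]; linarith
      · rw [abs_of_nonpos h]; linarith
    have s1 : 0 ≤ sin (((θ + φ) / 2 - |θ - φ| / 2) / 2) :=
      sin_nonneg_of_nonneg_of_le_pi (by linarith) (by linarith)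
    have s2 : 0 ≤ cos (((θ + φ) / 2 + |θ - φ| / 2) / 2) :=
      cos_nonneg_of_neg_pi_div_two_le_of_le (by linarith) (by linarith)
    have := mul_nonneg (mul_nonneg zero_le_two s1) s2
    linarith
  refine ⟨A, ?_, ?_⟩
  · have s1 : 0 ≤ sin ((θ + φ) / 2) :=
      sin_nonneg_of_nonneg_of_le_pi (by linarith) (by linarith)
    have e : sin θ = sin ((θ + φ) / 2 + (θ - φ) / 2) := by congr 1; ring
    rw [e, sin_add]
    have c1 := abs_cos_le_one ((θ - φ) / 2)
    have c2 := abs_cos_le_one ((θ + φ) / 2)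
    have b : |sin ((θ - φ) / 2)| ≤ sin (|θ - φ| / 2) := by
      have s2 : 0 ≤ sin (|θ - φ| / 2) :=
        sin_nonneg_of_nonneg_of_le_pi (by linarith) (by linarith)
      rcases le_total 0 (θ - φ) with h | h
      · rw [abs_of_nonneg h] at s2 ⊢; rw [abs_of_nonneg s2]
      · rw [abs_of_nonpos h, neg_div, sin_neg] at s2 ⊢
        rw [abs_of_nonpos (by linarith)]
    have p1 : sin ((θ + φ) / 2) * cos ((θ - φ) / 2) ≤ sin ((θ + φ) / 2) := by
      nlinarith [le_abs_self (cos ((θ - φ) / 2))]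
    have p2 : cos ((θ + φ) / 2) * sin ((θ - φ) / 2) ≤ |sin ((θ - φ) / 2)| := by
      refine (le_abs_self _).trans ?_
      rw [abs_mul]
      nlinarith [abs_nonneg (sin ((θ - φ) / 2))]
    linarith
  · have := mul_le_sin (x := |θ - φ| / 2) (by linarith) (by linarith)
    calc |θ - φ| / π = 2 / π * (|θ - φ| / 2) := by ring
      _ ≤ _ := this

lemma abs_sub_le_rho_mul {m : ℕ} (hm : 0 < m) {x u : ℝ} (hx : x ∈ Set.Icc (-1 : ℝ) 1)
    (hu : u ∈ Set.Icc (-1 : ℝ) 1) : |x - u| ≤ rho m u * relDist m x u ^ 2 := by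
  rw [rho_eq_sin, relDist]
  have e : x - u = cos (arccos x) - cos (arccos u) := by
    rw [cos_arccos hx.1 hx.2, cos_arccos hu.1 hu.2]
  have hs : 0 ≤ sin (arccos u) := sin_arccos_nonneg u
  set θ := arccos x
  set φ := arccos u
  have hm' : (0 : ℝ) < m := by exact_mod_cast hm
  have hd := abs_nonneg (θ - φ)
  have h1 : |x - u| ≤ |θ - φ| * (sin φ + |θ - φ|) := by
    rw [e, cos_sub_cos, abs_mul, abs_mul, abs_neg, abs_two]
    have a1 : |sin ((θ - φ) / 2)| ≤ |(θ - φ) / 2| := abs_sin_le_abs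
    rw [abs_div, abs_two] at a1
    have a2 : |sin ((θ + φ) / 2)| ≤ sin φ + |θ - φ| := by
      have e2 : (θ + φ) / 2 = φ + (θ - φ) / 2 := by ring
      rw [e2, sin_add]
      refine (abs_add_le _ _).trans ?_
      rw [abs_mul, abs_mul, abs_of_nonneg hs]
      have c1 := abs_cos_le_one ((θ - φ) / 2)
      have c2 := abs_cos_le_one φ
      nlinarith [abs_nonneg (sin ((θ - φ) / 2)), abs_nonneg (cos φ)]
    have := mul_le_mul a2 a1 (abs_nonneg _) (by positivity)
    nlinarith
  refine h1.trans ?_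
  have e3 : (sin φ / m + 1 / (m : ℝ) ^ 2) * (1 + m * |θ - φ|) ^ 2
     = |θ - φ| * (sin φ + |θ - φ|) + (sin φ / m + 1 / (m : ℝ) ^ 2 + |θ - φ| * sin φ
        + 2 * |θ - φ| / m + m * |θ - φ| ^ 2 * sin φ) := by
    field_simp; ring
  rw [e3]
  have : 0 ≤ sin φ / m + 1 / (m : ℝ) ^ 2 + |θ - φ| * sin φ
        + 2 * |θ - φ| / m + m * |θ - φ| ^ 2 * sin φ := by positivity
  linarith

lemma rho_le_of_half_le {m : ℕ} (hm : 0 < m) {x u : ℝ} (hx : x ∈ Set.Icc (-1 : ℝ) 1)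
    (hu : u ∈ Set.Icc (-1 : ℝ) 1) (h : 1 / 2 ≤ m * |arccos x - arccos u|) :
    rho m x ≤ 27 * |x - u| := by
  rw [rho_eq_sin, abs_sub_eq_sin hx hu]
  obtain ⟨a, b, c⟩ := sin_half_sum_bounds (x := x) (u := u)
  have hs : 0 ≤ sin (arccos x) := sin_arccos_nonneg x
  set δ := |arccos x - arccos u|
  set S := sin ((arccos x + arccos u) / 2)
  set t := sin (δ / 2)
  have hm' : (0 : ℝ) < m := by exact_mod_cast hm
  have hpi := pi_pos
  have hpi2 := pi_lt_d2
  have h1 : 1 / (m : ℝ) ≤ 2 * δ := by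
    rw [div_le_iff₀ hm']; linarith
  have hd : 0 ≤ δ := abs_nonneg _
  have c' : δ ≤ π * t := by rw [div_le_iff₀ hpi] at c; linarith
  have ht : 0 ≤ t := le_trans (by positivity) c
  have hm0 : 0 ≤ 1 / (m : ℝ) := by positivity
  have e1 : 1 / (m : ℝ) ≤ 2 * (3.15 * t) := by nlinarith
  have : sin (arccos x) / m + 1 / (m : ℝ) ^ 2
      = sin (arccos x) * (1 / m) + (1 / m) * (1 / m) := by ring
  rw [this]
  have hS : 0 ≤ 2 * S := by linarith
  have f1 : sin (arccos x) * (1 / m) ≤ (2 * S) * (2 * (3.15 * t)) := by gcongr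
  have f2 : (1 / (m : ℝ)) * (1 / m) ≤ (2 * (3.15 * t)) * (2 * (3.15 * t)) := by gcongr
  nlinarith [mul_le_mul_of_nonneg_right a ht]

lemma abs_sin_nat_mul_le (k : ℕ) (a : ℝ) : |sin (k * a)| ≤ k * |sin a| := by
  induction k with
  | zero => simp
  | succ k ih =>
    push_cast
    rw [add_mul, one_mul, sin_add]
    refine (abs_add_le _ _).trans ?_
    rw [abs_mul, abs_mul]
    nlinarith [abs_cos_le_one a, abs_cos_le_one (k * a), abs_nonneg (sin a),
      abs_nonneg (sin (k * a)), abs_nonneg (cos a), abs_nonneg (cos (k * a))]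

lemma abs_cos_sub_cos_mul_rho_le {m : ℕ} (hm : 0 < m) {k : ℕ} (hk : k ≤ m) {x u : ℝ}
    (hx : x ∈ Set.Icc (-1 : ℝ) 1) (hu : u ∈ Set.Icc (-1 : ℝ) 1) :
    |cos (k * arccos x) - cos (k * arccos u)| * rho m x ≤ 5 * |x - u| := by
  rw [rho_eq_sin, abs_sub_eq_sin hx hu]
  obtain ⟨a, b, c⟩ := sin_half_sum_bounds (x := x) (u := u)
  have hs : 0 ≤ sin (arccos x) := sin_arccos_nonneg x
  have hm' : (0 : ℝ) < m := by exact_mod_cast hm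
  have hpi := pi_pos
  have hpi2 := pi_lt_d2
  have hk' : (k : ℝ) ≤ m := by exact_mod_cast hk
  have hd : 0 ≤ |arccos x - arccos u| := abs_nonneg _
  have e : |cos (k * arccos x) - cos (k * arccos u)|
      = 2 * |sin (k * ((arccos x + arccos u) / 2))| * |sin (k * (|arccos x - arccos u| / 2))| := by
    rw [cos_sub_cos, abs_mul, abs_mul, abs_neg, abs_two]
    congr 1
    · congr 3; ring
    · rcases le_total 0 (arccos x - arccos u) with h | h
      · rw [abs_of_nonneg h]; congr 2; ring
      · rw [abs_of_nonpos h, ← abs_neg, ← sin_neg]; congr 2; ring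
  have hS := abs_sin_nat_mul_le k ((arccos x + arccos u) / 2)
  have ht := abs_sin_nat_mul_le k (|arccos x - arccos u| / 2)
  rw [e]
  have t0 : 0 ≤ sin (|arccos x - arccos u| / 2) := le_trans (by positivity) c
  rw [abs_of_nonneg t0] at ht
  rw [abs_of_nonneg (t0.trans a)] at hS
  have hS1 := abs_sin_le_one (k * ((arccos x + arccos u) / 2))
  set t := sin (|arccos x - arccos u| / 2)
  set S := sin ((arccos x + arccos u) / 2)
  set A := |sin (k * ((arccos x + arccos u) / 2))|
  set B := |sin (k * (|arccos x - arccos u| / 2))|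
  have hA : 0 ≤ A := abs_nonneg _
  have hB : 0 ≤ B := abs_nonneg _
  have hS0 : 0 ≤ S := t0.trans a
  have B1 : B ≤ m * t := ht.trans (by gcongr)
  have A1 : A ≤ m * S := hS.trans (by gcongr)
  have g1 : 2 * A * B * (sin (arccos x) / m) ≤ 4 * (S * t) := by
    calc 2 * A * B * (sin (arccos x) / m) ≤ 2 * 1 * (m * t) * (2 * S / m) := by gcongr
      _ = 4 * (S * t) := by field_simp; ring
  have g2 : 2 * A * B * (1 / (m : ℝ) ^ 2) ≤ 2 * (S * t) := by
    calc 2 * A * B * (1 / (m : ℝ) ^ 2) ≤ 2 * (m * S) * (m * t) * (1 / (m : ℝ) ^ 2) := by gcongr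
      _ = 2 * (S * t) := by field_simp
  have := mul_nonneg hS0 t0
  nlinarith

/-- The normalised Fejér kernel. -/
noncomputable def fejerFun (m : ℕ) (φ : ℝ) : ℝ :=
  ((m : ℝ) ^ 2)⁻¹ * (2 * ∑ k ∈ Finset.range m, ((m : ℝ) - k) * cos (k * φ) - m)

/-- The even part of the Fejér kernel centred at `arccos u`, as a polynomial in `cos θ`. -/
noncomputable def fejerPoly (m : ℕ) (u : ℝ) : ℝ[X] :=
  C (((m : ℝ) ^ 2)⁻¹) *
    (2 * ∑ k ∈ Finset.range m, C (((m : ℝ) - k) * cos (k * arccos u)) * Chebyshev.T ℝ (k : ℤ) - C (m : ℝ))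

lemma natDegree_fejerPoly_le (m : ℕ) (u : ℝ) : (fejerPoly m u).natDegree ≤ m := by
  unfold fejerPoly
  refine (natDegree_C_mul_le _ _).trans ?_
  refine (natDegree_sub_le _ _).trans ?_
  rw [natDegree_C]
  refine max_le ?_ (Nat.zero_le _)
  have : (2 : ℝ[X]) = C 2 := rfl
  rw [this]
  refine (natDegree_C_mul_le _ _).trans ?_
  refine natDegree_sum_le_of_forall_le _ _ fun k hk => ?_
  refine (natDegree_C_mul_le _ _).trans ?_
  rw [Chebyshev.natDegree_T]
  simpa using (Finset.mem_range.mp hk).le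

lemma eval_fejerPoly (m : ℕ) (u : ℝ) {x : ℝ} (hx : x ∈ Set.Icc (-1 : ℝ) 1) :
    (fejerPoly m u).eval x
      = (fejerFun m (arccos x - arccos u) + fejerFun m (arccos x + arccos u)) / 2 := by
  have e : ∀ k : ℕ, (Chebyshev.T ℝ (k : ℤ)).eval x = cos (k * arccos x) := by
    intro k
    have := Chebyshev.T_real_cos (arccos x) (k : ℤ)
    rw [cos_arccos hx.1 hx.2] at this
    simpa using this
  unfold fejerPoly fejerFun
  simp only [eval_mul, eval_C, eval_sub, eval_ofNat, eval_finsetSum, e]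
  have : ∑ k ∈ Finset.range m, ((m : ℝ) - k) * cos (k * arccos u) * cos (k * arccos x)
      = (∑ k ∈ Finset.range m, ((m : ℝ) - k) * cos (k * (arccos x - arccos u))
        + ∑ k ∈ Finset.range m, ((m : ℝ) - k) * cos (k * (arccos x + arccos u))) / 2 := by
    rw [← Finset.sum_add_distrib, Finset.sum_div]
    refine Finset.sum_congr rfl fun k _ => ?_
    rw [mul_sub, mul_add, cos_sub, cos_add]; ring
  rw [this]; ring

lemma dirichlet_identity (m : ℕ) (φ : ℝ) :
    (2 * ∑ k ∈ Finset.range (m + 1), cos (k * φ) - 1) * sin (φ / 2) = sin ((2 * m + 1) * (φ / 2)) := by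
  induction m with
  | zero => simp; ring
  | succ m ih =>
    rw [Finset.sum_range_succ]
    have e : (2 * (∑ k ∈ Finset.range (m + 1), cos (k * φ) + cos ((m + 1 : ℕ) * φ)) - 1) * sin (φ / 2)
      = (2 * ∑ k ∈ Finset.range (m + 1), cos (k * φ) - 1) * sin (φ / 2)
        + 2 * cos ((m + 1 : ℕ) * φ) * sin (φ / 2) := by ring
    rw [e, ih]
    have h := sin_sub_sin ((2 * (m + 1 : ℕ) + 1) * (φ / 2)) ((2 * m + 1) * (φ / 2))
    have e1 : ((2 * (m + 1 : ℕ) + 1) * (φ / 2) - (2 * m + 1) * (φ / 2)) / 2 = φ / 2 := by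
      push_cast; ring
    have e2 : ((2 * (m + 1 : ℕ) + 1) * (φ / 2) + (2 * m + 1) * (φ / 2)) / 2 = (m + 1 : ℕ) * φ := by
      push_cast; ring
    rw [e1, e2] at h
    linarith

lemma fejer_identity (m : ℕ) (φ : ℝ) :
    (2 * ∑ k ∈ Finset.range m, ((m : ℝ) - k) * cos (k * φ) - m) * sin (φ / 2) ^ 2
      = sin (m * (φ / 2)) ^ 2 := by
  induction m with
  | zero => simp
  | succ m ih =>
    have e : ∑ k ∈ Finset.range (m + 1), (((m + 1 : ℕ) : ℝ) - k) * cos (k * φ)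
        = ∑ k ∈ Finset.range m, ((m : ℝ) - k) * cos (k * φ)
          + ∑ k ∈ Finset.range (m + 1), cos (k * φ) := by
      have : ∑ k ∈ Finset.range m, ((m : ℝ) - k) * cos (k * φ)
          = ∑ k ∈ Finset.range (m + 1), ((m : ℝ) - k) * cos (k * φ) := by
        rw [Finset.sum_range_succ]; simp
      rw [this, ← Finset.sum_add_distrib]
      refine Finset.sum_congr rfl fun k _ => ?_
      push_cast; ring
    rw [e]
    have d := dirichlet_identity m φ
    have e2 : (2 * (∑ k ∈ Finset.range m, ((m : ℝ) - k) * cos (k * φ)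
          + ∑ k ∈ Finset.range (m + 1), cos (k * φ)) - ((m + 1 : ℕ) : ℝ)) * sin (φ / 2) ^ 2
        = (2 * ∑ k ∈ Finset.range m, ((m : ℝ) - k) * cos (k * φ) - m) * sin (φ / 2) ^ 2
          + (2 * ∑ k ∈ Finset.range (m + 1), cos (k * φ) - 1) * sin (φ / 2) * sin (φ / 2) := by
      push_cast; ring
    rw [e2, ih, d]
    have a1 : (2 * (m : ℝ) + 1) * (φ / 2) = ((m + 1 : ℕ) : ℝ) * (φ / 2) + m * (φ / 2) := by
      push_cast; ring
    have a2 : φ / 2 = ((m + 1 : ℕ) : ℝ) * (φ / 2) - m * (φ / 2) := by push_cast; ring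
    have a3 : sin (φ / 2) = sin (((m + 1 : ℕ) : ℝ) * (φ / 2) - m * (φ / 2)) := by rw [← a2]
    rw [a1, a3, sin_add, sin_sub]
    have p1 := sin_sq_add_cos_sq (m * (φ / 2))
    have p2 := sin_sq_add_cos_sq (((m + 1 : ℕ) : ℝ) * (φ / 2))
    generalize sin (m * (φ / 2)) = a at *
    generalize cos (m * (φ / 2)) = b at *
    generalize sin (((m + 1 : ℕ) : ℝ) * (φ / 2)) = c at *
    generalize cos (((m + 1 : ℕ) : ℝ) * (φ / 2)) = d' at *
    linear_combination c ^ 2 * p1 - a ^ 2 * p2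

lemma fejerFun_mul {m : ℕ} (hm : 0 < m) (φ : ℝ) :
    fejerFun m φ * (m * sin (φ / 2)) ^ 2 = sin (m * (φ / 2)) ^ 2 := by
  rw [← fejer_identity, fejerFun]
  have hm' : (m : ℝ) ≠ 0 := by positivity
  rw [mul_pow]
  generalize 2 * ∑ k ∈ Finset.range m, ((m : ℝ) - k) * cos (k * φ) - m = G
  field_simp

lemma sum_sub_range (m : ℕ) : 2 * ∑ k ∈ Finset.range m, ((m : ℝ) - k) - m = (m : ℝ) ^ 2 := by
  induction m with
  | zero => simp
  | succ m ih =>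
    have : ∑ k ∈ Finset.range (m + 1), (((m + 1 : ℕ) : ℝ) - k)
        = ∑ k ∈ Finset.range m, ((m : ℝ) - k) + (m + 1) := by
      rw [Finset.sum_range_succ, show ∑ k ∈ Finset.range m, (((m + 1 : ℕ) : ℝ) - k)
        = ∑ k ∈ Finset.range m, (((m : ℝ) - k) + 1) from
          Finset.sum_congr rfl fun k _ => by push_cast; ring, Finset.sum_add_distrib]
      simp; ring
    rw [this]; push_cast; linear_combination ih

lemma fejerFun_le_one {m : ℕ} (hm : 0 < m) (φ : ℝ) : fejerFun m φ ≤ 1 := by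
  unfold fejerFun
  have hm' : (0 : ℝ) < m := by exact_mod_cast hm
  rw [inv_mul_le_iff₀ (by positivity), mul_one, ← sum_sub_range]
  gcongr with k hk
  have : (k : ℝ) ≤ m := by exact_mod_cast (Finset.mem_range.mp hk).le
  nlinarith [cos_le_one (k * φ)]

lemma fejerFun_of_sin_eq_zero {m : ℕ} (hm : 0 < m) {φ : ℝ} (h : sin (φ / 2) = 0) :
    fejerFun m φ = 1 := by
  unfold fejerFun
  have hm' : (0 : ℝ) < m := by exact_mod_cast hm
  have : ∀ k : ℕ, cos (k * φ) = 1 := by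
    intro k
    have h1 := abs_sin_nat_mul_le k (φ / 2)
    rw [h, abs_zero, mul_zero] at h1
    have h2 : sin (k * (φ / 2)) = 0 := abs_nonpos_iff.mp h1
    have h3 := cos_two_mul (k * (φ / 2))
    have h4 := sin_sq_add_cos_sq (k * (φ / 2))
    rw [h2] at h4
    rw [show (k : ℝ) * φ = 2 * (k * (φ / 2)) by ring, h3]; linarith
  simp only [this, mul_one]
  rw [sum_sub_range]; field_simp

lemma fejerFun_nonneg {m : ℕ} (hm : 0 < m) (φ : ℝ) : 0 ≤ fejerFun m φ := by
  by_cases h : sin (φ / 2) = 0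
  · rw [fejerFun_of_sin_eq_zero hm h]; exact zero_le_one
  · have h1 := fejerFun_mul hm φ
    have hm' : (0 : ℝ) < m := by exact_mod_cast hm
    have h2 : 0 < (m * sin (φ / 2)) ^ 2 := by positivity
    by_contra! hc
    nlinarith [sq_nonneg (sin (m * (φ / 2)))]

lemma eval_fejerPoly_nonneg {m : ℕ} (hm : 0 < m) (u : ℝ) {x : ℝ} (hx : x ∈ Set.Icc (-1 : ℝ) 1) :
    0 ≤ (fejerPoly m u).eval x := by
  rw [eval_fejerPoly m u hx]
  linarith [fejerFun_nonneg hm (arccos x - arccos u), fejerFun_nonneg hm (arccos x + arccos u)]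

lemma eval_fejerPoly_le_one {m : ℕ} (hm : 0 < m) (u : ℝ) {x : ℝ} (hx : x ∈ Set.Icc (-1 : ℝ) 1) :
    (fejerPoly m u).eval x ≤ 1 := by
  rw [eval_fejerPoly m u hx]
  linarith [fejerFun_le_one hm (arccos x - arccos u), fejerFun_le_one hm (arccos x + arccos u)]

lemma half_le_eval_fejerPoly_self {m : ℕ} (hm : 0 < m) {u : ℝ} (hu : u ∈ Set.Icc (-1 : ℝ) 1) :
    1 / 2 ≤ (fejerPoly m u).eval u := by
  rw [eval_fejerPoly m u hu, fejerFun_of_sin_eq_zero hm (φ := arccos u - arccos u) (by simp)]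
  linarith [fejerFun_nonneg hm (arccos u + arccos u)]

lemma eval_fejerPoly_mul_relDist_sq_le {m : ℕ} (hm : 0 < m) (u : ℝ) {x : ℝ}
    (hx : x ∈ Set.Icc (-1 : ℝ) 1) : (fejerPoly m u).eval x * relDist m x u ^ 2 ≤ 40 := by
  have h0 := eval_fejerPoly_nonneg hm u hx
  have h1 := eval_fejerPoly_le_one hm u hx
  obtain ⟨a, -, c⟩ := sin_half_sum_bounds (x := x) (u := u)
  have hm' : (0 : ℝ) < m := by exact_mod_cast hm
  unfold relDist
  set δ := |arccos x - arccos u| with hδ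
  have hd : 0 ≤ δ := abs_nonneg _
  by_cases hs : m * δ ≤ 1
  · have : 0 ≤ m * δ := by positivity
    nlinarith [mul_nonneg this h0]
  push Not at hs
  have hδ0 : 0 < δ := by
    by_contra! h
    nlinarith
  have hpi := pi_pos
  have hpi2 := pi_lt_d2
  have key : ∀ φ, δ / π ≤ |sin (φ / 2)| → fejerFun m φ * (m * δ) ^ 2 ≤ π ^ 2 := by
    intro φ hφ
    have e := fejerFun_mul hm φ
    have e1 : (m * (δ / π)) ^ 2 ≤ (m * sin (φ / 2)) ^ 2 := by
      rw [mul_pow, mul_pow, ← sq_abs (sin (φ / 2))]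
      gcongr
    have e2 : sin (m * (φ / 2)) ^ 2 ≤ 1 := sin_sq_le_one _
    have e3 := mul_le_mul_of_nonneg_left e1 (fejerFun_nonneg hm φ)
    have e4 : fejerFun m φ * (m * δ) ^ 2 = π ^ 2 * (fejerFun m φ * (m * (δ / π)) ^ 2) := by
      field_simp
    rw [e4]
    nlinarith [sq_nonneg π]
  have k1 := key (arccos x - arccos u) (by
    refine c.trans ?_
    rcases le_total 0 (arccos x - arccos u) with h | h
    · rw [hδ, abs_of_nonneg h]; exact le_abs_self _
    · rw [hδ, abs_of_nonpos h, neg_div, sin_neg]; exact neg_le_abs _)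
  have k2 := key (arccos x + arccos u) ((c.trans a).trans (le_abs_self _))
  have e := eval_fejerPoly m u hx
  have k3 : (fejerPoly m u).eval x * (m * δ) ^ 2 ≤ π ^ 2 := by rw [e]; linarith
  nlinarith [mul_nonneg h0 (show 0 ≤ (m * δ - 1) * (3 * (m * δ) + 1) by
    apply mul_nonneg <;> nlinarith)]

lemma eval_fejerPoly_lower {m : ℕ} (hm : 0 < m) (u : ℝ) {x : ℝ} (hx : x ∈ Set.Icc (-1 : ℝ) 1)
    (h : m * |arccos x - arccos u| ≤ 3 * π / 2) : 1 / 100 ≤ (fejerPoly m u).eval x := by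
  have hm' : (0 : ℝ) < m := by exact_mod_cast hm
  have hpi := pi_pos
  have hpi2 := pi_lt_d2
  suffices 1 / 50 ≤ fejerFun m (arccos x - arccos u) by
    rw [eval_fejerPoly m u hx]
    linarith [fejerFun_nonneg hm (arccos x + arccos u)]
  set φ := arccos x - arccos u
  by_cases hs : sin (φ / 2) = 0
  · rw [fejerFun_of_sin_eq_zero hm hs]; norm_num
  have e := fejerFun_mul hm φ
  set ψ := m * |φ| / 4 with hψ
  have hψ0 : 0 ≤ ψ := by positivity
  have e1 : sin (m * (φ / 2)) ^ 2 = sin (2 * ψ) ^ 2 := by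
    rcases le_total 0 φ with h | h
    · rw [hψ, abs_of_nonneg h]; ring_nf
    · rw [hψ, abs_of_nonpos h, show 2 * (m * -φ / 4) = -(m * (φ / 2)) by ring, sin_neg, neg_sq]
  have s1 := mul_le_sin (x := ψ) hψ0 (by linarith)
  have s2 := one_sub_mul_le_cos (x := ψ) hψ0 (by linarith)
  have s3 : 1 / 4 ≤ cos ψ := by
    have : 2 / π * ψ ≤ 3 / 4 := by
      rw [div_mul_eq_mul_div, div_le_iff₀ hpi]; linarith
    linarith
  have s4 : ψ / π ≤ sin (2 * ψ) := by
    rw [sin_two_mul]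
    have : 0 ≤ 2 / π * ψ := by positivity
    have e5 : ψ / π = 2 * (2 / π * ψ) * (1 / 4) := by ring
    rw [e5]
    have : 0 ≤ sin ψ := by linarith
    gcongr
  have s5 : (ψ / π) ^ 2 ≤ sin (m * (φ / 2)) ^ 2 := by
    rw [e1]; gcongr
  have s6 : (m * sin (φ / 2)) ^ 2 ≤ (2 * ψ) ^ 2 := by
    have a1 : |sin (φ / 2)| ≤ |φ / 2| := abs_sin_le_abs
    rw [abs_div, abs_two] at a1
    have : 2 * ψ = m * (|φ| / 2) := by rw [hψ]; ring
    rw [this, mul_pow, mul_pow, ← sq_abs (sin _)]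
    gcongr
  have hpos : 0 < (m * sin (φ / 2)) ^ 2 := by positivity
  have hψ2 : 0 < ψ ^ 2 := by nlinarith
  have hF := fejerFun_nonneg hm φ
  rw [← e] at s5
  have s7 : (ψ / π) ^ 2 ≤ fejerFun m φ * (2 * ψ) ^ 2 := s5.trans (by gcongr)
  rw [div_pow, div_le_iff₀ (by positivity)] at s7
  have s8 : 1 ≤ fejerFun m φ * 4 * π ^ 2 := by
    by_contra! hc
    nlinarith
  nlinarith

lemma abs_eval_fejerPoly_sub_mul_rho_le {m : ℕ} (hm : 0 < m) (u : ℝ) {x z : ℝ}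
    (hx : x ∈ Set.Icc (-1 : ℝ) 1) (hz : z ∈ Set.Icc (-1 : ℝ) 1) :
    |(fejerPoly m u).eval x - (fejerPoly m u).eval z| * rho m x ≤ 10 * |x - z| := by
  have e : ∀ y ∈ Set.Icc (-1 : ℝ) 1, ∀ k : ℕ,
      (Chebyshev.T ℝ (k : ℤ)).eval y = cos (k * arccos y) := by
    intro y hy k
    have := Chebyshev.T_real_cos (arccos y) (k : ℤ)
    rw [cos_arccos hy.1 hy.2] at this
    simpa using this
  have hm' : (0 : ℝ) < m := by exact_mod_cast hm
  have hr := rho_pos hm x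
  have e1 : (fejerPoly m u).eval x - (fejerPoly m u).eval z = ((m : ℝ) ^ 2)⁻¹ *
      (2 * ∑ k ∈ Finset.range m, ((m : ℝ) - k) * cos (k * arccos u) *
        (cos (k * arccos x) - cos (k * arccos z))) := by
    unfold fejerPoly
    simp only [eval_mul, eval_C, eval_sub, eval_ofNat, eval_finsetSum, e x hx, e z hz, mul_sub,
      Finset.sum_sub_distrib]
    ring
  rw [e1, abs_mul, abs_mul, abs_two, abs_of_nonneg (by positivity : (0 : ℝ) ≤ ((m : ℝ) ^ 2)⁻¹)]
  have e2 : |∑ k ∈ Finset.range m, ((m : ℝ) - k) * cos (k * arccos u) *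
        (cos (k * arccos x) - cos (k * arccos z))| * rho m x
      ≤ ∑ k ∈ Finset.range m, m * (5 * |x - z|) := by
    refine (mul_le_mul_of_nonneg_right (Finset.abs_sum_le_sum_abs _ _) hr.le).trans ?_
    rw [Finset.sum_mul]
    refine Finset.sum_le_sum fun k hk => ?_
    have hk' := (Finset.mem_range.mp hk).le
    have h1 := abs_cos_sub_cos_mul_rho_le hm hk' hx hz
    have hk2 : (k : ℝ) ≤ m := by exact_mod_cast hk'
    rw [abs_mul, mul_assoc]
    have h2 : |((m : ℝ) - k) * cos (k * arccos u)| ≤ m := by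
      rw [abs_mul, abs_of_nonneg (by linarith : (0 : ℝ) ≤ m - k)]
      have := abs_cos_le_one (k * arccos u)
      have h4 : (0 : ℝ) ≤ k := by positivity
      nlinarith [abs_nonneg (cos (k * arccos u))]
    exact mul_le_mul h2 h1 (by positivity) (by positivity)
  rw [Finset.sum_const, Finset.card_range, nsmul_eq_mul] at e2
  calc _ = ((m : ℝ) ^ 2)⁻¹ * 2 * (|∑ k ∈ Finset.range m, ((m : ℝ) - k) * cos (k * arccos u) *
        (cos (k * arccos x) - cos (k * arccos z))| * rho m x) := by ring
    _ ≤ ((m : ℝ) ^ 2)⁻¹ * 2 * (m * (m * (5 * |x - z|))) := by gcongr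
    _ = 10 * |x - z| := by field_simp; ring

lemma exists_derivative_eq (p : ℝ[X]) : ∃ q : ℝ[X], derivative q = p ∧ q.natDegree ≤ p.natDegree + 1 := by
  refine ⟨∑ i ∈ Finset.range (p.natDegree + 1), C (p.coeff i / (i + 1)) * X ^ (i + 1), ?_, ?_⟩
  · rw [derivative_sum]
    conv_rhs => rw [p.as_sum_range_C_mul_X_pow]
    refine Finset.sum_congr rfl fun i _ => ?_
    rw [derivative_C_mul_X_pow]
    have : (i : ℝ) + 1 ≠ 0 := by positivity
    congr 2
    push_cast; field_simp
  · refine natDegree_sum_le_of_forall_le _ _ fun i hi => ?_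
    refine (natDegree_C_mul_X_pow_le _ _).trans ?_
    have := Finset.mem_range.mp hi; omega

lemma abs_arccos_sub_anti {u x t : ℝ} (h1 : u ≤ x) (h2 : x ≤ t) :
    |arccos x - arccos u| ≤ |arccos t - arccos u| := by
  have a := antitone_arccos h1
  have b := antitone_arccos h2
  rw [abs_of_nonpos (by linarith), abs_of_nonpos (by linarith)]; linarith

lemma abs_arccos_sub_anti' {u x t : ℝ} (h1 : x ≤ u) (h2 : t ≤ x) :
    |arccos x - arccos u| ≤ |arccos t - arccos u| := by
  have a := antitone_arccos h1
  have b := antitone_arccos h2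
  rw [abs_of_nonneg (by linarith), abs_of_nonneg (by linarith)]; linarith

lemma relDist_mono_of_abs {m : ℕ} {x t u : ℝ}
    (h : |arccos x - arccos u| ≤ |arccos t - arccos u|) : relDist m x u ≤ relDist m t u := by
  unfold relDist; gcongr

lemma relDist_le_of_mem_uIcc {m : ℕ} {x z t : ℝ} (ht : t ∈ Set.uIcc x z) :
    relDist m x t ≤ relDist m x z := by
  rw [relDist_comm m x t, relDist_comm m x z]
  apply relDist_mono_of_abs
  rcases le_total x z with h | h
  · rw [Set.uIcc_of_le h] at ht; exact abs_arccos_sub_anti ht.1 ht.2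
  · rw [Set.uIcc_of_ge h] at ht; exact abs_arccos_sub_anti' ht.2 ht.1

lemma increment_le_of_decay {R K : ℝ → ℝ} {u x y ρ A : ℝ} (hρ : 0 < ρ) (hA : 0 ≤ A)
    (hux : u ≤ x) (hxy : x ≤ y) (hR : ∀ t ∈ Set.Icc x y, HasDerivAt R (K t) t)
    (hK : ∀ t ∈ Set.Icc x y, K t * (1 + (t - u) / ρ) ^ 2 ≤ A) : R y - R x ≤ A * ρ := by
  have hpos : ∀ t ∈ Set.Icc x y, 0 < 1 + (t - u) / ρ := by
    intro t ht
    have : 0 ≤ (t - u) / ρ := div_nonneg (by linarith [ht.1]) hρ.le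
    linarith
  let G : ℝ → ℝ := fun t => R t + A * ρ * (1 + (t - u) / ρ)⁻¹
  have hG : ∀ t ∈ Set.Icc x y, HasDerivAt G (K t + A * ρ * (-(1 / ρ) / (1 + (t - u) / ρ) ^ 2)) t := by
    intro t ht
    have h1 : HasDerivAt (fun t => 1 + (t - u) / ρ) (1 / ρ) t :=
      (((hasDerivAt_id t).sub_const u).div_const ρ).const_add 1
    exact (hR t ht).add ((h1.inv (hpos t ht).ne').const_mul (A * ρ))
  have hanti : AntitoneOn G (Set.Icc x y) := by
    apply antitoneOn_of_deriv_nonpos (convex_Icc x y)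
    · exact fun t ht => (hG t ht).continuousAt.continuousWithinAt
    · intro t ht; rw [interior_Icc] at ht
      exact (hG t (Set.Ioo_subset_Icc_self ht)).differentiableAt.differentiableWithinAt
    · intro t ht; rw [interior_Icc] at ht
      have ht' := Set.Ioo_subset_Icc_self ht
      rw [(hG t ht').deriv]
      have hp := hpos t ht'
      have e : A * ρ * (-(1 / ρ) / (1 + (t - u) / ρ) ^ 2) = -(A / (1 + (t - u) / ρ) ^ 2) := by
        field_simp
      rw [e]
      have := (le_div_iff₀ (by positivity : 0 < (1 + (t - u) / ρ) ^ 2)).mpr (hK t ht')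
      linarith
  have h := hanti ⟨le_rfl, hxy⟩ ⟨hxy, le_rfl⟩ hxy
  simp only [G] at h
  have h1 : 0 < (1 + (y - u) / ρ)⁻¹ := inv_pos.mpr (hpos y ⟨hxy, le_rfl⟩)
  have h2 : (1 + (x - u) / ρ)⁻¹ ≤ 1 := by
    apply inv_le_one_of_one_le₀
    have : 0 ≤ (x - u) / ρ := div_nonneg (by linarith) hρ.le
    linarith
  have h3 : 0 ≤ A * ρ := by positivity
  nlinarith [mul_le_mul_of_nonneg_left h2 h3, mul_nonneg h3 h1.le]

lemma increment_le_of_decay' {R K : ℝ → ℝ} {u x y ρ A : ℝ} (hρ : 0 < ρ) (hA : 0 ≤ A)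
    (hux : y ≤ u) (hxy : x ≤ y) (hR : ∀ t ∈ Set.Icc x y, HasDerivAt R (K t) t)
    (hK : ∀ t ∈ Set.Icc x y, K t * (1 + (u - t) / ρ) ^ 2 ≤ A) : R y - R x ≤ A * ρ := by
  have := increment_le_of_decay (R := fun t => -R (-t)) (K := fun t => K (-t)) (u := -u)
    (x := -y) (y := -x) hρ hA (by linarith) (by linarith) (by
      intro t ht
      have h := (hR (-t) ⟨by linarith [ht.2], by linarith [ht.1]⟩).comp t (hasDerivAt_neg t)
      have h2 := h.neg
      rw [mul_neg_one, neg_neg] at h2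
      exact h2) (by
      intro t ht
      have h := hK (-t) ⟨by linarith [ht.2], by linarith [ht.1]⟩
      rwa [show u - -t = t - -u by ring] at h)
  simp only [neg_neg] at this
  linarith

/-- Polynomials approximating the step function with jump at `u`, equal to `1` on the left. -/
theorem exists_stepPoly (b : ℕ) : ∃ C : ℝ, 0 < C ∧ ∀ m : ℕ, 0 < m → ∀ u ∈ Set.Icc (-1 : ℝ) 1,
    1 / 2 ≤ m * arccos u → ∃ σ : ℝ[X], σ.natDegree ≤ (b + 3) * m ∧
      (∀ x ∈ Set.Icc (-1 : ℝ) 1, u ≤ x → |σ.eval x| * relDist m x u ^ (2 * b) ≤ C) ∧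
      (∀ x ∈ Set.Icc (-1 : ℝ) 1, x ≤ u → |σ.eval x - 1| * relDist m x u ^ (2 * b) ≤ C) ∧
      (∀ x ∈ Set.Icc (-1 : ℝ) 1, ∀ z ∈ Set.Icc (-1 : ℝ) 1, relDist m x z ≤ 2 →
        |σ.eval x - σ.eval z| * relDist m x u ^ (2 * b) * rho m x ≤ C * |x - z|) := by
  set K0 : ℝ := 40 ^ (b + 2) with hK0
  set L0 : ℝ := 100 ^ (b + 2) * 27 with hL0
  have hK0p : 0 < K0 := by positivity
  have hL0p : 0 < L0 := by positivity
  refine ⟨K0 * 4 ^ (b + 2) * L0, by positivity, fun m hm u hu hu2 => ?_⟩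
  have hm' : (0 : ℝ) < m := by exact_mod_cast hm
  obtain ⟨R, hR, hRdeg⟩ := exists_derivative_eq (fejerPoly m u ^ (b + 2))
  have hRd : ∀ t, HasDerivAt (fun t => R.eval t) ((fejerPoly m u).eval t ^ (b + 2)) t := by
    intro t
    have := R.hasDerivAt t
    rwa [hR, eval_pow] at this
  have hKb : ∀ t ∈ Set.Icc (-1 : ℝ) 1,
      (fejerPoly m u).eval t ^ (b + 2) * relDist m t u ^ (2 * b + 4) ≤ K0 := by
    intro t ht
    have h1 := eval_fejerPoly_mul_relDist_sq_le hm u ht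
    have h0 := eval_fejerPoly_nonneg hm u ht
    have hd := relDist_pos m t u
    rw [show 2 * b + 4 = 2 * (b + 2) by ring, pow_mul, ← mul_pow]
    exact pow_le_pow_left₀ (by positivity) h1 _
  have hKn : ∀ t ∈ Set.Icc (-1 : ℝ) 1, 0 ≤ (fejerPoly m u).eval t ^ (b + 2) :=
    fun t ht => pow_nonneg (eval_fejerPoly_nonneg hm u ht) _
  have hρ := rho_pos hm u
  have hmono : MonotoneOn (fun t => R.eval t) (Set.Icc (-1 : ℝ) 1) := by
    apply monotoneOn_of_deriv_nonneg (convex_Icc _ _)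
    · exact R.continuous.continuousOn
    · exact R.differentiable.differentiableOn
    · intro t ht; rw [interior_Icc] at ht
      rw [(hRd t).deriv]; exact hKn t (Set.Ioo_subset_Icc_self ht)
  have hfar : ∀ x ∈ Set.Icc (-1 : ℝ) 1, ∀ t ∈ Set.Icc (-1 : ℝ) 1, relDist m x u ≤ relDist m t u →
      (fejerPoly m u).eval t ^ (b + 2) * (1 + |t - u| / rho m u) ^ 2
        ≤ 4 * K0 / relDist m x u ^ (2 * b) := by
    intro x hx t ht hxt
    have h1 := abs_sub_le_rho_mul hm ht hu
    have h2 := hKb t ht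
    have hDx := relDist_pos m x u
    have hDt := one_le_relDist m t u
    have h3 : 1 + |t - u| / rho m u ≤ 2 * relDist m t u ^ 2 := by
      have : |t - u| / rho m u ≤ relDist m t u ^ 2 := by
        rw [div_le_iff₀ hρ]; linarith
      nlinarith
    have h4 : (1 + |t - u| / rho m u) ^ 2 ≤ 4 * relDist m t u ^ 4 := by
      have : 0 ≤ |t - u| / rho m u := by positivity
      calc (1 + |t - u| / rho m u) ^ 2 ≤ (2 * relDist m t u ^ 2) ^ 2 := by gcongr
        _ = _ := by ring
    rw [le_div_iff₀ (by positivity)]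
    have h5 : relDist m x u ^ (2 * b) ≤ relDist m t u ^ (2 * b) := by gcongr
    have h6 := hKn t ht
    calc (fejerPoly m u).eval t ^ (b + 2) * (1 + |t - u| / rho m u) ^ 2 * relDist m x u ^ (2 * b)
        ≤ (fejerPoly m u).eval t ^ (b + 2) * (4 * relDist m t u ^ 4) * relDist m t u ^ (2 * b) := by
          gcongr
      _ = 4 * ((fejerPoly m u).eval t ^ (b + 2) * relDist m t u ^ (2 * b + 4)) := by ring
      _ ≤ 4 * K0 := by linarith
  have hright : ∀ x ∈ Set.Icc (-1 : ℝ) 1, u ≤ x →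
      R.eval 1 - R.eval x ≤ 4 * K0 / relDist m x u ^ (2 * b) * rho m u := by
    intro x hx hux
    have hDx := relDist_pos m x u
    refine increment_le_of_decay (R := fun t => R.eval t)
      (K := fun t => (fejerPoly m u).eval t ^ (b + 2)) hρ (by positivity) hux hx.2
      (fun t _ => hRd t) fun t ht => ?_
    have := hfar x hx t ⟨by linarith [ht.1, hx.1], ht.2⟩
      (relDist_mono_of_abs (abs_arccos_sub_anti hux ht.1))
    rwa [abs_of_nonneg (by linarith [ht.1])] at this
  have hleft : ∀ x ∈ Set.Icc (-1 : ℝ) 1, x ≤ u →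
      R.eval x - R.eval (-1) ≤ 4 * K0 / relDist m x u ^ (2 * b) * rho m u := by
    intro x hx hux
    have hDx := relDist_pos m x u
    refine increment_le_of_decay' (R := fun t => R.eval t)
      (K := fun t => (fejerPoly m u).eval t ^ (b + 2)) hρ (by positivity) hux hx.1
      (fun t _ => hRd t) fun t ht => ?_
    have := hfar x hx t ⟨ht.1, by linarith [ht.2, hx.2]⟩
      (relDist_mono_of_abs (abs_arccos_sub_anti' hux ht.2))
    rwa [abs_of_nonpos (by linarith [ht.2]), neg_sub] at this
  have hT : rho m u ≤ L0 * (R.eval 1 - R.eval (-1)) := by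
    set v := cos (arccos u - 1 / (2 * m)) with hv
    have hpi := pi_gt_three
    have hnn : 0 ≤ arccos u - 1 / (2 * m) := by
      rw [sub_nonneg, div_le_iff₀ (by positivity)]; linarith
    have hin : 0 ≤ 1 / (2 * (m : ℝ)) := by positivity
    have hav : arccos v = arccos u - 1 / (2 * m) :=
      arccos_cos hnn (by linarith [arccos_le_pi u])
    have hvI : v ∈ Set.Icc (-1 : ℝ) 1 := ⟨neg_one_le_cos _, cos_le_one _⟩
    have huv : u ≤ v := by
      rw [← cos_arccos hu.1 hu.2]
      exact cos_le_cos_of_nonneg_of_le_pi hnn (arccos_le_pi u) (by linarith)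
    have hdist : m * |arccos u - arccos v| = 1 / 2 := by
      rw [hav, sub_sub_cancel, abs_of_nonneg hin]; field_simp
    have h1 := rho_le_of_half_le hm hu hvI (by rw [hdist])
    rw [abs_sub_comm, abs_of_nonneg (by linarith)] at h1
    have h2 : (1 / 100) ^ (b + 2) * (v - u) ≤ R.eval v - R.eval u := by
      refine Convex.mul_sub_le_image_sub_of_le_deriv (convex_Icc u v) (f := fun t => R.eval t)
        R.continuous.continuousOn R.differentiable.differentiableOn ?_ u ⟨le_rfl, huv⟩ v
        ⟨huv, le_rfl⟩ huv
      intro t ht; rw [interior_Icc] at ht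
      rw [(hRd t).deriv]
      have htI : t ∈ Set.Icc (-1 : ℝ) 1 := ⟨by linarith [ht.1, hu.1], by linarith [ht.2, hvI.2]⟩
      refine pow_le_pow_left₀ (by norm_num) (eval_fejerPoly_lower hm u htI ?_) _
      have := abs_arccos_sub_anti ht.1.le ht.2.le
      rw [abs_sub_comm (arccos v)] at this
      nlinarith
    have h3 : R.eval (-1) ≤ R.eval u := hmono ⟨le_rfl, by norm_num⟩ hu hu.1
    have h4 : R.eval v ≤ R.eval 1 := hmono hvI ⟨by norm_num, le_rfl⟩ hvI.2
    have e : L0 * ((1 / 100) ^ (b + 2) * (v - u)) = 27 * (v - u) := by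
      rw [hL0, one_div, inv_pow]; field_simp
    have h5 : L0 * ((1 / 100) ^ (b + 2) * (v - u)) ≤ L0 * (R.eval 1 - R.eval (-1)) := by
      gcongr; linarith
    linarith
  set T := R.eval 1 - R.eval (-1) with hTd
  have hTpos : 0 < T := by
    by_contra! h
    nlinarith
  have hbig : 4 * K0 * L0 ≤ K0 * 4 ^ (b + 2) * L0 := by
    have : (4 : ℝ) ^ 1 ≤ 4 ^ (b + 2) := pow_le_pow_right₀ (by norm_num) (by omega)
    have h2 := mul_le_mul_of_nonneg_left this (mul_pos hK0p hL0p).le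
    linarith
  have hnorm : ∀ s D : ℝ, 0 < D → 0 ≤ s → s ≤ 4 * K0 / D * rho m u → s / T * D ≤ K0 * 4 ^ (b + 2) * L0 := by
    intro s D hD hs h
    rw [div_mul_eq_mul_div, le_div_iff₀ hD] at h
    rw [div_mul_eq_mul_div, div_le_iff₀ hTpos]
    have h1 : 4 * K0 * rho m u ≤ 4 * K0 * (L0 * T) := by gcongr
    nlinarith [mul_le_mul_of_nonneg_right hbig hTpos.le]
  refine ⟨C (1 / T) * (C (R.eval 1) - R), ?_, ?_, ?_, ?_⟩
  · refine (natDegree_C_mul_le _ _).trans ((natDegree_sub_le _ _).trans ?_)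
    rw [natDegree_C]
    refine max_le (Nat.zero_le _) (hRdeg.trans ?_)
    have := natDegree_pow_le_of_le (b + 2) (natDegree_fejerPoly_le m u)
    nlinarith
  · intro x hx hux
    have h1 : R.eval x ≤ R.eval 1 := hmono hx ⟨by norm_num, le_rfl⟩ hx.2
    have e : |(C (1 / T) * (C (R.eval 1) - R)).eval x| = (R.eval 1 - R.eval x) / T := by
      simp only [eval_mul, eval_C, eval_sub]
      rw [abs_of_nonneg (mul_nonneg (by positivity) (by linarith))]; ring
    rw [e]
    exact hnorm _ _ (pow_pos (relDist_pos m x u) _) (by linarith) (hright x hx hux)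
  · intro x hx hux
    have h1 : R.eval (-1) ≤ R.eval x := hmono ⟨le_rfl, by norm_num⟩ hx hx.1
    have e : |(C (1 / T) * (C (R.eval 1) - R)).eval x - 1| = (R.eval x - R.eval (-1)) / T := by
      simp only [eval_mul, eval_C, eval_sub]
      have : 1 / T * (R.eval 1 - R.eval x) - 1 = -((R.eval x - R.eval (-1)) / T) := by
        field_simp; rw [hTd]; ring
      rw [this, abs_neg, abs_of_nonneg (div_nonneg (by linarith) hTpos.le)]
    rw [e]
    exact hnorm _ _ (pow_pos (relDist_pos m x u) _) (by linarith) (hleft x hx hux)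
  · intro x hx z hz hxz
    have hDx := relDist_pos m x u
    set A := K0 * 4 ^ (b + 2) / relDist m x u ^ (2 * b + 4) with hA
    have hmvt : |R.eval z - R.eval x| ≤ A * |z - x| := by
      have := Convex.norm_image_sub_le_of_norm_hasDerivWithin_le (f := fun t => R.eval t)
        (f' := fun t => (fejerPoly m u).eval t ^ (b + 2)) (C := A) (s := Set.uIcc x z) (x := x) (y := z)
        (fun t _ => (hRd t).hasDerivWithinAt) ?_ (convex_uIcc x z) Set.left_mem_uIcc
        Set.right_mem_uIcc
      · simpa [Real.norm_eq_abs] using this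
      intro t ht
      have htI : t ∈ Set.Icc (-1 : ℝ) 1 := Set.uIcc_subset_Icc hx hz ht
      rw [Real.norm_eq_abs, abs_of_nonneg (hKn t htI), hA, le_div_iff₀ (by positivity)]
      have h1 : relDist m x u ≤ 2 * relDist m t u :=
        (relDist_triangle m x t u).trans (by
          gcongr
          · exact (relDist_pos m t u).le
          · exact (relDist_le_of_mem_uIcc ht).trans hxz)
      have h2 : relDist m x u ^ (2 * b + 4) ≤ (2 * relDist m t u) ^ (2 * b + 4) := by gcongr
      have h3 := hKn t htI
      calc _ ≤ (fejerPoly m u).eval t ^ (b + 2) * (2 * relDist m t u) ^ (2 * b + 4) := by gcongr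
        _ = ((fejerPoly m u).eval t ^ (b + 2) * relDist m t u ^ (2 * b + 4)) * 4 ^ (b + 2) := by
          rw [mul_pow, show (2 : ℝ) ^ (2 * b + 4) = 4 ^ (b + 2) by
            rw [show 2 * b + 4 = 2 * (b + 2) by ring, pow_mul]; norm_num]
          ring
        _ ≤ _ := by gcongr; exact hKb t htI
    have e : |(C (1 / T) * (C (R.eval 1) - R)).eval x - (C (1 / T) * (C (R.eval 1) - R)).eval z|
        = |R.eval z - R.eval x| / T := by
      simp only [eval_mul, eval_C, eval_sub]
      rw [← mul_sub, show R.eval 1 - R.eval x - (R.eval 1 - R.eval z) = R.eval z - R.eval x by ring,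
        abs_mul, abs_of_pos (by positivity : 0 < 1 / T)]
      ring
    rw [e]
    have hr := rho_le_relDist_mul hm x u
    have hrx := rho_pos hm x
    have hD1 := one_le_relDist m x u
    rw [abs_sub_comm z x] at hmvt
    calc |R.eval z - R.eval x| / T * relDist m x u ^ (2 * b) * rho m x
        ≤ (A * |x - z|) / T * relDist m x u ^ (2 * b) * (relDist m x u * (L0 * T)) := by
          gcongr
          exact hr.trans (by gcongr)
      _ = (K0 * 4 ^ (b + 2) * L0) * |x - z| *
            (relDist m x u ^ (2 * b + 1) / relDist m x u ^ (2 * b + 4)) := by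
          rw [hA]; field_simp; ring
      _ ≤ (K0 * 4 ^ (b + 2) * L0) * |x - z| * 1 := by
          gcongr
          rw [div_le_one (by positivity)]
          exact pow_le_pow_right₀ hD1 (by omega)
      _ = _ := by ring

/-- `g` is localized at `u` to order `β`, and is Lipschitz on the scale `ρ_m`. -/
def Localized (m : ℕ) (u : ℝ) (β : ℕ) (K : ℝ) (g : ℝ[X]) : Prop :=
  (∀ x ∈ Set.Icc (-1 : ℝ) 1, |g.eval x| * relDist m x u ^ β ≤ K) ∧
  ∀ x ∈ Set.Icc (-1 : ℝ) 1, ∀ w ∈ Set.Icc (-1 : ℝ) 1, relDist m x w ≤ 2 →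
    |g.eval x - g.eval w| * relDist m x u ^ β * rho m x ≤ K * |x - w|

lemma Localized.nonneg {m : ℕ} {u : ℝ} {β : ℕ} {K : ℝ} {g : ℝ[X]} (h : Localized m u β K g) :
    0 ≤ K :=
  le_trans (by have := relDist_pos m 0 u; positivity) (h.1 0 ⟨by norm_num, by norm_num⟩)

lemma Localized.mono {m : ℕ} {u : ℝ} {β : ℕ} {K K' : ℝ} {g : ℝ[X]} (h : Localized m u β K g)
    (hK : K ≤ K') : Localized m u β K' g :=
  ⟨fun x hx => (h.1 x hx).trans hK, fun x hx w hw hxw =>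
    (h.2 x hx w hw hxw).trans (by gcongr)⟩

lemma Localized.C_mul {m : ℕ} {u : ℝ} {β : ℕ} {K : ℝ} {g : ℝ[X]} (h : Localized m u β K g)
    (a : ℝ) : Localized m u β (|a| * K) (C a * g) := by
  refine ⟨fun x hx => ?_, fun x hx w hw hxw => ?_⟩
  · rw [eval_mul, eval_C, abs_mul, mul_assoc]
    exact mul_le_mul_of_nonneg_left (h.1 x hx) (abs_nonneg a)
  · rw [eval_mul, eval_C, eval_mul, eval_C, ← mul_sub, abs_mul, mul_assoc, mul_assoc, mul_assoc]
    refine mul_le_mul_of_nonneg_left ?_ (abs_nonneg a)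
    have := h.2 x hx w hw hxw
    linarith

lemma Localized.mul {m : ℕ} {u : ℝ} {β β' : ℕ} {K K' : ℝ} {g g' : ℝ[X]} (hm : 0 < m)
    (h : Localized m u β K g) (h' : Localized m u β' K' g') :
    Localized m u (β + β') ((2 ^ β' + 1) * K * K') (g * g') := by
  have hK := h.nonneg
  have hK' := h'.nonneg
  refine ⟨fun x hx => ?_, fun x hx w hw hxw => ?_⟩
  · rw [eval_mul, abs_mul, pow_add]
    have hD := relDist_pos m x u
    have h1 := mul_le_mul (h.1 x hx) (h'.1 x hx) (by positivity) hK
    have h2 : 0 ≤ (2 : ℝ) ^ β' * K * K' := by positivity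
    nlinarith
  · have hD := relDist_pos m x u
    have hDw := relDist_pos m w u
    have hr := rho_pos hm x
    have hxw' : relDist m x u ≤ 2 * relDist m w u :=
      (relDist_triangle m x w u).trans (by gcongr)
    have a1 : |g'.eval w| * relDist m x u ^ β' ≤ 2 ^ β' * K' :=
      calc _ ≤ |g'.eval w| * (2 * relDist m w u) ^ β' := by gcongr
        _ = 2 ^ β' * (|g'.eval w| * relDist m w u ^ β') := by rw [mul_pow]; ring
        _ ≤ _ := by gcongr; exact h'.1 w hw
    have e : (g * g').eval x - (g * g').eval w
        = (g.eval x - g.eval w) * g'.eval w + g.eval x * (g'.eval x - g'.eval w) := by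
      simp only [eval_mul]; ring
    rw [e, pow_add]
    calc _ ≤ (|g.eval x - g.eval w| * |g'.eval w| + |g.eval x| * |g'.eval x - g'.eval w|)
            * (relDist m x u ^ β * relDist m x u ^ β') * rho m x := by
          gcongr
          rw [← abs_mul, ← abs_mul]; exact abs_add_le _ _
      _ = (|g.eval x - g.eval w| * relDist m x u ^ β * rho m x) * (|g'.eval w| * relDist m x u ^ β')
          + (|g.eval x| * relDist m x u ^ β)
            * (|g'.eval x - g'.eval w| * relDist m x u ^ β' * rho m x) := by ring
      _ ≤ (K * |x - w|) * (2 ^ β' * K') + K * (K' * |x - w|) := by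
          have b1 := h.2 x hx w hw hxw
          have b2 := h.1 x hx
          have b3 := h'.2 x hx w hw hxw
          gcongr
      _ = _ := by ring

lemma localized_one (m : ℕ) (u : ℝ) : Localized m u 0 1 1 := by
  refine ⟨fun x _ => by simp, fun x _ w _ _ => by simp⟩

lemma localized_fejer_sq {m : ℕ} (hm : 0 < m) {u : ℝ} :
    Localized m u 2 2000 (fejerPoly m u ^ 2) := by
  refine ⟨fun x hx => ?_, fun x hx w hw hxw => ?_⟩
  · have h1 := eval_fejerPoly_nonneg hm u hx
    have h2 := eval_fejerPoly_le_one hm u hx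
    have h3 := eval_fejerPoly_mul_relDist_sq_le hm u hx
    have hD := relDist_pos m x u
    rw [eval_pow, abs_of_nonneg (by positivity)]
    have : (fejerPoly m u).eval x ^ 2 ≤ (fejerPoly m u).eval x := by nlinarith
    have := mul_le_mul_of_nonneg_right this (by positivity : 0 ≤ relDist m x u ^ 2)
    linarith
  · have h1 := eval_fejerPoly_nonneg hm u hx
    have h2 := eval_fejerPoly_nonneg hm u hw
    have h3 := eval_fejerPoly_mul_relDist_sq_le hm u hx
    have h4 := eval_fejerPoly_mul_relDist_sq_le hm u hw
    have hD := relDist_pos m x u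
    have hDw := relDist_pos m w u
    have hr := rho_pos hm x
    have hxw' : relDist m x u ≤ 2 * relDist m w u :=
      (relDist_triangle m x w u).trans (by gcongr)
    have h5 : (fejerPoly m u).eval w * relDist m x u ^ 2 ≤ 160 := by
      calc _ ≤ (fejerPoly m u).eval w * (2 * relDist m w u) ^ 2 := by gcongr
        _ = 4 * ((fejerPoly m u).eval w * relDist m w u ^ 2) := by ring
        _ ≤ _ := by linarith
    have h6 := abs_eval_fejerPoly_sub_mul_rho_le hm u hx hw
    rw [eval_pow, eval_pow, sq_sub_sq, abs_mul, abs_of_nonneg (by positivity)]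
    calc _ = ((fejerPoly m u).eval x * relDist m x u ^ 2 + (fejerPoly m u).eval w * relDist m x u ^ 2)
          * (|(fejerPoly m u).eval x - (fejerPoly m u).eval w| * rho m x) := by ring
      _ ≤ (40 + 160) * (10 * |x - w|) := by gcongr
      _ = _ := by ring

lemma exists_localized_fejer_pow (b : ℕ) : ∃ K : ℝ, 0 < K ∧ ∀ m : ℕ, 0 < m → ∀ u,
    Localized m u (2 * b) K (fejerPoly m u ^ (2 * b)) := by
  induction b with
  | zero => exact ⟨1, one_pos, fun m _ u => by simpa using localized_one m u⟩
  | succ b ih =>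
    obtain ⟨K, hK, h⟩ := ih
    refine ⟨(2 ^ 2 + 1) * K * 2000, by positivity, fun m hm u => ?_⟩
    rw [mul_add, pow_add]
    exact (h m hm u).mul hm (localized_fejer_sq hm)

lemma exists_localized_linear : ∃ K : ℝ, 0 < K ∧ ∀ m : ℕ, 0 < m → ∀ z ∈ Set.Icc (-1 : ℝ) 1,
    ∀ z', rho m z ≤ |z - z'| →
      Localized m z 0 K (fejerPoly m z ^ (2 * 2) * (C (1 / (z - z')) * (X - C z'))) := by
  obtain ⟨K, hK, hF⟩ := exists_localized_fejer_pow 2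
  refine ⟨9 * K, by positivity, fun m hm z hz z' hzz => ?_⟩
  have hF := hF m hm z
  set F := fejerPoly m z ^ (2 * 2)
  have hrz := rho_pos hm z
  have hzz0 : 0 < |z - z'| := hrz.trans_le hzz
  have hval : ∀ x ∈ Set.Icc (-1 : ℝ) 1,
      |(C (1 / (z - z')) * (X - C z')).eval x| ≤ 2 * relDist m x z ^ 2 := by
    intro x hx
    simp only [eval_mul, eval_C, eval_sub, eval_X]
    rw [abs_mul, abs_div, abs_one, one_div_mul_eq_div, div_le_iff₀ hzz0]
    have h1 := abs_sub_le_rho_mul hm hx hz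
    have h2 := abs_sub_le x z z'
    have h3 := one_le_relDist m x z
    have h4 : rho m z * relDist m x z ^ 2 ≤ |z - z'| * relDist m x z ^ 2 := by gcongr
    have h5 : |z - z'| ≤ relDist m x z ^ 2 * |z - z'| := by
      nlinarith [one_le_pow₀ h3 (n := 2)]
    linarith
  have hlip : ∀ x ∈ Set.Icc (-1 : ℝ) 1, ∀ w,
      |(C (1 / (z - z')) * (X - C z')).eval x - (C (1 / (z - z')) * (X - C z')).eval w| * rho m x
        ≤ relDist m x z * |x - w| := by
    intro x hx w
    simp only [eval_mul, eval_C, eval_sub, eval_X]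
    rw [← mul_sub, sub_sub_sub_cancel_right, abs_mul, abs_div, abs_one, one_div_mul_eq_div,
      div_mul_eq_mul_div, div_le_iff₀ hzz0]
    have h1 := rho_le_relDist_mul hm x z
    have h2 := relDist_pos m x z
    calc _ ≤ |x - w| * (relDist m x z * |z - z'|) := by gcongr; exact h1.trans (by gcongr)
      _ = _ := by ring
  generalize C (1 / (z - z')) * (X - C z') = ℓ at *
  refine ⟨fun x hx => ?_, fun x hx w hw hxw => ?_⟩
  · have hD := one_le_relDist m x z
    have h1 := hF.1 x hx
    rw [eval_mul, abs_mul, pow_zero, mul_one]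
    calc _ ≤ |F.eval x| * (2 * relDist m x z ^ 2) := by gcongr; exact hval x hx
      _ ≤ |F.eval x| * (2 * relDist m x z ^ (2 * 2)) := by gcongr; first | exact hD | norm_num
      _ = 2 * (|F.eval x| * relDist m x z ^ (2 * 2)) := by ring
      _ ≤ 9 * K := by linarith
  · have hD := one_le_relDist m x z
    have hDw := relDist_pos m w z
    have hr := rho_pos hm x
    have hxw' : relDist m w z ≤ 2 * relDist m x z := by
      rw [relDist_comm] at hxw
      exact (relDist_triangle m w x z).trans (by gcongr)
    have e : (F * ℓ).eval x - (F * ℓ).eval w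
        = (F.eval x - F.eval w) * ℓ.eval w + F.eval x * (ℓ.eval x - ℓ.eval w) := by
      simp only [eval_mul]; ring
    have a1 : |ℓ.eval w| ≤ 8 * relDist m x z ^ (2 * 2) :=
      calc _ ≤ 2 * relDist m w z ^ 2 := hval w hw
        _ ≤ 2 * (2 * relDist m x z) ^ 2 := by gcongr
        _ = 8 * relDist m x z ^ 2 := by ring
        _ ≤ _ := by gcongr; first | exact hD | norm_num
    have a2 : |ℓ.eval x - ℓ.eval w| * rho m x ≤ relDist m x z ^ (2 * 2) * |x - w| :=
      (hlip x hx w).trans (by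
        gcongr
        calc relDist m x z = relDist m x z ^ 1 := (pow_one _).symm
          _ ≤ _ := pow_le_pow_right₀ hD (by norm_num))
    rw [e, pow_zero, mul_one]
    calc _ ≤ (|F.eval x - F.eval w| * |ℓ.eval w| + |F.eval x| * |ℓ.eval x - ℓ.eval w|) * rho m x := by
          gcongr
          rw [← abs_mul, ← abs_mul]; exact abs_add_le _ _
      _ = |F.eval x - F.eval w| * rho m x * |ℓ.eval w|
          + |F.eval x| * (|ℓ.eval x - ℓ.eval w| * rho m x) := by ring
      _ ≤ |F.eval x - F.eval w| * rho m x * (8 * relDist m x z ^ (2 * 2))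
          + |F.eval x| * (relDist m x z ^ (2 * 2) * |x - w|) := by gcongr
      _ = 8 * (|F.eval x - F.eval w| * relDist m x z ^ (2 * 2) * rho m x)
          + (|F.eval x| * relDist m x z ^ (2 * 2)) * |x - w| := by ring
      _ ≤ 8 * (K * |x - w|) + K * |x - w| := by
          have b1 := hF.2 x hx w hw hxw
          have b2 := hF.1 x hx
          gcongr
      _ = _ := by ring

/-- Polynomials of degree `O(m)` localized at a point of `Z` and forming a Lagrange basis on `Z`. -/
theorem exists_bumpPoly (b B : ℕ) : ∃ K : ℝ, 0 < K ∧ ∃ L : ℕ, ∀ m : ℕ, 0 < m → ∀ Z : Finset ℝ,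
    Z.card ≤ B → (∀ z ∈ Z, z ∈ Set.Icc (-1 : ℝ) 1) →
    (∀ z ∈ Z, ∀ z' ∈ Z, z ≠ z' → 2 / (m : ℝ) ≤ |z - z'|) → ∀ z ∈ Z,
    ∃ g : ℝ[X], g.natDegree ≤ L * m ∧ Localized m z (2 * b) K g ∧ g.eval z = 1 ∧
      ∀ z' ∈ Z, z' ≠ z → g.eval z' = 0 := by
  induction B with
  | zero =>
    refine ⟨1, one_pos, 0, fun m hm Z hZ _ _ z hz => ?_⟩
    simp [Finset.card_eq_zero.mp (Nat.le_zero.mp hZ)] at hz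
  | succ B ih =>
    obtain ⟨K, hK, L, ih⟩ := ih
    obtain ⟨K1, hK1, hF⟩ := exists_localized_fejer_pow b
    obtain ⟨K2, hK2, hlin⟩ := exists_localized_linear
    refine ⟨max (2 ^ (2 * b) * K1) ((2 ^ 0 + 1) * K * (2 ^ (2 * 2) * K2)), by positivity,
      max (2 * b) (L + (2 * 2 + 1)), fun m hm Z hZ hZI hsep z hz => ?_⟩
    have hzI := hZI z hz
    set v := (fejerPoly m z).eval z with hv
    have hvhalf : 1 / 2 ≤ v := half_le_eval_fejerPoly_self hm hzI
    have hv0 : 0 < v := by linarith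
    have hscale : ∀ n : ℕ, |1 / v ^ n| ≤ 2 ^ n := by
      intro n
      rw [abs_of_nonneg (by positivity), div_le_iff₀ (by positivity), ← mul_pow]
      exact one_le_pow₀ (by linarith)
    by_cases hex : ∃ z' ∈ Z, z' ≠ z
    · obtain ⟨z', hz', hne⟩ := hex
      have hcard : (Z.erase z').card ≤ B := by
        rw [Finset.card_erase_of_mem hz']; omega
      obtain ⟨g, hdeg, hloc, h1, h0⟩ := ih m hm (Z.erase z') hcard
        (fun w hw => hZI w (Finset.mem_of_mem_erase hw))
        (fun w hw w' hw' => hsep w (Finset.mem_of_mem_erase hw) w' (Finset.mem_of_mem_erase hw')) z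
        (Finset.mem_erase.mpr ⟨hne.symm, hz⟩)
      have hgap : rho m z ≤ |z - z'| := (rho_le_two_div hm z).trans (hsep z hz z' hz' hne.symm)
      have hzz : z - z' ≠ 0 := sub_ne_zero.mpr hne.symm
      have hl := (hlin m hm z hzI z' hgap).C_mul (1 / v ^ (2 * 2))
      refine ⟨g * (C (1 / v ^ (2 * 2)) *
        (fejerPoly m z ^ (2 * 2) * (C (1 / (z - z')) * (X - C z')))), ?_, ?_, ?_, ?_⟩
      · have e1 : (fejerPoly m z ^ (2 * 2)).natDegree ≤ 2 * 2 * m :=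
          natDegree_pow_le_of_le _ (natDegree_fejerPoly_le m z)
        have e2 : (C (1 / (z - z')) * (X - C z')).natDegree ≤ 1 :=
          (natDegree_C_mul_le _ _).trans (natDegree_X_sub_C_le z')
        have e3 := natDegree_mul_le_of_le hdeg
          ((natDegree_C_mul_le (1 / v ^ (2 * 2)) _).trans (natDegree_mul_le_of_le e1 e2))
        refine e3.trans ?_
        have : (L + (2 * 2 + 1)) * m ≤ max (2 * b) (L + (2 * 2 + 1)) * m := by
          gcongr; exact le_max_right _ _
        nlinarith
      · refine (hloc.mul hm hl).mono (le_trans ?_ (le_max_right _ _))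
        gcongr
        exact hscale _
      · simp only [eval_mul, eval_C, eval_pow, eval_sub, eval_X, h1, ← hv]
        field_simp
      · intro w hw hwz
        by_cases hww : w = z'
        · simp [hww]
        · simp [h0 w (Finset.mem_erase.mpr ⟨hww, hw⟩) hwz]
    · push Not at hex
      refine ⟨C (1 / v ^ (2 * b)) * fejerPoly m z ^ (2 * b), ?_, ?_, ?_, ?_⟩
      · refine (natDegree_C_mul_le _ _).trans
          ((natDegree_pow_le_of_le _ (natDegree_fejerPoly_le m z)).trans ?_)
        gcongr; exact le_max_left _ _
      · exact ((hF m hm z).C_mul _).mono (le_trans (by gcongr; exact hscale _) (le_max_left _ _))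
      · simp only [eval_mul, eval_C, eval_pow, ← hv]
        field_simp
      · intro w hw hwz
        exact absurd (hex w hw) hwz

/-- The indicator of the points to the left of `u`. -/
noncomputable def leftOf (u x : ℝ) : ℝ := if x < u then 1 else 0

lemma leftOf_eq (u x : ℝ) : leftOf u x = 0 ∨ leftOf u x = 1 := by
  unfold leftOf; split_ifs <;> simp

lemma leftOf_eq_of_near {m : ℕ} {u x z : ℝ} (hx : x ∈ Set.Icc (-1 : ℝ) 1)
    (hz : z ∈ Set.Icc (-1 : ℝ) 1) (hu : u ∈ Set.Icc (-1 : ℝ) 1)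
    (hzu : 1 / 2 ≤ m * |arccos z - arccos u|) (hxz : m * |arccos x - arccos z| < 1 / 2) :
    leftOf u x = leftOf u z := by
  have hm : (0 : ℝ) ≤ m := by positivity
  have key : |arccos x - arccos z| < |arccos z - arccos u| :=
    lt_of_mul_lt_mul_left (hxz.trans_le hzu) hm
  have iff1 : ∀ y ∈ Set.Icc (-1 : ℝ) 1, y < u ↔ arccos u < arccos y := fun y hy =>
    (strictAntiOn_arccos.lt_iff_gt hu hy).symm
  unfold leftOf
  rw [if_congr ((iff1 x hx).trans (Iff.trans ?_ (iff1 z hz).symm)) rfl rfl]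
  rcases le_total (arccos z) (arccos u) with h | h
  · rw [abs_of_nonpos (sub_nonpos.mpr h)] at key
    have := (abs_lt.mp key).2
    constructor <;> intro h' <;> linarith
  · rw [abs_of_nonneg (sub_nonneg.mpr h)] at key
    have := (abs_lt.mp key).1
    constructor
    · intro h'
      rcases h.lt_or_eq with h'' | h''
      · exact h''
      · rw [h'', sub_self] at key; exact absurd key (not_lt.mpr (abs_nonneg _))
    · intro h'; linarith

/-- Step polynomials that agree with the step function on `Z`. -/
theorem exists_interpolating_step (b B : ℕ) : ∃ K : ℝ, 0 < K ∧ ∃ L : ℕ, ∀ m : ℕ, 0 < m →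
    ∀ Z : Finset ℝ, Z.card ≤ B → (∀ z ∈ Z, z ∈ Set.Icc (-1 : ℝ) 1) →
    (∀ z ∈ Z, ∀ z' ∈ Z, z ≠ z' → 2 / (m : ℝ) ≤ |z - z'|) →
    ∀ u ∈ Set.Icc (-1 : ℝ) 1, 1 / 2 ≤ m * arccos u →
    (∀ z ∈ Z, 1 / 2 ≤ m * |arccos z - arccos u|) →
    ∃ σ : ℝ[X], σ.natDegree ≤ L * m ∧ (∀ z ∈ Z, σ.eval z = leftOf u z) ∧
      (∀ x ∈ Set.Icc (-1 : ℝ) 1, |σ.eval x - leftOf u x| * relDist m x u ^ (2 * b) ≤ K) ∧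
      ∀ x ∈ Set.Icc (-1 : ℝ) 1, ∀ z ∈ Z,
        |σ.eval x - leftOf u x| * relDist m x u ^ (2 * b) * rho m x ≤ K * |x - z| := by
  obtain ⟨K1, hK1, hstep⟩ := exists_stepPoly b
  obtain ⟨K2, hK2, L, hbump⟩ := exists_bumpPoly b B
  set K : ℝ := K1 + B * (K1 * K2) with hK
  have hKp : 0 < K := by positivity
  refine ⟨27 * K, by positivity, max (b + 3) L, fun m hm Z hcard hZI hsep u hu hmu hZu => ?_⟩
  obtain ⟨σ0, hdeg0, hr0, hl0, hlip0⟩ := hstep m hm u hu hmu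
  choose! g hgdeg hgloc hg1 hg0 using hbump m hm Z hcard hZI hsep
  have h00 : ∀ x ∈ Set.Icc (-1 : ℝ) 1, |σ0.eval x - leftOf u x| * relDist m x u ^ (2 * b) ≤ K1 := by
    intro x hx
    unfold leftOf
    split_ifs with h
    · exact hl0 x hx h.le
    · rw [sub_zero]; exact hr0 x hx (not_lt.mp h)
  set σ : ℝ[X] := σ0 + ∑ z ∈ Z, C (leftOf u z - σ0.eval z) * g z with hσ
  have hσZ : ∀ z ∈ Z, σ.eval z = leftOf u z := by
    intro z hz
    rw [hσ, eval_add, eval_finsetSum, Finset.sum_eq_single_of_mem z hz]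
    · simp [hg1 z hz]
    · intro w hw hwz
      simp [hg0 w hw z hz hwz.symm]
  have hterm : ∀ x ∈ Set.Icc (-1 : ℝ) 1, ∀ z ∈ Z, ∀ T M : ℝ, 0 ≤ T → T * relDist m x z ^ (2 * b) ≤ M →
      |leftOf u z - σ0.eval z| * T * relDist m x u ^ (2 * b) ≤ K1 * M := by
    intro x hx z hz T M hT hTM
    have h1 := h00 z (hZI z hz)
    have h2 := relDist_triangle m x z u
    have h3 := relDist_pos m x u
    have h4 := relDist_pos m x z
    have h5 := relDist_pos m z u
    rw [abs_sub_comm]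
    calc _ ≤ |σ0.eval z - leftOf u z| * T * (relDist m x z * relDist m z u) ^ (2 * b) := by gcongr
      _ = (|σ0.eval z - leftOf u z| * relDist m z u ^ (2 * b)) * (T * relDist m x z ^ (2 * b)) := by
        rw [mul_pow]; ring
      _ ≤ _ := by gcongr
  have hA : ∀ x ∈ Set.Icc (-1 : ℝ) 1, |σ.eval x - leftOf u x| * relDist m x u ^ (2 * b) ≤ K := by
    intro x hx
    have hD := relDist_pos m x u
    have e : σ.eval x - leftOf u x = (σ0.eval x - leftOf u x)
        + ∑ z ∈ Z, (leftOf u z - σ0.eval z) * (g z).eval x := by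
      simp [hσ, eval_finsetSum]; ring
    rw [e]
    calc _ ≤ (|σ0.eval x - leftOf u x| + ∑ z ∈ Z, |leftOf u z - σ0.eval z| * |(g z).eval x|)
          * relDist m x u ^ (2 * b) := by
          gcongr
          refine (abs_add_le _ _).trans ?_
          gcongr
          refine (Finset.abs_sum_le_sum_abs _ _).trans (le_of_eq ?_)
          simp only [abs_mul]
      _ = |σ0.eval x - leftOf u x| * relDist m x u ^ (2 * b)
          + ∑ z ∈ Z, |leftOf u z - σ0.eval z| * |(g z).eval x| * relDist m x u ^ (2 * b) := by
          rw [add_mul, Finset.sum_mul]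
      _ ≤ K1 + ∑ z ∈ Z, K1 * K2 := by
          refine add_le_add (h00 x hx) (Finset.sum_le_sum fun z hz => ?_)
          exact hterm x hx z hz _ _ (abs_nonneg _) ((hgloc z hz).1 x hx)
      _ ≤ K := by
          rw [Finset.sum_const, nsmul_eq_mul, hK]
          gcongr
  refine ⟨σ, ?_, hσZ, fun x hx => (hA x hx).trans (by linarith), fun x hx z hz => ?_⟩
  · refine (natDegree_add_le _ _).trans (max_le ?_ ?_)
    · exact hdeg0.trans (by gcongr; exact le_max_left _ _)
    · refine natDegree_sum_le_of_forall_le _ _ fun z hz => (natDegree_C_mul_le _ _).trans ?_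
      exact (hgdeg z hz).trans (by gcongr; exact le_max_right _ _)
  · have hzI := hZI z hz
    have hr := rho_pos hm x
    have hD := relDist_pos m x u
    by_cases hnear : m * |arccos x - arccos z| < 1 / 2
    · rw [leftOf_eq_of_near hx hzI hu (hZu z hz) hnear, ← hσZ z hz]
      have hxz : relDist m x z ≤ 2 := by unfold relDist; linarith
      have e : σ.eval x - σ.eval z = (σ0.eval x - σ0.eval z)
          + ∑ w ∈ Z, (leftOf u w - σ0.eval w) * ((g w).eval x - (g w).eval z) := by
        simp [hσ, eval_finsetSum, mul_sub, Finset.sum_sub_distrib]; ring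
      rw [e]
      calc _ ≤ (|σ0.eval x - σ0.eval z|
              + ∑ w ∈ Z, |leftOf u w - σ0.eval w| * |(g w).eval x - (g w).eval z|)
            * relDist m x u ^ (2 * b) * rho m x := by
            gcongr
            refine (abs_add_le _ _).trans ?_
            gcongr
            refine (Finset.abs_sum_le_sum_abs _ _).trans (le_of_eq ?_)
            simp only [abs_mul]
        _ = |σ0.eval x - σ0.eval z| * relDist m x u ^ (2 * b) * rho m x
            + ∑ w ∈ Z, |leftOf u w - σ0.eval w| * (|(g w).eval x - (g w).eval z| * rho m x)
              * relDist m x u ^ (2 * b) := by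
            rw [add_mul, add_mul, Finset.sum_mul, Finset.sum_mul]
            congr 1
            exact Finset.sum_congr rfl fun w _ => by ring
        _ ≤ K1 * |x - z| + ∑ w ∈ Z, K1 * (K2 * |x - z|) := by
            refine add_le_add (hlip0 x hx z hzI hxz) (Finset.sum_le_sum fun w hw => ?_)
            refine hterm x hx w hw _ _ (by positivity) ?_
            have := (hgloc w hw).2 x hx z hzI hxz
            linarith
        _ ≤ K * |x - z| := by
            rw [Finset.sum_const, nsmul_eq_mul, hK, add_mul, mul_assoc, mul_assoc]
            gcongr
        _ ≤ _ := by gcongr; linarith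
    · have h1 := rho_le_of_half_le hm hx hzI (not_lt.mp hnear)
      have h2 := hA x hx
      calc _ ≤ K * (27 * |x - z|) := by gcongr
        _ = _ := by ring

lemma exists_smoothstep (ν : ℕ) : ∃ a c : ℝ[X], a * X ^ ν + c * (1 - X) ^ ν = 1 := by
  have h : IsCoprime (X : ℝ[X]) (1 - X) := ⟨1, 1, by ring⟩
  exact h.pow

lemma exists_bound_on_Icc (a : ℝ[X]) (M : ℝ) : ∃ K : ℝ, 0 < K ∧ ∀ t, |t| ≤ M → |a.eval t| ≤ K := by
  obtain ⟨K, hK⟩ := (isCompact_Icc (a := -M) (b := M)).exists_bound_of_continuousOn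
    a.continuous.continuousOn
  exact ⟨max K 1, by positivity, fun t ht => (hK t (abs_le.mp ht)).trans (le_max_left _ _)⟩

/-- Step polynomials that agree with the step function on `Z` to order `ν`. -/
theorem exists_hermite_step (b B ν : ℕ) (hν : 1 ≤ ν) : ∃ K : ℝ, 0 < K ∧ ∃ L : ℕ, ∀ m : ℕ, 0 < m →
    ∀ Z : Finset ℝ, Z.card ≤ B → (∀ z ∈ Z, z ∈ Set.Icc (-1 : ℝ) 1) →
    (∀ z ∈ Z, ∀ z' ∈ Z, z ≠ z' → 2 / (m : ℝ) ≤ |z - z'|) →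
    ∀ u ∈ Set.Icc (-1 : ℝ) 1, 1 / 2 ≤ m * arccos u →
    (∀ z ∈ Z, 1 / 2 ≤ m * |arccos z - arccos u|) →
    ∃ τ : ℝ[X], τ.natDegree ≤ L * m ∧ (∀ z ∈ Z, (X - C z) ^ ν ∣ τ - C (leftOf u z)) ∧
      (∀ x ∈ Set.Icc (-1 : ℝ) 1, |τ.eval x - leftOf u x| * relDist m x u ^ (2 * b) ≤ K) ∧
      ∀ x ∈ Set.Icc (-1 : ℝ) 1, ∀ z ∈ Z,
        |τ.eval x - leftOf u x| * relDist m x u ^ (2 * b) * rho m x ^ ν ≤ K * |x - z| ^ ν := by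
  obtain ⟨K0, hK0, L, hstep⟩ := exists_interpolating_step b B
  obtain ⟨a, c, hac⟩ := exists_smoothstep ν
  obtain ⟨Ka, hKa, ha⟩ := exists_bound_on_Icc a (K0 + 1)
  obtain ⟨Kc, hKc, hc⟩ := exists_bound_on_Icc c (K0 + 1)
  refine ⟨max Ka Kc * K0 ^ ν, by positivity, (a * X ^ ν).natDegree * L,
    fun m hm Z hcard hZI hsep u hu hmu hZu => ?_⟩
  obtain ⟨σ, hdeg, hσZ, h1, h2⟩ := hstep m hm Z hcard hZI hsep u hu hmu hZu
  have e0 : ((a * X ^ ν).comp σ) = a.comp σ * σ ^ ν := by simp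
  have e1 : ((a * X ^ ν).comp σ) - 1 = -(c.comp σ * (1 - σ) ^ ν) := by
    have := congrArg (fun q => q.comp σ) hac
    simp only [add_comp, mul_comp, pow_comp, X_comp, sub_comp, one_comp] at this
    rw [e0]; linear_combination this
  have hbound : ∀ x ∈ Set.Icc (-1 : ℝ) 1, |((a * X ^ ν).comp σ).eval x - leftOf u x|
      ≤ max Ka Kc * |σ.eval x - leftOf u x| ^ ν := by
    intro x hx
    have hD := one_le_pow₀ (one_le_relDist m x u) (n := 2 * b)
    have h3 : |σ.eval x - leftOf u x| ≤ K0 := by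
      have := h1 x hx
      nlinarith [abs_nonneg (σ.eval x - leftOf u x)]
    have h4 : |σ.eval x| ≤ K0 + 1 := by
      have := abs_add_le (σ.eval x - leftOf u x) (leftOf u x)
      have h5 : |leftOf u x| ≤ 1 := by rcases leftOf_eq u x with h | h <;> simp [h]
      rw [sub_add_cancel] at this
      linarith
    rcases leftOf_eq u x with h | h
    · rw [h, sub_zero, sub_zero, e0, eval_mul, eval_comp, eval_pow, abs_mul, abs_pow]
      gcongr
      exact (ha _ h4).trans (le_max_left _ _)
    · have := congrArg (eval x) e1
      simp only [eval_sub, eval_one] at this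
      rw [h, this, eval_neg, eval_mul, eval_comp, eval_pow, abs_neg, abs_mul, abs_pow, eval_sub,
        eval_one, abs_sub_comm 1]
      gcongr
      exact (hc _ h4).trans (le_max_right _ _)
  have hDpow : ∀ x, relDist m x u ^ (2 * b) ≤ (relDist m x u ^ (2 * b)) ^ ν := fun x =>
    le_self_pow₀ (one_le_pow₀ (one_le_relDist m x u)) (by omega)
  refine ⟨(a * X ^ ν).comp σ, ?_, fun z hz => ?_, fun x hx => ?_, fun x hx z hz => ?_⟩
  · rw [natDegree_comp, mul_assoc]; gcongr
  · have hroot : (X - C z) ∣ σ - C (leftOf u z) := by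
      rw [dvd_iff_isRoot]; simp [hσZ z hz]
    rcases leftOf_eq u z with h | h
    · rw [h, C_0, sub_zero] at hroot ⊢
      rw [e0]
      exact (pow_dvd_pow_of_dvd hroot ν).mul_left _
    · rw [h, C_1] at hroot ⊢
      rw [e1, dvd_neg]
      rw [dvd_sub_comm] at hroot
      exact (pow_dvd_pow_of_dvd hroot ν).mul_left _
  · have hD := relDist_pos m x u
    calc _ ≤ (max Ka Kc * |σ.eval x - leftOf u x| ^ ν) * (relDist m x u ^ (2 * b)) ^ ν := by
          gcongr
          · exact hbound x hx
          · exact hDpow x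
      _ = max Ka Kc * (|σ.eval x - leftOf u x| * relDist m x u ^ (2 * b)) ^ ν := by
          rw [mul_pow]; ring
      _ ≤ _ := by gcongr; exact h1 x hx
  · have hD := relDist_pos m x u
    have hr := rho_pos hm x
    calc _ ≤ (max Ka Kc * |σ.eval x - leftOf u x| ^ ν) * (relDist m x u ^ (2 * b)) ^ ν
            * rho m x ^ ν := by
          gcongr
          · exact hbound x hx
          · exact hDpow x
      _ = max Ka Kc * (|σ.eval x - leftOf u x| * relDist m x u ^ (2 * b) * rho m x) ^ ν := by
          rw [mul_pow, mul_pow]; ring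
      _ ≤ max Ka Kc * (K0 * |x - z|) ^ ν := by
          have h3 := h2 x hx z hz
          gcongr
      _ = _ := by rw [mul_pow]; ring

/-- The angular variable, scaled so that `[-1,1]` corresponds to `[0,m]`. -/
noncomputable def angle (m : ℕ) (x : ℝ) : ℝ := m * arccos x / π

lemma mul_abs_arccos_sub (m : ℕ) (x u : ℝ) :
    m * |arccos x - arccos u| = π * |angle m x - angle m u| := by
  have hpi := pi_pos
  unfold angle
  rw [← sub_div, ← mul_sub, abs_div, abs_mul, abs_of_pos hpi, Nat.abs_cast]
  field_simp

lemma angle_nonneg (m : ℕ) (x : ℝ) : 0 ≤ angle m x :=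
  div_nonneg (mul_nonneg (Nat.cast_nonneg m) (arccos_nonneg x)) pi_pos.le

lemma angle_le (m : ℕ) (x : ℝ) : angle m x ≤ m := by
  unfold angle
  rw [div_le_iff₀ pi_pos]
  gcongr; exact arccos_le_pi x

lemma angle_lt_iff {m : ℕ} (hm : 0 < m) {x u : ℝ} (hx : x ∈ Set.Icc (-1 : ℝ) 1)
    (hu : u ∈ Set.Icc (-1 : ℝ) 1) : angle m x < angle m u ↔ u < x := by
  have hm' : (0 : ℝ) < m := by exact_mod_cast hm
  unfold angle
  rw [div_lt_div_iff_of_pos_right pi_pos, mul_lt_mul_iff_right₀ hm']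
  exact strictAntiOn_arccos.lt_iff_gt hx hu

lemma angle_le_iff {m : ℕ} (hm : 0 < m) {x u : ℝ} (hx : x ∈ Set.Icc (-1 : ℝ) 1)
    (hu : u ∈ Set.Icc (-1 : ℝ) 1) : angle m x ≤ angle m u ↔ u ≤ x := by
  rw [← not_lt, ← not_lt, angle_lt_iff hm hu hx]

/-- A grid of `m + 1` nodes, roughly equispaced in the angular variable, which stays away
from `Z`. -/
structure IsGrid (m : ℕ) (Z : Finset ℝ) (v : ℕ → ℝ) : Prop where
  mem : ∀ j ≤ m, v j ∈ Set.Icc (-1 : ℝ) 1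
  angle_lower : ∀ j ≤ m, (j : ℝ) ≤ angle m (v j)
  angle_upper : ∀ j ≤ m, angle m (v j) ≤ j + 1 / 2
  zero : v 0 = 1
  last : v m = -1
  far : ∀ j, 1 ≤ j → j < m → ∀ z ∈ Z, 1 / 4 ≤ |angle m z - angle m (v j)|

lemma inv_sq_le_telescope (v : ℝ) :
    1 / (1 + |v|) ^ 2 ≤ 2 * ((v + 1) / (1 + |v + 1|) - v / (1 + |v|)) := by
  rcases le_total 0 v with h | h
  · rw [abs_of_nonneg h, abs_of_nonneg (by linarith : 0 ≤ v + 1)]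
    have e : 2 * ((v + 1) / (1 + (v + 1)) - v / (1 + v)) = 2 / ((1 + v) * (2 + v)) := by
      field_simp; ring
    rw [e, div_le_div_iff₀ (by positivity) (by positivity)]
    nlinarith
  · rw [abs_of_nonpos h]
    have h1 : 0 < 1 + -v := by linarith
    rcases le_total 0 (v + 1) with h' | h'
    · rw [abs_of_nonneg h']
      have h2 : 0 < 1 + (v + 1) := by linarith
      have e : 2 * ((v + 1) / (1 + (v + 1)) - v / (1 + -v))
          = 2 * (1 - 2 * v - 2 * v ^ 2) / ((1 + -v) * (1 + (v + 1))) := by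
        field_simp; ring
      rw [e, div_le_div_iff₀ (by positivity) (by positivity)]
      nlinarith [mul_nonneg (neg_nonneg.mpr h) h', mul_nonneg (mul_nonneg (neg_nonneg.mpr h) h') h1.le]
    · rw [abs_of_nonpos h']
      have h2 : 0 < 1 + -(v + 1) := by linarith
      have e : 2 * ((v + 1) / (1 + -(v + 1)) - v / (1 + -v))
          = 2 / ((1 + -v) * (1 + -(v + 1))) := by
        field_simp; ring
      rw [e, div_le_div_iff₀ (by positivity) (by positivity)]
      nlinarith

lemma sum_inv_sq_le (t : ℝ) (m : ℕ) : ∑ j ∈ Finset.range m, 1 / (1 + |(j : ℝ) - t|) ^ 2 ≤ 4 := by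
  have hb : ∀ v : ℝ, |v / (1 + |v|)| ≤ 1 := fun v => by
    have h := abs_nonneg v
    rw [abs_div, abs_of_pos (by linarith : 0 < 1 + |v|), div_le_one (by linarith)]; linarith
  have := Finset.sum_range_sub (fun j : ℕ => ((j : ℝ) - t) / (1 + |(j : ℝ) - t|)) m
  calc _ ≤ ∑ j ∈ Finset.range m, 2 * ((((j + 1 : ℕ) : ℝ) - t) / (1 + |((j + 1 : ℕ) : ℝ) - t|)
          - ((j : ℝ) - t) / (1 + |(j : ℝ) - t|)) := by
        refine Finset.sum_le_sum fun j _ => ?_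
        have := inv_sq_le_telescope ((j : ℝ) - t)
        rwa [show (j : ℝ) - t + 1 = ((j + 1 : ℕ) : ℝ) - t by push_cast; ring] at this
    _ ≤ 4 := by
        rw [← Finset.mul_sum, this]
        have h1 := (abs_le.mp (hb ((m : ℝ) - t))).2
        have h2 := (abs_le.mp (hb (((0 : ℕ) : ℝ) - t))).1
        linarith

lemma sum_relDist_inv_sq_le {m : ℕ} {Z : Finset ℝ} {v : ℕ → ℝ} (hv : IsGrid m Z v) (x : ℝ) :
    ∑ j ∈ Finset.Ico 1 m, 1 / relDist m x (v j) ^ 2 ≤ 16 := by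
  calc _ ≤ ∑ j ∈ Finset.range m, 1 / relDist m x (v j) ^ 2 := by
        refine Finset.sum_le_sum_of_subset_of_nonneg (fun j hj => ?_) fun j _ _ => by positivity
        rw [Finset.mem_Ico] at hj; exact Finset.mem_range.mpr hj.2
    _ ≤ ∑ j ∈ Finset.range m, 4 * (1 / (1 + |(j : ℝ) - angle m x|) ^ 2) := by
        refine Finset.sum_le_sum fun j hj => ?_
        have hj := (Finset.mem_range.mp hj).le
        have h1 := hv.angle_lower j hj
        have h2 := hv.angle_upper j hj
        have h3 : |(j : ℝ) - angle m x| ≤ |angle m x - angle m (v j)| + 1 / 2 := by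
          rw [abs_sub_comm]
          refine (abs_sub_le _ (angle m (v j)) _).trans ?_
          gcongr
          rw [abs_le]; constructor <;> linarith
        have h4 : 1 + |(j : ℝ) - angle m x| ≤ 2 * relDist m x (v j) := by
          unfold relDist
          rw [mul_abs_arccos_sub]
          nlinarith [pi_gt_three, abs_nonneg (angle m x - angle m (v j))]
        have h5 := relDist_pos m x (v j)
        rw [← div_eq_mul_one_div, div_le_div_iff₀ (by positivity) (by positivity), one_mul]
        calc _ ≤ (2 * relDist m x (v j)) ^ 2 := by gcongr
          _ = _ := by ring
    _ ≤ 16 := by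
        rw [← Finset.mul_sum]
        linarith [sum_inv_sq_le (angle m x) m]

/-- Sums over the grid of quantities decaying quadratically. -/
lemma sum_grid_le {m : ℕ} {Z : Finset ℝ} {v : ℕ → ℝ} (hv : IsGrid m Z v) (x : ℝ) {M : ℝ}
    (hM : 0 ≤ M) {g : ℕ → ℝ}
    (hg : ∀ j ∈ Finset.Ico 1 m, g j * relDist m x (v j) ^ 2 ≤ M) :
    ∑ j ∈ Finset.Ico 1 m, g j ≤ 16 * M := by
  calc _ ≤ ∑ j ∈ Finset.Ico 1 m, M * (1 / relDist m x (v j) ^ 2) := by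
        refine Finset.sum_le_sum fun j hj => ?_
        have := relDist_pos m x (v j)
        rw [← div_eq_mul_one_div, le_div_iff₀ (by positivity)]
        exact hg j hj
    _ ≤ _ := by
        rw [← Finset.mul_sum]
        nlinarith [sum_relDist_inv_sq_le hv x]

lemma IsGrid.half_le {m : ℕ} {Z : Finset ℝ} {v : ℕ → ℝ} (hv : IsGrid m Z v) {j : ℕ} (h1 : 1 ≤ j)
    (hj : j < m) {z : ℝ} (hz : z ∈ Z) : 1 / 2 ≤ m * |arccos z - arccos (v j)| := by
  rw [mul_abs_arccos_sub]
  nlinarith [pi_gt_three, hv.far j h1 hj z hz]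

lemma IsGrid.half_le_arccos {m : ℕ} {Z : Finset ℝ} {v : ℕ → ℝ} (hv : IsGrid m Z v) {j : ℕ}
    (h1 : 1 ≤ j) (hj : j < m) : 1 / 2 ≤ m * arccos (v j) := by
  have h := hv.angle_lower j hj.le
  have h1' : (1 : ℝ) ≤ j := by exact_mod_cast h1
  have e : m * arccos (v j) = π * angle m (v j) := by
    unfold angle; have := pi_pos; field_simp
  rw [e]
  nlinarith [pi_gt_three]

lemma IsGrid.rho_le {m : ℕ} {Z : Finset ℝ} {v : ℕ → ℝ} (hm : 0 < m) (hv : IsGrid m Z v)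
    (hZI : ∀ z ∈ Z, z ∈ Set.Icc (-1 : ℝ) 1) {j : ℕ} (h1 : 1 ≤ j)
    (hj : j < m) {z : ℝ} (hz : z ∈ Z) : rho m (v j) ≤ 27 * |v j - z| := by
  refine rho_le_of_half_le hm (hv.mem j hj.le) (hZI z hz) ?_
  rw [abs_sub_comm]; exact hv.half_le h1 hj hz

lemma IsGrid.exists_near {m : ℕ} {Z : Finset ℝ} {v : ℕ → ℝ} (hm : 2 ≤ m) (hv : IsGrid m Z v) (x : ℝ) :
    ∃ j, 1 ≤ j ∧ j < m ∧ m * |arccos x - arccos (v j)| ≤ 3 * π / 2 := by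
  suffices h : ∃ j, 1 ≤ j ∧ j < m ∧ |angle m x - angle m (v j)| ≤ 3 / 2 by
    obtain ⟨j, h1, h2, h3⟩ := h
    refine ⟨j, h1, h2, ?_⟩
    rw [mul_abs_arccos_sub]; nlinarith [pi_pos]
  set t := angle m x with ht
  have ht0 := angle_nonneg m x
  have htm := angle_le m x
  rw [← ht] at ht0 htm
  by_cases h1 : t < 1
  · refine ⟨1, le_rfl, by omega, ?_⟩
    have a := hv.angle_lower 1 (by omega)
    have b := hv.angle_upper 1 (by omega)
    push_cast at a b
    rw [abs_le]; constructor <;> linarith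
  · by_cases h2 : t < m
    · have h3 : 1 ≤ ⌊t⌋₊ := Nat.le_floor (by push_cast; linarith)
      have h4 : ⌊t⌋₊ < m := (Nat.floor_lt ht0).mpr h2
      refine ⟨⌊t⌋₊, h3, h4, ?_⟩
      have a := hv.angle_lower _ h4.le
      have b := hv.angle_upper _ h4.le
      have c := Nat.floor_le ht0
      have d := Nat.lt_floor_add_one t
      rw [abs_le]; constructor <;> linarith
    · refine ⟨m - 1, by omega, by omega, ?_⟩
      have a := hv.angle_lower (m - 1) (by omega)
      have b := hv.angle_upper (m - 1) (by omega)
      rw [Nat.cast_sub (by omega), Nat.cast_one] at a b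
      rw [abs_le]; constructor <;> linarith

/-- The distance from `x` to `z` on the scale `ρ_m(x)`, truncated at `1`. -/
noncomputable def prox (m : ℕ) (x z : ℝ) : ℝ := min 1 (|x - z| / rho m x)

lemma prox_nonneg {m : ℕ} (hm : 0 < m) (x z : ℝ) : 0 ≤ prox m x z :=
  le_min zero_le_one (div_nonneg (abs_nonneg _) (rho_pos hm x).le)

lemma prox_le_one (m : ℕ) (x z : ℝ) : prox m x z ≤ 1 := min_le_left _ _

lemma le_mul_prod_prox {m : ℕ} (hm : 0 < m) {Z : Finset ℝ}
    (hsep : ∀ z ∈ Z, ∀ z' ∈ Z, z ≠ z' → 4 / (m : ℝ) ≤ |z - z'|) {x T K : ℝ} {ν : ℕ}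
    (h1 : T ≤ K) (h2 : ∀ z ∈ Z, T * rho m x ^ ν ≤ K * |x - z| ^ ν) :
    T ≤ K * ∏ z ∈ Z, prox m x z ^ ν := by
  have hr := rho_pos hm x
  by_cases h : ∃ z ∈ Z, |x - z| < rho m x
  · obtain ⟨z, hz, hzx⟩ := h
    rw [Finset.prod_eq_single_of_mem z hz]
    · have : prox m x z = |x - z| / rho m x := by
        unfold prox; rw [min_eq_right]; rw [div_le_one hr]; exact hzx.le
      rw [this, div_pow, mul_div_assoc', le_div_iff₀ (by positivity)]
      exact h2 z hz
    · intro w hw hwz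
      have h3 := hsep w hw z hz hwz
      have h4 := rho_le_two_div hm x
      have h5 := abs_sub_le w x z
      have : prox m x w = 1 := by
        unfold prox; rw [min_eq_left]; rw [one_le_div hr, abs_sub_comm]
        have : (4 : ℝ) / m = 2 / m + 2 / m := by ring
        linarith
      rw [this, one_pow]
  · push Not at h
    rw [Finset.prod_eq_one, mul_one]
    · exact h1
    · intro z hz
      have : prox m x z = 1 := by
        unfold prox; rw [min_eq_left]; rw [one_le_div hr]; exact h z hz
      rw [this, one_pow]

/-- The polynomial with the sign pattern prescribed by `Y`. -/
noncomputable def signPoly (Y : Finset ℝ) : ℝ[X] := ∏ y ∈ Y, (X - C y)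

/-- The polynomial vanishing on `Z` to order `2 * J`, with additional simple factors on `Y`. -/
noncomputable def zeroPoly (J : ℕ) (Y Z : Finset ℝ) : ℝ[X] := signPoly Y * ∏ z ∈ Z, (X - C z) ^ (2 * J)

lemma eval_signPoly (Y : Finset ℝ) (x : ℝ) : (signPoly Y).eval x = ∏ y ∈ Y, (x - y) := by
  simp [signPoly, eval_prod]

lemma eval_zeroPoly (J : ℕ) (Y Z : Finset ℝ) (x : ℝ) :
    (zeroPoly J Y Z).eval x = (signPoly Y).eval x * ∏ z ∈ Z, (x - z) ^ (2 * J) := by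
  simp [zeroPoly, eval_prod]

lemma natDegree_zeroPoly_le (J : ℕ) (Y Z : Finset ℝ) :
    (zeroPoly J Y Z).natDegree ≤ Y.card + Z.card * (2 * J) := by
  refine natDegree_mul_le_of_le ?_ ?_
  · refine (natDegree_prod_le _ _).trans ?_
    refine (Finset.sum_le_card_nsmul _ _ 1 fun y _ => natDegree_X_sub_C_le y).trans ?_
    simp
  · refine (natDegree_prod_le _ _).trans ?_
    refine (Finset.sum_le_card_nsmul _ _ (2 * J) fun z _ => ?_).trans ?_
    · exact (natDegree_pow_le_of_le _ (natDegree_X_sub_C_le z)).trans (by omega)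
    · simp

lemma eval_zeroPoly_mul_signPoly_nonneg (J : ℕ) (Y Z : Finset ℝ) (x : ℝ) :
    0 ≤ (zeroPoly J Y Z).eval x * (signPoly Y).eval x := by
  rw [eval_zeroPoly, mul_right_comm, ← pow_two]
  refine mul_nonneg (sq_nonneg _) (Finset.prod_nonneg fun z _ => ?_)
  rw [pow_mul]; positivity

lemma abs_eval_zeroPoly_le {J : ℕ} {Y Z : Finset ℝ} {x u R : ℝ} (hR : 1 ≤ R) (hYZ : Y ⊆ Z)
    (h : ∀ z ∈ Z, |x - z| ≤ R * |u - z|) :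
    |(zeroPoly J Y Z).eval x| ≤ R ^ (Z.card * (2 * J + 1)) * |(zeroPoly J Y Z).eval u| := by
  have hR0 : 0 ≤ R := by linarith
  rw [eval_zeroPoly, eval_zeroPoly, eval_signPoly, eval_signPoly, abs_mul, abs_mul, Finset.abs_prod,
    Finset.abs_prod, Finset.abs_prod, Finset.abs_prod]
  have h1 : ∏ y ∈ Y, |x - y| ≤ R ^ Z.card * ∏ y ∈ Y, |u - y| := by
    calc _ ≤ ∏ y ∈ Y, (R * |u - y|) := Finset.prod_le_prod (fun _ _ => abs_nonneg _)
          fun y hy => h y (hYZ hy)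
      _ = R ^ Y.card * ∏ y ∈ Y, |u - y| := by rw [Finset.prod_mul_distrib, Finset.prod_const]
      _ ≤ _ := by
          have := Finset.prod_nonneg (s := Y) fun y _ => abs_nonneg (u - y)
          gcongr
  have h2 : ∏ z ∈ Z, |(x - z) ^ (2 * J)| ≤ R ^ (Z.card * (2 * J)) * ∏ z ∈ Z, |(u - z) ^ (2 * J)| := by
    calc _ ≤ ∏ z ∈ Z, (R ^ (2 * J) * |(u - z) ^ (2 * J)|) := by
          refine Finset.prod_le_prod (fun _ _ => abs_nonneg _) fun z hz => ?_
          rw [abs_pow, abs_pow, ← mul_pow]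
          exact pow_le_pow_left₀ (abs_nonneg _) (h z hz) _
      _ = _ := by
          rw [Finset.prod_mul_distrib, Finset.prod_const, ← pow_mul, mul_comm (2 * J)]
  calc _ ≤ (R ^ Z.card * ∏ y ∈ Y, |u - y|) * (R ^ (Z.card * (2 * J)) * ∏ z ∈ Z, |(u - z) ^ (2 * J)|) := by
        refine mul_le_mul h1 h2 (Finset.prod_nonneg fun _ _ => abs_nonneg _) ?_
        exact mul_nonneg (by positivity) (Finset.prod_nonneg fun _ _ => abs_nonneg _)
    _ = _ := by ring

lemma le_abs_eval_zeroPoly {J : ℕ} {Y Z : Finset ℝ} {x u R : ℝ} {m : ℕ} (hm : 0 < m) (hR : 1 ≤ R)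
    (hYZ : Y ⊆ Z) (h : ∀ z ∈ Z, prox m x z * |u - z| ≤ R * |x - z|) :
    |(zeroPoly J Y Z).eval u| * ∏ z ∈ Z, prox m x z ^ (2 * J + 1)
      ≤ R ^ (Z.card * (2 * J + 1)) * |(zeroPoly J Y Z).eval x| := by
  have hR0 : 0 ≤ R := by linarith
  have hp := fun z => prox_nonneg hm x z
  rw [eval_zeroPoly, eval_zeroPoly, eval_signPoly, eval_signPoly, abs_mul, abs_mul, Finset.abs_prod,
    Finset.abs_prod, Finset.abs_prod, Finset.abs_prod]
  have h1 : (∏ y ∈ Y, |u - y|) * ∏ z ∈ Z, prox m x z ≤ R ^ Z.card * ∏ y ∈ Y, |x - y| := by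
    calc _ ≤ (∏ y ∈ Y, |u - y|) * ∏ y ∈ Y, prox m x y := by
          refine mul_le_mul_of_nonneg_left ?_ (Finset.prod_nonneg fun _ _ => abs_nonneg _)
          rw [← Finset.prod_sdiff hYZ]
          exact mul_le_of_le_one_left (Finset.prod_nonneg fun z _ => hp z)
            (Finset.prod_le_one (fun z _ => hp z) fun z _ => prox_le_one m x z)
      _ = ∏ y ∈ Y, (prox m x y * |u - y|) := by rw [Finset.prod_mul_distrib, mul_comm]
      _ ≤ ∏ y ∈ Y, (R * |x - y|) := Finset.prod_le_prod
          (fun y _ => mul_nonneg (hp y) (abs_nonneg _)) fun y hy => h y (hYZ hy)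
      _ = R ^ Y.card * ∏ y ∈ Y, |x - y| := by rw [Finset.prod_mul_distrib, Finset.prod_const]
      _ ≤ _ := by
          have := Finset.prod_nonneg (s := Y) fun y _ => abs_nonneg (x - y)
          gcongr
  have h2 : (∏ z ∈ Z, |(u - z) ^ (2 * J)|) * ∏ z ∈ Z, prox m x z ^ (2 * J)
      ≤ R ^ (Z.card * (2 * J)) * ∏ z ∈ Z, |(x - z) ^ (2 * J)| := by
    rw [← Finset.prod_mul_distrib]
    calc _ ≤ ∏ z ∈ Z, (R ^ (2 * J) * |(x - z) ^ (2 * J)|) := by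
          refine Finset.prod_le_prod (fun z _ => mul_nonneg (abs_nonneg _) (pow_nonneg (hp z) _))
            fun z hz => ?_
          rw [abs_pow, abs_pow, ← mul_pow, ← mul_pow, mul_comm]
          exact pow_le_pow_left₀ (mul_nonneg (hp z) (abs_nonneg _)) (h z hz) _
      _ = _ := by
          rw [Finset.prod_mul_distrib, Finset.prod_const, ← pow_mul, mul_comm (2 * J)]
  calc _ = ((∏ y ∈ Y, |u - y|) * ∏ z ∈ Z, prox m x z) *
        ((∏ z ∈ Z, |(u - z) ^ (2 * J)|) * ∏ z ∈ Z, prox m x z ^ (2 * J)) := by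
        simp only [pow_succ, Finset.prod_mul_distrib]; ring
    _ ≤ (R ^ Z.card * ∏ y ∈ Y, |x - y|) * (R ^ (Z.card * (2 * J)) * ∏ z ∈ Z, |(x - z) ^ (2 * J)|) := by
        refine mul_le_mul h1 h2 ?_ ?_
        · exact mul_nonneg (Finset.prod_nonneg fun _ _ => abs_nonneg _)
            (Finset.prod_nonneg fun z _ => pow_nonneg (hp z) _)
        · exact mul_nonneg (by positivity) (Finset.prod_nonneg fun _ _ => abs_nonneg _)
    _ = _ := by ring

/-- A polynomial with prescribed signs, of size comparable to `Φ` away from its zeros `Z`. -/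
theorem exists_signed_poly (J B E : ℕ) (KΦ : ℝ) (hKΦ : 0 < KΦ) : ∃ K : ℝ, 0 < K ∧ ∃ L : ℕ,
    ∀ m : ℕ, 2 ≤ m → ∀ Y Z : Finset ℝ, Y ⊆ Z → Z.card ≤ B → (∀ z ∈ Z, z ∈ Set.Icc (-1 : ℝ) 1) →
    ∀ v : ℕ → ℝ, IsGrid m Z v → ∀ Φ : ℝ → ℝ, (∀ x ∈ Set.Icc (-1 : ℝ) 1, 0 ≤ Φ x) →
    (∀ x ∈ Set.Icc (-1 : ℝ) 1, ∀ u ∈ Set.Icc (-1 : ℝ) 1, Φ u ≤ KΦ * Φ x * relDist m x u ^ E) →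
    ∃ W : ℝ[X], W.natDegree ≤ L * m ∧ (∀ z ∈ Z, (X - C z) ^ (2 * J) ∣ W) ∧
      (∀ x ∈ Set.Icc (-1 : ℝ) 1, |W.eval x| ≤ K * Φ x) ∧
      (∀ x ∈ Set.Icc (-1 : ℝ) 1, Φ x * ∏ z ∈ Z, prox m x z ^ (2 * J + 1) ≤ K * |W.eval x|) ∧
      ∀ x ∈ Set.Icc (-1 : ℝ) 1, 0 ≤ W.eval x * (signPoly Y).eval x := by
  set e : ℕ := B * (2 * J + 1) with he
  set b : ℕ := E + 2 * e + 2 with hb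
  obtain ⟨K1, hK1, hfej⟩ := exists_localized_fejer_pow b
  set Ku : ℝ := 16 * (KΦ * 28 ^ e * K1) with hKu
  set Kl : ℝ := KΦ * 6 ^ E * (37 ^ e * 100 ^ (2 * b)) with hKl
  refine ⟨max Ku Kl, by positivity, B + B * (2 * J) + 2 * b,
    fun m hm2 Y Z hYZ hZB hZI v hv Φ hΦ0 hΦ => ?_⟩
  have hm : 0 < m := by omega
  have hcard : Z.card * (2 * J + 1) ≤ e := by rw [he]; gcongr
  set Q₀ := zeroPoly J Y Z with hQ₀
  set V : ℝ[X] := ∑ j ∈ Finset.Ico 1 m, C (Φ (v j) / |Q₀.eval (v j)|) * fejerPoly m (v j) ^ (2 * b)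
    with hV
  have hmem : ∀ j ∈ Finset.Ico 1 m, 1 ≤ j ∧ j < m ∧ v j ∈ Set.Icc (-1 : ℝ) 1 := fun j hj => by
    rw [Finset.mem_Ico] at hj; exact ⟨hj.1, hj.2, hv.mem j hj.2.le⟩
  have hpos : ∀ j ∈ Finset.Ico 1 m, 0 < |Q₀.eval (v j)| := by
    intro j hj
    obtain ⟨h1, h2, -⟩ := hmem j hj
    have hne : ∀ z ∈ Z, v j - z ≠ 0 := fun z hz h0 => by
      have := hv.rho_le hm hZI h1 h2 hz
      rw [h0, abs_zero, mul_zero] at this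
      linarith [rho_pos hm (v j)]
    rw [abs_pos, hQ₀, eval_zeroPoly, eval_signPoly]
    refine mul_ne_zero (Finset.prod_ne_zero_iff.mpr fun y hy => hne y (hYZ hy))
      (Finset.prod_ne_zero_iff.mpr fun z hz => pow_ne_zero _ (hne z hz))
  have hVe : ∀ x, V.eval x = ∑ j ∈ Finset.Ico 1 m,
      Φ (v j) / |Q₀.eval (v j)| * (fejerPoly m (v j)).eval x ^ (2 * b) := by
    intro x; simp [hV, eval_finsetSum]
  have hterm0 : ∀ x ∈ Set.Icc (-1 : ℝ) 1, ∀ j ∈ Finset.Ico 1 m,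
      0 ≤ Φ (v j) / |Q₀.eval (v j)| * (fejerPoly m (v j)).eval x ^ (2 * b) := by
    intro x hx j hj
    have h1 := hΦ0 _ (hmem j hj).2.2
    have h2 := eval_fejerPoly_nonneg hm (v j) hx
    positivity
  have hV0 : ∀ x ∈ Set.Icc (-1 : ℝ) 1, 0 ≤ V.eval x := fun x hx => by
    rw [hVe]; exact Finset.sum_nonneg (hterm0 x hx)
  refine ⟨Q₀ * V, ?_, fun z hz => ?_, fun x hx => ?_, fun x hx => ?_, fun x hx => ?_⟩
  · have d1 : Q₀.natDegree ≤ (B + B * (2 * J)) * m := by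
      refine (natDegree_zeroPoly_le J Y Z).trans ?_
      have h1 := Finset.card_le_card hYZ
      have h2 : Z.card * (2 * J) ≤ B * (2 * J) := by gcongr
      nlinarith [Nat.zero_le (B * (2 * J)), Nat.zero_le B]
    have d2 : V.natDegree ≤ 2 * b * m := by
      refine natDegree_sum_le_of_forall_le _ _ fun j _ => (natDegree_C_mul_le _ _).trans ?_
      exact natDegree_pow_le_of_le _ (natDegree_fejerPoly_le m (v j))
    exact (natDegree_mul_le_of_le d1 d2).trans (le_of_eq (by ring))
  · refine Dvd.dvd.mul_right ?_ V
    rw [hQ₀, zeroPoly]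
    exact (Finset.dvd_prod_of_mem (fun z => (X - C z) ^ (2 * J)) hz).mul_left _
  · refine le_trans ?_ (mul_le_mul_of_nonneg_right (le_max_left Ku Kl) (hΦ0 x hx))
    rw [eval_mul, abs_mul, abs_of_nonneg (hV0 x hx), hVe, Finset.mul_sum, hKu, mul_assoc]
    have hΦx := hΦ0 x hx
    refine sum_grid_le hv x (by positivity) fun j hj => ?_
    obtain ⟨h1, h2, hvj⟩ := hmem j hj
    have hD := one_le_relDist m x (v j)
    have hD0 := relDist_pos m x (v j)
    have hQ₀j := hpos j hj
    have hf := (hfej m hm (v j)).1 x hx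
    have hf0 := eval_fejerPoly_nonneg hm (v j) hx
    rw [eval_pow, abs_of_nonneg (by positivity)] at hf
    have hΦj := hΦ0 _ hvj
    have hratio : |Q₀.eval x| ≤ (28 * relDist m x (v j) ^ 2) ^ e * |Q₀.eval (v j)| := by
      have hR : 1 ≤ 28 * relDist m x (v j) ^ 2 := by nlinarith [one_le_pow₀ hD (n := 2)]
      refine (abs_eval_zeroPoly_le (u := v j) hR hYZ fun z hz => ?_).trans ?_
      · have g1 := hv.rho_le hm hZI h1 h2 hz
        have g2 := abs_sub_le_rho_mul hm hx hvj
        have g3 := abs_sub_le x (v j) z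
        have g4 : rho m (v j) * relDist m x (v j) ^ 2 ≤ 27 * |v j - z| * relDist m x (v j) ^ 2 := by
          gcongr
        nlinarith [mul_nonneg (abs_nonneg (v j - z)) (sub_nonneg.mpr (one_le_pow₀ hD (n := 2)))]
      · gcongr
    calc |Q₀.eval x| * (Φ (v j) / |Q₀.eval (v j)| * (fejerPoly m (v j)).eval x ^ (2 * b))
            * relDist m x (v j) ^ 2
        ≤ ((28 * relDist m x (v j) ^ 2) ^ e * |Q₀.eval (v j)|) *
            ((KΦ * Φ x * relDist m x (v j) ^ E) / |Q₀.eval (v j)| *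
              (fejerPoly m (v j)).eval x ^ (2 * b)) * relDist m x (v j) ^ 2 := by
          have := hΦ x hx _ hvj
          gcongr
      _ = KΦ * 28 ^ e * Φ x * ((fejerPoly m (v j)).eval x ^ (2 * b)
            * relDist m x (v j) ^ (E + 2 * e + 2)) := by
          rw [mul_pow, ← pow_mul, pow_add, pow_add]; field_simp
      _ ≤ KΦ * 28 ^ e * Φ x * ((fejerPoly m (v j)).eval x ^ (2 * b)
            * relDist m x (v j) ^ (2 * b)) := by
          gcongr
          omega
      _ ≤ KΦ * 28 ^ e * Φ x * K1 := by gcongr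
      _ = _ := by ring
  · refine le_trans ?_ (mul_le_mul_of_nonneg_right (le_max_right Ku Kl) (abs_nonneg _))
    obtain ⟨j, h1, h2, hnear⟩ := hv.exists_near hm2 x
    have hj : j ∈ Finset.Ico 1 m := Finset.mem_Ico.mpr ⟨h1, h2⟩
    obtain ⟨-, -, hvj⟩ := hmem j hj
    have hf := eval_fejerPoly_lower hm (v j) hx hnear
    have hQ₀j := hpos j hj
    have hΦj := hΦ0 _ hvj
    have hΦx := hΦ0 x hx
    have hD6 : relDist m x (v j) ≤ 6 := by unfold relDist; linarith [pi_lt_d2]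
    have hD := relDist_pos m x (v j)
    have hV1 : Φ (v j) / |Q₀.eval (v j)| * (1 / 100) ^ (2 * b) ≤ V.eval x := by
      rw [hVe]
      refine le_trans ?_ (Finset.single_le_sum (hterm0 x hx) hj)
      gcongr
    have hr := rho_pos hm x
    have hQ₀1 : |Q₀.eval (v j)| * ∏ z ∈ Z, prox m x z ^ (2 * J + 1) ≤ 37 ^ e * |Q₀.eval x| := by
      refine (le_abs_eval_zeroPoly (R := 37) hm (by norm_num) hYZ fun z hz => ?_).trans ?_
      · have g1 : |v j - x| ≤ 36 * rho m x := by
          refine (abs_sub_le_rho_mul hm hvj hx).trans ?_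
          rw [relDist_comm, mul_comm]
          gcongr
          nlinarith
        have g2 := abs_sub_le (v j) x z
        have g3 := prox_le_one m x z
        have g4 : prox m x z * rho m x ≤ |x - z| := by
          rw [← le_div_iff₀ hr]; exact min_le_right _ _
        have g5 := prox_nonneg hm x z
        calc _ ≤ prox m x z * (36 * rho m x + |x - z|) := by gcongr; linarith
          _ ≤ _ := by nlinarith [abs_nonneg (x - z)]
      · gcongr; norm_num
    have hp : 0 ≤ ∏ z ∈ Z, prox m x z ^ (2 * J + 1) :=
      Finset.prod_nonneg fun z _ => pow_nonneg (prox_nonneg hm x z) _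
    rw [eval_mul, abs_mul, abs_of_nonneg (hV0 x hx)]
    calc Φ x * ∏ z ∈ Z, prox m x z ^ (2 * J + 1)
        ≤ (KΦ * Φ (v j) * 6 ^ E) * ∏ z ∈ Z, prox m x z ^ (2 * J + 1) := by
          gcongr
          refine (hΦ _ hvj x hx).trans ?_
          rw [relDist_comm]
          gcongr
      _ = KΦ * 6 ^ E * 100 ^ (2 * b) * (|Q₀.eval (v j)| * ∏ z ∈ Z, prox m x z ^ (2 * J + 1))
            * (Φ (v j) / |Q₀.eval (v j)| * (1 / 100) ^ (2 * b)) := by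
          rw [one_div, inv_pow]; field_simp
      _ ≤ KΦ * 6 ^ E * 100 ^ (2 * b) * (37 ^ e * |Q₀.eval x|) * V.eval x := by gcongr
      _ = _ := by ring
  · rw [eval_mul, mul_right_comm]
    exact mul_nonneg (eval_zeroPoly_mul_signPoly_nonneg J Y Z x) (hV0 x hx)

/-- Growth of a polynomial outside an interval on which it is bounded. -/
lemma exists_poly_growth (D : ℕ) : ∃ K : ℝ, 1 ≤ K ∧ ∀ q : ℝ[X], q.natDegree ≤ D → ∀ a b M : ℝ,
    a < b → (∀ x ∈ Set.Icc a b, |q.eval x| ≤ M) →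
    ∀ x, |q.eval x| ≤ K * M * (1 + |x - a| / (b - a)) ^ D := by
  induction D with
  | zero =>
    refine ⟨1, le_rfl, fun q hq a b M hab h x => ?_⟩
    rw [eq_C_of_natDegree_le_zero hq] at h ⊢
    simpa using h a ⟨le_rfl, hab.le⟩
  | succ D ih =>
    obtain ⟨K, hK, ih⟩ := ih
    refine ⟨1 + K * 4 * 2 ^ D, by nlinarith [pow_pos (two_pos : (0 : ℝ) < 2) D],
      fun q hq a b M hab h x => ?_⟩
    have hM : 0 ≤ M := (abs_nonneg _).trans (h a ⟨le_rfl, hab.le⟩)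
    have hba : 0 < b - a := sub_pos.mpr hab
    obtain ⟨g, hg⟩ : (X - C a) ∣ q - C (q.eval a) := by rw [dvd_iff_isRoot]; simp
    have hgd : g.natDegree ≤ D := by
      by_cases hg0 : g = 0
      · simp [hg0]
      have h1 : (q - C (q.eval a)).natDegree ≤ D + 1 := by
        rwa [natDegree_sub_C]
      rw [hg, natDegree_mul (X_sub_C_ne_zero a) hg0, natDegree_X_sub_C] at h1
      omega
    have hev : ∀ x, q.eval x = q.eval a + (x - a) * g.eval x := fun x => by
      have := congrArg (eval x) hg
      simp only [eval_sub, eval_C, eval_mul, eval_X] at this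
      linarith
    have hgb : ∀ x ∈ Set.Icc ((a + b) / 2) b, |g.eval x| ≤ 4 * M / (b - a) := by
      intro x hx
      have h1 := h x ⟨by linarith [hx.1], hx.2⟩
      have h2 := h a ⟨le_rfl, hab.le⟩
      have h3 : |(x - a) * g.eval x| ≤ 2 * M := by
        rw [show (x - a) * g.eval x = q.eval x - q.eval a by rw [hev x]; ring]
        exact (abs_sub _ _).trans (by linarith)
      have h4 : (b - a) / 2 ≤ x - a := by linarith [hx.1]
      rw [abs_mul, abs_of_pos (by linarith)] at h3
      rw [le_div_iff₀ hba]
      nlinarith [abs_nonneg (g.eval x)]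
    have h1 := ih g hgd ((a + b) / 2) b (4 * M / (b - a)) (by linarith) hgb x
    set T := 1 + |x - a| / (b - a) with hT
    have hxa : 0 ≤ |x - a| / (b - a) := by positivity
    have hT1 : 1 ≤ T := by linarith
    have h2 : 1 + |x - (a + b) / 2| / (b - (a + b) / 2) ≤ 2 * T := by
      have e : b - (a + b) / 2 = (b - a) / 2 := by ring
      have h3 : |x - (a + b) / 2| ≤ |x - a| + (b - a) / 2 := by
        refine (abs_sub_le x a _).trans ?_
        gcongr
        rw [abs_le]; constructor <;> linarith
      rw [e, hT]
      calc _ ≤ 1 + (|x - a| + (b - a) / 2) / ((b - a) / 2) := by gcongr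
        _ = _ := by field_simp; ring
    rw [hev x]
    calc _ ≤ |q.eval a| + |x - a| * |g.eval x| := by rw [← abs_mul]; exact abs_add_le _ _
      _ ≤ M + |x - a| * (K * (4 * M / (b - a)) * (2 * T) ^ D) := by
          gcongr
          · exact h a ⟨le_rfl, hab.le⟩
          · have h0 : 0 < b - (a + b) / 2 := by linarith
            have h00 : 0 ≤ 1 + |x - (a + b) / 2| / (b - (a + b) / 2) := by positivity
            refine h1.trans ?_
            gcongr
      _ = M + K * 4 * 2 ^ D * M * ((|x - a| / (b - a)) * T ^ D) := by rw [mul_pow]; ring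
      _ ≤ M * T ^ (D + 1) + K * 4 * 2 ^ D * M * (T * T ^ D) := by
          gcongr
          · exact le_mul_of_one_le_right hM (one_le_pow₀ hT1)
          · linarith
      _ = _ := by ring

lemma telescoping_sum {M : Type*} [AddCommGroup M] (p : ℕ → M) {i m : ℕ} (hi : i < m) :
    p 0 + ∑ j ∈ Finset.Ico 1 m, (if j ≤ i then p j - p (j - 1) else 0) = p i := by
  rw [← Finset.sum_filter]
  have : (Finset.Ico 1 m).filter (fun j => j ≤ i) = Finset.Ico 1 (i + 1) := by
    ext j; simp only [Finset.mem_filter, Finset.mem_Ico]; omega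
  rw [this, Finset.sum_Ico_eq_sum_range]
  simp only [Nat.add_sub_cancel, Nat.add_sub_cancel_left]
  have := Finset.sum_range_sub p i
  simp only [add_comm 1] at *
  rw [this]; abel

namespace IsGrid

variable {m : ℕ} {Z : Finset ℝ} {v : ℕ → ℝ}

lemma lt_of_lt (hm : 0 < m) (hv : IsGrid m Z v) {i j : ℕ} (hij : i < j) (hj : j ≤ m) :
    v j < v i := by
  rw [← angle_lt_iff hm (hv.mem i (by omega)) (hv.mem j hj)]
  have h1 := hv.angle_upper i (by omega)
  have h2 := hv.angle_lower j hj
  have : (i : ℝ) + 1 ≤ j := by exact_mod_cast hij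
  linarith

lemma le_of_le (hm : 0 < m) (hv : IsGrid m Z v) {i j : ℕ} (hij : i ≤ j) (hj : j ≤ m) :
    v j ≤ v i := by
  rcases hij.lt_or_eq with h | h
  · exact (hv.lt_of_lt hm h hj).le
  · rw [h]

lemma exists_piece (hm : 0 < m) (hv : IsGrid m Z v) {x : ℝ} (hx : x ∈ Set.Icc (-1 : ℝ) 1) :
    ∃ i < m, x ∈ Set.Icc (v (i + 1)) (v i) ∧
      ∀ j, 1 ≤ j → j < m → leftOf (v j) x = if j ≤ i then 1 else 0 := by
  classical
  set P : ℕ → Prop := fun i => i = 0 ∨ x < v i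
  set i := Nat.findGreatest P (m - 1) with hi
  have him : i ≤ m - 1 := Nat.findGreatest_le _
  have hPi : P i := Nat.findGreatest_spec (P := P) (Nat.zero_le _) (Or.inl rfl)
  have hgt : ∀ j, i < j → j < m → v j ≤ x := fun j hij hj => by
    have := Nat.findGreatest_is_greatest hij (by omega : j ≤ m - 1)
    by_contra! h
    exact this (Or.inr h)
  refine ⟨i, by omega, ⟨?_, ?_⟩, fun j h1 hj => ?_⟩
  · by_cases h : i + 1 < m
    · exact hgt _ (by omega) h
    · rw [show i + 1 = m by omega, hv.last]; exact hx.1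
  · rcases hPi with h | h
    · rw [h, hv.zero]; exact hx.2
    · exact h.le
  · unfold leftOf
    by_cases hji : j ≤ i
    · have : x < v i := hPi.resolve_left (by omega)
      rw [if_pos hji, if_pos (this.trans_le (hv.le_of_le hm hji (by omega)))]
    · rw [if_neg hji, if_neg (not_lt.mpr (hgt j (by omega) hj))]

lemma leftOf_of_mem_piece (hm : 0 < m) (hv : IsGrid m Z v) {z : ℝ} (hz : z ∈ Z) {i : ℕ} (hi : i < m)
    (hzi : z ∈ Set.Icc (v (i + 1)) (v i)) {j : ℕ} (h1 : 1 ≤ j) (hj : j < m) :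
    leftOf (v j) z = if j ≤ i then 1 else 0 := by
  unfold leftOf
  by_cases hji : j ≤ i
  · have h2 := hzi.2.trans (hv.le_of_le hm hji hi.le)
    have h3 : z ≠ v j := fun h => by
      have := hv.far j h1 hj z hz
      rw [h, sub_self, abs_zero] at this
      linarith
    rw [if_pos hji, if_pos (lt_of_le_of_ne h2 h3)]
  · rw [if_neg hji, if_neg (not_lt.mpr ((hv.le_of_le hm (by omega) hj.le).trans hzi.1))]

lemma angle_mem_of_mem_piece (hm : 0 < m) (hv : IsGrid m Z v) {x : ℝ} {i : ℕ} (hi : i < m)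
    (hx : x ∈ Set.Icc (v (i + 1)) (v i)) :
    x ∈ Set.Icc (-1 : ℝ) 1 ∧ (i : ℝ) ≤ angle m x ∧ angle m x ≤ i + 3 / 2 := by
  have hxI : x ∈ Set.Icc (-1 : ℝ) 1 :=
    ⟨(hv.mem _ hi).1.trans hx.1, hx.2.trans (hv.mem _ hi.le).2⟩
  refine ⟨hxI, ?_, ?_⟩
  · exact (hv.angle_lower i hi.le).trans ((angle_le_iff hm (hv.mem _ hi.le) hxI).mpr hx.2)
  · have h1 := (angle_le_iff hm hxI (hv.mem _ hi)).mpr hx.1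
    have h2 := hv.angle_upper (i + 1) hi
    push_cast at h2
    linarith

lemma rho_le_sub (hm : 0 < m) (hv : IsGrid m Z v) {j : ℕ} (hj : j < m) :
    rho m (v j) ≤ 27 * (v j - v (j + 1)) := by
  have h1 := hv.lt_of_lt hm (Nat.lt_succ_self j) hj
  have h2 := rho_le_of_half_le hm (hv.mem j hj.le) (hv.mem (j + 1) hj) (by
    rw [mul_abs_arccos_sub]
    have a := hv.angle_upper j hj.le
    have b := hv.angle_lower (j + 1) hj
    push_cast at b
    rw [abs_sub_comm, abs_of_nonneg (by linarith)]
    nlinarith [pi_gt_three])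
  rwa [abs_of_pos (sub_pos.mpr h1)] at h2

end IsGrid

/-- Gluing local polynomial approximants into one polynomial, preserving signs and contact. -/
theorem exists_glued_poly (J B E D : ℕ) (KΦ Kp : ℝ) (hKΦ : 0 < KΦ) (hKp : 0 < Kp) :
    ∃ K : ℝ, 0 < K ∧ ∃ L : ℕ,
    ∀ m : ℕ, 2 ≤ m → ∀ Y Z : Finset ℝ, Y ⊆ Z → Z.card ≤ B → (∀ z ∈ Z, z ∈ Set.Icc (-1 : ℝ) 1) →
    (∀ z ∈ Z, ∀ z' ∈ Z, z ≠ z' → 4 / (m : ℝ) ≤ |z - z'|) →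
    ∀ v : ℕ → ℝ, IsGrid m Z v → ∀ Φ : ℝ → ℝ, (∀ x ∈ Set.Icc (-1 : ℝ) 1, 0 ≤ Φ x) →
    (∀ x ∈ Set.Icc (-1 : ℝ) 1, ∀ u ∈ Set.Icc (-1 : ℝ) 1, Φ u ≤ KΦ * Φ x * relDist m x u ^ E) →
    ∀ (f : ℝ → ℝ) (p : ℕ → ℝ[X]), (∀ i < m, (p i).natDegree ≤ D) →
    (∀ i < m, ∀ x ∈ Set.Icc (-1 : ℝ) 1, (i : ℝ) ≤ angle m x → angle m x ≤ i + 3 →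
      |f x - (p i).eval x| ≤ Kp * Φ x) →
    (∀ i < m, ∀ x ∈ Set.Icc (v (i + 1)) (v i), 0 ≤ (p i).eval x * (signPoly Y).eval x) →
    ∃ P : ℝ[X], P.natDegree ≤ L * m ∧ (∀ x ∈ Set.Icc (-1 : ℝ) 1, |f x - P.eval x| ≤ K * Φ x) ∧
      (∀ x ∈ Set.Icc (-1 : ℝ) 1, 0 ≤ P.eval x * (signPoly Y).eval x) ∧
      ∀ i < m, ∀ z ∈ Z, z ∈ Set.Icc (v (i + 1)) (v i) → (X - C z) ^ (2 * J) ∣ P - p i := by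
  obtain ⟨Kg, hKg, hgrow⟩ := exists_poly_growth D
  set b : ℕ := E + 2 * D + 2 with hb
  set ν : ℕ := 2 * J + 1 with hν
  obtain ⟨Kτ, hKτ, Lτ, hstep⟩ := exists_hermite_step b B ν (by omega)
  obtain ⟨Kw, hKw, Lw, hW⟩ := exists_signed_poly J B E KΦ hKΦ
  -- bound for differences of consecutive local polynomials
  set Kd : ℝ := Kg * (2 * Kp * KΦ * 6 ^ E) * 29 ^ D * KΦ with hKd
  have hKg0 : 0 < Kg := by linarith
  have hKdp : 0 < Kd := by positivity
  set KQ : ℝ := 16 * (Kd * Kτ) with hKQ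
  refine ⟨Kp + KQ + KQ * Kw * Kw, by positivity, D + Lτ + D + Lw,
    fun m hm2 Y Z hYZ hZB hZI hsep v hv Φ hΦ0 hΦ f p hpD hpf hps => ?_⟩
  have hm : 0 < m := by omega
  have hmem : ∀ j ∈ Finset.Ico 1 m, 1 ≤ j ∧ j < m ∧ v j ∈ Set.Icc (-1 : ℝ) 1 := fun j hj => by
    rw [Finset.mem_Ico] at hj; exact ⟨hj.1, hj.2, hv.mem j hj.2.le⟩
  have hsep2 : ∀ z ∈ Z, ∀ z' ∈ Z, z ≠ z' → 2 / (m : ℝ) ≤ |z - z'| := fun z hz z' hz' h =>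
    le_trans (by gcongr; norm_num) (hsep z hz z' hz' h)
  choose! τ hτd hτZ hτ1 hτ2 using fun j (hj : j ∈ Finset.Ico 1 m) =>
    hstep m hm Z hZB hZI hsep2 (v j) (hmem j hj).2.2
      (hv.half_le_arccos (hmem j hj).1 (hmem j hj).2.1)
      (fun z hz => hv.half_le (hmem j hj).1 (hmem j hj).2.1 hz)
  obtain ⟨W, hWd, hWZ, hWu, hWl, hWs⟩ := hW m hm2 Y Z hYZ hZB hZI v hv Φ hΦ0 hΦ
  set Q : ℝ[X] := p 0 + ∑ j ∈ Finset.Ico 1 m, (p j - p (j - 1)) * τ j with hQ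
  -- difference bound
  have hdiff : ∀ j ∈ Finset.Ico 1 m, ∀ x ∈ Set.Icc (-1 : ℝ) 1,
      |(p j - p (j - 1)).eval x| ≤ Kd * Φ x * relDist m x (v j) ^ (E + 2 * D) := by
    intro j hj x hx
    obtain ⟨h1, h2, hvj⟩ := hmem j hj
    have hdeg : (p j - p (j - 1)).natDegree ≤ D :=
      (natDegree_sub_le _ _).trans (max_le (hpD j h2) (hpD (j - 1) (by omega)))
    have hΦj := hΦ0 _ hvj
    have hgap := hv.rho_le_sub hm h2
    have hr := rho_pos hm (v j)
    have hlt := hv.lt_of_lt hm (Nat.lt_succ_self j) h2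
    have hbd : ∀ y ∈ Set.Icc (v (j + 1)) (v j),
        |(p j - p (j - 1)).eval y| ≤ 2 * Kp * KΦ * 6 ^ E * Φ (v j) := by
      intro y hy
      obtain ⟨hyI, a1, a2⟩ := hv.angle_mem_of_mem_piece hm h2 hy
      have b1 := hpf j h2 y hyI a1 (by linarith)
      have b2 := hpf (j - 1) (by omega) y hyI
        (by rw [Nat.cast_sub h1]; push_cast; linarith) (by rw [Nat.cast_sub h1]; push_cast; linarith)
      have hD : relDist m (v j) y ≤ 6 := by
        unfold relDist
        rw [mul_abs_arccos_sub]
        have c1 := hv.angle_lower j h2.le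
        have c2 := hv.angle_upper j h2.le
        have : |angle m (v j) - angle m y| ≤ 3 / 2 := by
          rw [abs_le]; constructor <;> linarith
        nlinarith [pi_lt_d2, pi_pos]
      have hD0 := relDist_pos m (v j) y
      have c := hΦ _ hvj y hyI
      have c' : Φ y ≤ KΦ * Φ (v j) * 6 ^ E := c.trans (by gcongr)
      rw [eval_sub, show (p j).eval y - (p (j - 1)).eval y
        = (f y - (p (j - 1)).eval y) - (f y - (p j).eval y) by ring]
      calc _ ≤ Kp * Φ y + Kp * Φ y := (abs_sub _ _).trans (add_le_add b2 b1)
        _ ≤ Kp * (KΦ * Φ (v j) * 6 ^ E) + Kp * (KΦ * Φ (v j) * 6 ^ E) := by gcongr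
        _ = _ := by ring
    have hD1 := one_le_relDist m x (v j)
    have hD0 := relDist_pos m x (v j)
    have hba : 0 < v j - v (j + 1) := sub_pos.mpr hlt
    have hT : 1 + |x - v (j + 1)| / (v j - v (j + 1)) ≤ 29 * relDist m x (v j) ^ 2 := by
      have t1 := abs_sub_le x (v j) (v (j + 1))
      rw [abs_of_pos hba] at t1
      have t2 := abs_sub_le_rho_mul hm hx hvj
      have t3 : |x - v (j + 1)| / (v j - v (j + 1)) ≤ 27 * relDist m x (v j) ^ 2 + 1 := by
        rw [div_le_iff₀ hba]
        have : rho m (v j) * relDist m x (v j) ^ 2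
          ≤ 27 * (v j - v (j + 1)) * relDist m x (v j) ^ 2 := by gcongr
        nlinarith
      have t4 := one_le_pow₀ hD1 (n := 2)
      linarith
    have g := hgrow _ hdeg _ _ _ hlt hbd x
    calc _ ≤ Kg * (2 * Kp * KΦ * 6 ^ E * Φ (v j)) * (29 * relDist m x (v j) ^ 2) ^ D := by
          refine g.trans ?_
          gcongr
      _ ≤ Kg * (2 * Kp * KΦ * 6 ^ E * (KΦ * Φ x * relDist m x (v j) ^ E))
            * (29 * relDist m x (v j) ^ 2) ^ D := by
          have := hΦ x hx _ hvj
          gcongr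
      _ = _ := by rw [mul_pow, ← pow_mul, pow_add]; ring
  -- distance of `Q` to the piecewise polynomial
  have hQS : ∀ x ∈ Set.Icc (-1 : ℝ) 1, ∀ i < m,
      (∀ j, 1 ≤ j → j < m → leftOf (v j) x = if j ≤ i then 1 else 0) →
      |Q.eval x - (p i).eval x| ≤ KQ * Φ x * ∏ z ∈ Z, prox m x z ^ ν := by
    intro x hx i hi hloc
    have hr := rho_pos hm x
    have hΦx := hΦ0 x hx
    have e : Q.eval x - (p i).eval x
        = ∑ j ∈ Finset.Ico 1 m, (p j - p (j - 1)).eval x * ((τ j).eval x - leftOf (v j) x) := by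
      rw [← telescoping_sum (fun j => (p j).eval x) hi, hQ, eval_add, eval_finsetSum,
        add_sub_add_left_eq_sub, ← Finset.sum_sub_distrib]
      refine Finset.sum_congr rfl fun j hj => ?_
      rw [hloc j (hmem j hj).1 (hmem j hj).2.1]
      split_ifs <;> simp only [eval_mul, eval_sub] <;> ring
    have key : ∀ j ∈ Finset.Ico 1 m, ∀ R M : ℝ, 0 ≤ R → 0 ≤ M →
        |(τ j).eval x - leftOf (v j) x| * relDist m x (v j) ^ (2 * b) * R ≤ Kτ * M →
        |(p j - p (j - 1)).eval x * ((τ j).eval x - leftOf (v j) x)| * R * relDist m x (v j) ^ 2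
          ≤ Kd * Kτ * Φ x * M := by
      intro j hj R M hR hM h
      have hD1 := one_le_relDist m x (v j)
      have hD0 := relDist_pos m x (v j)
      rw [abs_mul]
      calc _ ≤ (Kd * Φ x * relDist m x (v j) ^ (E + 2 * D)) * |(τ j).eval x - leftOf (v j) x| * R
              * relDist m x (v j) ^ 2 := by
            have := hdiff j hj x hx
            gcongr
        _ = Kd * Φ x * (|(τ j).eval x - leftOf (v j) x| * relDist m x (v j) ^ (E + 2 * D + 2) * R) := by
            ring
        _ ≤ Kd * Φ x * (|(τ j).eval x - leftOf (v j) x| * relDist m x (v j) ^ (2 * b) * R) := by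
            gcongr
            omega
        _ ≤ Kd * Φ x * (Kτ * M) := by gcongr
        _ = _ := by ring
    refine le_mul_prod_prox hm hsep ?_ fun z hz => ?_
    · rw [e, show KQ * Φ x = 16 * (Kd * Kτ * Φ x * 1) by rw [hKQ]; ring]
      refine (Finset.abs_sum_le_sum_abs _ _).trans ?_
      refine sum_grid_le hv x (by positivity) fun j hj => ?_
      have := key j hj 1 1 zero_le_one zero_le_one (by simpa using hτ1 j hj x hx)
      simpa using this
    · rw [e, show KQ * Φ x * |x - z| ^ ν = 16 * (Kd * Kτ * Φ x * |x - z| ^ ν) by rw [hKQ]; ring]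
      refine (mul_le_mul_of_nonneg_right (Finset.abs_sum_le_sum_abs _ _) (by positivity)).trans ?_
      rw [Finset.sum_mul]
      refine sum_grid_le hv x (by positivity) fun j hj => ?_
      exact key j hj _ _ (by positivity) (by positivity) (hτ2 j hj x hx z hz)
  have hprox1 : ∀ x, ∏ z ∈ Z, prox m x z ^ ν ≤ 1 := fun x =>
    Finset.prod_le_one (fun z _ => pow_nonneg (prox_nonneg hm x z) _)
      fun z _ => pow_le_one₀ (prox_nonneg hm x z) (prox_le_one m x z)
  refine ⟨Q + C (KQ * Kw) * W, ?_, fun x hx => ?_, fun x hx => ?_, fun i hi z hz hzi => ?_⟩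
  · have d1 : Q.natDegree ≤ (D + Lτ + D) * m := by
      refine (natDegree_add_le _ _).trans (max_le ?_ ?_)
      · refine (hpD 0 hm).trans ?_
        nlinarith [Nat.zero_le (Lτ * m), Nat.zero_le (D * m), Nat.mul_le_mul_left D hm]
      · refine natDegree_sum_le_of_forall_le _ _ fun j hj => ?_
        have hdeg : (p j - p (j - 1)).natDegree ≤ D := (natDegree_sub_le _ _).trans
          (max_le (hpD j (hmem j hj).2.1) (hpD (j - 1) (by have := (hmem j hj).2.1; omega)))
        refine (natDegree_mul_le_of_le hdeg (hτd j hj)).trans ?_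
        nlinarith [Nat.zero_le (Lτ * m), Nat.zero_le (D * m), Nat.mul_le_mul_left D hm]
    refine (natDegree_add_le _ _).trans (max_le (d1.trans ?_) ?_)
    · exact Nat.mul_le_mul_right m (by omega)
    · exact (natDegree_C_mul_le _ _).trans (hWd.trans (Nat.mul_le_mul_right m (by omega)))
  · obtain ⟨i, hi, hxi, hloc⟩ := hv.exists_piece hm hx
    obtain ⟨-, a1, a2⟩ := hv.angle_mem_of_mem_piece hm hi hxi
    have h1 := hpf i hi x hx a1 (by linarith)
    have h2 := (hQS x hx i hi hloc).trans (mul_le_of_le_one_right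
      (mul_nonneg (by positivity) (hΦ0 x hx)) (hprox1 x))
    have h3 := hWu x hx
    have e : f x - (Q + C (KQ * Kw) * W).eval x
        = (f x - (p i).eval x) - (Q.eval x - (p i).eval x) - KQ * Kw * W.eval x := by
      simp only [eval_add, eval_mul, eval_C]; ring
    rw [e]
    calc _ ≤ |f x - (p i).eval x| + |Q.eval x - (p i).eval x| + |KQ * Kw * W.eval x| :=
          (abs_sub _ _).trans (by gcongr; exact abs_sub _ _)
      _ ≤ Kp * Φ x + KQ * Φ x + KQ * Kw * (Kw * Φ x) := by
          rw [abs_mul, abs_of_pos (by positivity : 0 < KQ * Kw)]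
          gcongr
      _ = _ := by ring
  · obtain ⟨i, hi, hxi, hloc⟩ := hv.exists_piece hm hx
    have h1 := hps i hi x hxi
    have h2 := hQS x hx i hi hloc
    have h3 := hWl x hx
    have h4 := hWs x hx
    set s := (signPoly Y).eval x
    have h5 : |Q.eval x - (p i).eval x| ≤ KQ * Kw * |W.eval x| := by
      calc _ ≤ _ := h2
        _ = KQ * (Φ x * ∏ z ∈ Z, prox m x z ^ ν) := by ring
        _ ≤ KQ * (Kw * |W.eval x|) := mul_le_mul_of_nonneg_left h3 (by positivity)
        _ = _ := by ring
    have h6 : |(Q.eval x - (p i).eval x) * s| ≤ KQ * Kw * (W.eval x * s) := by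
      rw [← abs_of_nonneg h4, abs_mul, abs_mul, ← mul_assoc]
      gcongr
    have e : (Q + C (KQ * Kw) * W).eval x * s = (p i).eval x * s
        + ((Q.eval x - (p i).eval x) * s + KQ * Kw * (W.eval x * s)) := by
      simp only [eval_add, eval_mul, eval_C]; ring
    rw [e]
    have := (abs_le.mp h6).1
    linarith
  · have e : Q + C (KQ * Kw) * W - p i = (∑ j ∈ Finset.Ico 1 m,
        (p j - p (j - 1)) * (τ j - C (leftOf (v j) z))) + C (KQ * Kw) * W := by
      rw [← telescoping_sum p hi, hQ]
      have : ∑ j ∈ Finset.Ico 1 m, (p j - p (j - 1)) * (τ j - C (leftOf (v j) z))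
          = ∑ j ∈ Finset.Ico 1 m, (p j - p (j - 1)) * τ j
            - ∑ j ∈ Finset.Ico 1 m, (if j ≤ i then p j - p (j - 1) else 0) := by
        rw [← Finset.sum_sub_distrib]
        refine Finset.sum_congr rfl fun j hj => ?_
        rw [hv.leftOf_of_mem_piece hm hz hi hzi (hmem j hj).1 (hmem j hj).2.1]
        split_ifs <;> simp <;> ring
      rw [this]; ring
    rw [e]
    refine dvd_add (Finset.dvd_sum fun j hj => ?_) ((hWZ z hz).mul_left _)
    exact ((pow_dvd_pow _ (by omega)).trans (hτZ j hj z hz)).mul_left _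

/-- The `k`-th forward difference of `g` at `x` with step `t`. -/
noncomputable def fd (k : ℕ) (t : ℝ) (g : ℝ → ℝ) (x : ℝ) : ℝ :=
  ∑ i ∈ Finset.range (k + 1), (-1 : ℝ) ^ (k - i) * (k.choose i : ℝ) * g (x + (i : ℝ) * t)

lemma fd_eq_fwdDiff (k : ℕ) (t : ℝ) (g : ℝ → ℝ) (x : ℝ) :
    fd k t g x = (fwdDiff (1 : ℝ))^[k] (fun s => g (x + s * t)) 0 := by
  rw [fwdDiff_iter_eq_sum_shift, fd]
  refine Finset.sum_congr rfl fun i _ => ?_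
  simp

lemma fd_succ (k : ℕ) (t : ℝ) (g : ℝ → ℝ) (x : ℝ) :
    fd (k + 1) t g x = fd k t g (x + t) - fd k t g x := by
  simp only [fd_eq_fwdDiff]
  rw [Function.iterate_succ_apply', fwdDiff, fwdDiff_iter_eq_sum_shift, fwdDiff_iter_eq_sum_shift]
  rw [fwdDiff_iter_eq_sum_shift]
  congr 1
  refine Finset.sum_congr rfl fun i _ => ?_
  congr 2
  simp
  ring

lemma fd_sub (k : ℕ) (t : ℝ) (g₁ g₂ : ℝ → ℝ) (x : ℝ) :
    fd k t (fun y => g₁ y - g₂ y) x = fd k t g₁ x - fd k t g₂ x := by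
  simp only [fd, ← Finset.sum_sub_distrib, mul_sub]

lemma fd_eval_eq_zero {k : ℕ} {p : ℝ[X]} (hp : p.natDegree < k) (t x : ℝ) :
    fd k t (fun y => p.eval y) x = 0 := by
  have h := fwdDiff_iter_eq_zero_of_degree_lt (P := p.comp (C t * X + C x)) (n := k) (by
    refine lt_of_le_of_lt (natDegree_comp_le.trans ?_) hp
    calc p.natDegree * (C t * X + C x).natDegree ≤ p.natDegree * 1 :=
          Nat.mul_le_mul_left _ natDegree_linear_le
      _ = _ := mul_one _)
  rw [fd_eq_fwdDiff]
  have e : (fun s : ℝ => p.eval (x + s * t)) = (p.comp (C t * X + C x)).eval := by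
    funext s
    simp only [eval_comp, eval_add, eval_mul, eval_C, eval_X]
    congr 1; ring
  rw [e, h]; rfl

lemma fd_reflect (k : ℕ) (t : ℝ) (g : ℝ → ℝ) (x : ℝ) :
    fd k t (fun y => g (1 - y)) x = (-1) ^ k * fd k t g (1 - x - k * t) := by
  rw [fd, fd, ← Finset.sum_range_reflect, Finset.mul_sum]
  refine Finset.sum_congr rfl fun i hi => ?_
  have hi' : i ≤ k := by simpa [Nat.lt_succ_iff] using hi
  have e1 : k + 1 - 1 - i = k - i := by omega
  have e2 : k - (k - i) = i := by omega
  rw [e1, e2, Nat.choose_symm hi', Nat.cast_sub hi']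
  have e3 : (-1 : ℝ) ^ i = (-1) ^ k * (-1) ^ (k - i) := by
    rw [← pow_add]
    have : k + (k - i) = i + 2 * (k - i) := by omega
    rw [this, pow_add, pow_mul]; norm_num
  rw [e3]
  have : 1 - (x + ((k : ℝ) - i) * t) = 1 - x - k * t + i * t := by ring
  rw [this]; ring

lemma sum_choose_real (k : ℕ) : ∑ i ∈ Finset.range (k + 1), (k.choose i : ℝ) = 2 ^ k := by
  exact_mod_cast Nat.sum_range_choose k

/-- Bounded derivative on an interval starting at `0` bounds the increment. -/
lemma abs_sub_le_of_deriv_le {θ θ' : ℝ → ℝ} (h : ∀ t, HasDerivAt θ (θ' t) t) {δ ω : ℝ}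
    (hδ : 0 ≤ δ) (hω : ∀ t, 0 < t → t < δ → |θ' t| ≤ ω) : |θ δ - θ 0| ≤ ω * δ := by
  rcases hδ.eq_or_lt with rfl | hδ
  · simp
  obtain ⟨c, hc, he⟩ := exists_hasDerivAt_eq_slope θ θ' hδ
    (fun x _ => (h x).continuousAt.continuousWithinAt) fun x _ => h x
  have := hω c hc.1 hc.2
  rw [he, abs_div, sub_zero, abs_of_pos hδ, div_le_iff₀ hδ] at this
  exact this

lemma abs_fd_succ_le {k : ℕ} {G g : ℝ → ℝ} (hG : ∀ x, HasDerivAt G (g x) x) {ω x t : ℝ}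
    (ht : 0 < t) (hω : ∀ s, 0 < s → s < t → |fd k t g (x + s)| ≤ ω) :
    |fd (k + 1) t G x| ≤ ω * t := by
  have h : ∀ s, HasDerivAt (fun s => fd k t G (x + s)) (fd k t g (x + s)) s := by
    intro s
    unfold fd
    refine HasDerivAt.fun_sum fun i _ => HasDerivAt.const_mul _ ?_
    have := (hG (x + s + i * t)).comp s (((hasDerivAt_id s).const_add x).add_const (i * t))
    simpa [Function.comp_def] using this
  have := abs_sub_le_of_deriv_le h ht.le hω
  simpa [fd_succ] using this

lemma abs_le_of_antideriv {k : ℕ} (hk : 1 ≤ k) {G g : ℝ → ℝ} (hG : ∀ x, HasDerivAt G (g x) x)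
    {ω M : ℝ} (hω : ∀ x t : ℝ, 0 < t → 0 ≤ x → x + k * t ≤ 1 → |fd k t g x| ≤ ω)
    (hM : ∀ x ∈ Set.Icc (0 : ℝ) 1, |G x| ≤ M) {x : ℝ} (hx : 0 ≤ x) (hx' : x ≤ 1 / 2) :
    |g x| ≤ ω + 4 * k * 2 ^ k * M := by
  have hk0 : (0 : ℝ) < k := by exact_mod_cast hk
  set δ : ℝ := 1 / (2 * k) with hδ
  have hδ0 : 0 < δ := by positivity
  have hkδ : k * δ = 1 / 2 := by rw [hδ]; field_simp
  have hM0 : 0 ≤ M := (abs_nonneg _).trans (hM 0 ⟨le_rfl, zero_le_one⟩)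
  set c : ℕ → ℝ := fun i => (-1 : ℝ) ^ (k - i) * (k.choose i : ℝ)
  have hc : ∀ i, |c i| = k.choose i := fun i => by simp [c, abs_mul, abs_pow]
  let θ : ℝ → ℝ := fun t => ∑ i ∈ Finset.range k,
    c (i + 1) * (G (x + ((i + 1 : ℕ) : ℝ) * t) / ((i + 1 : ℕ) : ℝ)) + c 0 * g x * t
  have h : ∀ t, HasDerivAt θ (fd k t g x) t := by
    intro t
    have e : fd k t g x = ∑ i ∈ Finset.range k,
        c (i + 1) * g (x + ((i + 1 : ℕ) : ℝ) * t) + c 0 * g x := by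
      rw [fd, Finset.sum_range_succ']
      simp [c]
    rw [e]
    refine HasDerivAt.add (HasDerivAt.fun_sum fun i _ => HasDerivAt.const_mul _ ?_) ?_
    · have h0 : ((i + 1 : ℕ) : ℝ) ≠ 0 := by positivity
      have := ((hG (x + ((i + 1 : ℕ) : ℝ) * t)).comp t
        (((hasDerivAt_id t).const_mul ((i + 1 : ℕ) : ℝ)).const_add x)).div_const ((i + 1 : ℕ) : ℝ)
      rw [mul_one, mul_div_cancel_right₀ _ h0] at this
      exact this
    · simpa using (hasDerivAt_id t).const_mul (c 0 * g x)
  have h1 := abs_sub_le_of_deriv_le h hδ0.le fun t ht htδ => hω x t ht hx (by nlinarith)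
  have h2 : θ δ - θ 0 = ∑ i ∈ Finset.range k,
    c (i + 1) * ((G (x + ((i + 1 : ℕ) : ℝ) * δ) - G x) / ((i + 1 : ℕ) : ℝ)) + c 0 * g x * δ := by
    simp only [θ, mul_zero, add_zero]
    rw [add_sub_right_comm, ← Finset.sum_sub_distrib]
    congr 1
    refine Finset.sum_congr rfl fun i _ => by ring
  have h3 : |∑ i ∈ Finset.range k,
      c (i + 1) * ((G (x + ((i + 1 : ℕ) : ℝ) * δ) - G x) / ((i + 1 : ℕ) : ℝ))| ≤ 2 ^ k * (2 * M) := by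
    calc _ ≤ ∑ i ∈ Finset.range k, (k.choose (i + 1) : ℝ) * (2 * M) := by
          refine (Finset.abs_sum_le_sum_abs _ _).trans (Finset.sum_le_sum fun i hi => ?_)
          have hi' : ((i + 1 : ℕ) : ℝ) ≤ k := by
            exact_mod_cast Nat.succ_le_of_lt (Finset.mem_range.mp hi)
          rw [abs_mul, hc]
          refine mul_le_mul_of_nonneg_left ?_ (by positivity)
          have hi1 : (1 : ℝ) ≤ ((i + 1 : ℕ) : ℝ) := by push_cast; linarith [Nat.cast_nonneg (α := ℝ) i]
          rw [abs_div, abs_of_pos (by linarith : (0:ℝ) < ((i + 1 : ℕ) : ℝ))]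
          refine (div_le_self (abs_nonneg _) hi1).trans ?_
          have a1 := hM (x + ((i + 1 : ℕ) : ℝ) * δ) ⟨by positivity, by nlinarith⟩
          have a2 := hM x ⟨hx, by linarith⟩
          exact (abs_sub _ _).trans (by linarith)
      _ = (∑ i ∈ Finset.range k, (k.choose (i + 1) : ℝ)) * (2 * M) := by rw [Finset.sum_mul]
      _ ≤ _ := by
          gcongr
          rw [← sum_choose_real k, Finset.sum_range_succ']
          simp
  have h4 : |c 0 * g x * δ| = |g x| * δ := by
    rw [abs_mul, abs_mul, hc, abs_of_pos hδ0]; simp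
  rw [h2] at h1
  have h5 : |g x| * δ ≤ ω * δ + 2 ^ k * (2 * M) := by
    rw [← h4]
    set S := ∑ i ∈ Finset.range k,
      c (i + 1) * ((G (x + ((i + 1 : ℕ) : ℝ) * δ) - G x) / ((i + 1 : ℕ) : ℝ))
    have : c 0 * g x * δ = (S + c 0 * g x * δ) - S := by ring
    rw [this]
    exact (abs_sub _ _).trans (by linarith)
  have h6 : |g x| * δ ≤ (ω + 4 * k * 2 ^ k * M) * δ := by
    have : (ω + 4 * k * 2 ^ k * M) * δ = ω * δ + 2 ^ k * (2 * M) * (2 * (k * δ)) := by ring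
    rw [this, hkδ]; linarith
  exact le_of_mul_le_mul_right h6 hδ0

lemma abs_le_of_antideriv' {k : ℕ} (hk : 1 ≤ k) {G g : ℝ → ℝ} (hG : ∀ x, HasDerivAt G (g x) x)
    {ω M : ℝ} (hω : ∀ x t : ℝ, 0 < t → 0 ≤ x → x + k * t ≤ 1 → |fd k t g x| ≤ ω)
    (hM : ∀ x ∈ Set.Icc (0 : ℝ) 1, |G x| ≤ M) {x : ℝ} (hx : x ∈ Set.Icc (0 : ℝ) 1) :
    |g x| ≤ ω + 4 * k * 2 ^ k * M := by
  rcases le_total x (1 / 2) with h | h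
  · exact abs_le_of_antideriv hk hG hω hM hx.1 h
  · have := abs_le_of_antideriv hk (G := fun y => -G (1 - y)) (g := fun y => g (1 - y)) (ω := ω)
      (M := M) (x := 1 - x)
      (fun y => by
        have := ((hG (1 - y)).comp y ((hasDerivAt_id y).const_sub 1)).neg
        rw [mul_neg_one, neg_neg] at this
        exact this)
      (fun y t ht hy hyt => by
        rw [fd_reflect, abs_mul, abs_pow, abs_neg, abs_one, one_pow, one_mul]
        exact hω _ _ ht (by linarith) (by linarith))
      (fun y hy => by rw [abs_neg]; exact hM _ ⟨by linarith [hy.2], by linarith [hy.1]⟩)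
      (by linarith [hx.2]) (by linarith)
    simpa using this

lemma abs_grid_le {k N : ℕ} {G : ℝ → ℝ} {ω : ℝ} (hω0 : 0 ≤ ω) (hN : 0 < N)
    (h0 : ∀ j ≤ k, G ((j : ℝ) / N) = 0)
    (hω : ∀ x, 0 ≤ x → x + ((k + 1 : ℕ) : ℝ) * (1 / N) ≤ 1 → |fd (k + 1) (1 / N) G x| ≤ ω) (j : ℕ)
    (hj : j ≤ N) : |G ((j : ℝ) / N)| ≤ (2 ^ (k + 1) + 1) ^ j * ω := by
  induction j using Nat.strong_induction_on with
  | _ j ih =>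
    rcases le_or_gt j k with hjk | hjk
    · rw [h0 j hjk, abs_zero]; positivity
    · obtain ⟨i, rfl⟩ := Nat.exists_eq_add_of_lt hjk
      have hN0 : (0 : ℝ) < N := by exact_mod_cast hN
      set B : ℝ := 2 ^ (k + 1) + 1 with hB
      have hB1 : 1 ≤ B := by rw [hB]; linarith [pow_pos (two_pos : (0:ℝ) < 2) (k + 1)]
      have hjN : ((k + i + 1 : ℕ) : ℝ) ≤ N := by exact_mod_cast hj
      have h1 := hω ((i : ℝ) / N) (by positivity) (by
        rw [mul_one_div, ← add_div, div_le_one hN0]; push_cast at hjN ⊢; linarith)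
      rw [fd, Finset.sum_range_succ] at h1
      have e : ∀ l : ℕ, (i : ℝ) / N + (l : ℝ) * (1 / N) = ((i + l : ℕ) : ℝ) / N := fun l => by
        push_cast; ring
      simp only [e] at h1
      have e2 : i + (k + 1) = k + i + 1 := by ring
      rw [e2, Nat.sub_self, pow_zero, Nat.choose_self, Nat.cast_one, one_mul, one_mul] at h1
      have h2 : |∑ l ∈ Finset.range (k + 1), (-1 : ℝ) ^ (k + 1 - l) * ((k + 1).choose l : ℝ) *
          G (((i + l : ℕ) : ℝ) / N)| ≤ 2 ^ (k + 1) * (B ^ (k + i) * ω) := by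
        calc _ ≤ ∑ l ∈ Finset.range (k + 1), ((k + 1).choose l : ℝ) * (B ^ (k + i) * ω) := by
              refine (Finset.abs_sum_le_sum_abs _ _).trans (Finset.sum_le_sum fun l hl => ?_)
              rw [abs_mul, abs_mul, abs_pow, abs_neg, abs_one, one_pow, one_mul, Nat.abs_cast]
              have hl' : l ≤ k := Nat.lt_succ_iff.mp (Finset.mem_range.mp hl)
              have := ih (i + l) (by omega) (by omega)
              have h3 : B ^ (i + l) ≤ B ^ (k + i) := pow_le_pow_right₀ hB1 (by omega)
              gcongr
              exact this.trans (by gcongr)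
          _ = (∑ l ∈ Finset.range (k + 1), ((k + 1).choose l : ℝ)) * (B ^ (k + i) * ω) := by
              rw [Finset.sum_mul]
          _ ≤ _ := by
              gcongr
              rw [← sum_choose_real (k + 1), Finset.sum_range_succ _ (k + 1)]
              simp
      set S := ∑ l ∈ Finset.range (k + 1), (-1 : ℝ) ^ (k + 1 - l) * ((k + 1).choose l : ℝ) *
          G (((i + l : ℕ) : ℝ) / N)
      set g := G (((k + i + 1 : ℕ) : ℝ) / N)
      have e3 : g = (S + g) - S := by ring
      have h3 : |g| ≤ ω + 2 ^ (k + 1) * (B ^ (k + i) * ω) := by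
        rw [e3]; exact (abs_sub _ _).trans (by linarith)
      have h4 : 1 ≤ B ^ (k + i) := one_le_pow₀ hB1
      rw [pow_succ]
      nlinarith

lemma exists_antideriv {f : ℝ → ℝ} (hf : Continuous f) :
    ∃ F : ℝ → ℝ, ∀ x, HasDerivAt F (f x) x :=
  ⟨fun x => ∫ t in (0 : ℝ)..x, f t, fun x => intervalIntegral.integral_hasDerivAt_right
    (hf.intervalIntegrable _ _) (hf.stronglyMeasurableAtFilter _ _) hf.continuousAt⟩

/-- **Whitney's inequality** on the unit interval. -/
theorem whitney_unit (k : ℕ) (hk : 1 ≤ k) : ∃ K : ℝ, 0 < K ∧ ∀ f : ℝ → ℝ, Continuous f → ∀ ω : ℝ,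
    (∀ x t : ℝ, 0 < t → 0 ≤ x → x + k * t ≤ 1 → |fd k t f x| ≤ ω) →
    ∃ w : ℝ[X], w.natDegree < k ∧ ∀ x ∈ Set.Icc (0 : ℝ) 1, |f x - w.eval x| ≤ K * ω := by
  have hk0 : (0 : ℝ) < k := by exact_mod_cast hk
  set N : ℕ := 8 * k * 2 ^ k with hN
  have hNk : k ≤ N := by
    rw [hN]; nlinarith [Nat.one_le_two_pow (n := k)]
  have hN0 : 0 < N := by omega
  have hN0' : (0 : ℝ) < N := by exact_mod_cast hN0
  set c : ℝ := 4 * k * 2 ^ k with hc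
  have hc0 : 0 < c := by positivity
  have hcN : (N : ℝ) = 2 * c := by rw [hN, hc]; push_cast; ring
  set B : ℝ := (2 ^ (k + 1) + 1) ^ N with hB
  have hB0 : 0 < B := by positivity
  refine ⟨1 + c * (2 * (B + 1)), by positivity, fun f hf ω hω => ?_⟩
  have hω0 : 0 ≤ ω := (abs_nonneg _).trans (hω 0 (1 / k) (by positivity) le_rfl (by
    field_simp; linarith))
  obtain ⟨F, hF⟩ := exists_antideriv hf
  let x : Fin (k + 1) → ℝ := fun i => (i : ℝ) / N
  have hxi : Set.InjOn x (Finset.univ : Finset (Fin (k + 1))) := by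
    intro a _ b _ hab
    have : (a : ℝ) / N = (b : ℝ) / N := hab
    rw [div_left_inj' hN0'.ne'] at this
    exact Fin.ext (by exact_mod_cast this)
  set q := Lagrange.interpolate Finset.univ x (fun i => F (x i)) with hq
  have hqd : q.natDegree ≤ k := by
    have := Lagrange.degree_interpolate_lt (s := Finset.univ) (v := x) (fun i => F (x i)) hxi
    rw [Finset.card_univ, Fintype.card_fin] at this
    by_cases h0 : q = 0
    · simp [h0]
    · exact Nat.lt_succ_iff.mp ((natDegree_lt_iff_degree_lt h0).mpr this)
  set G : ℝ → ℝ := fun y => F y - q.eval y with hG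
  set g : ℝ → ℝ := fun y => f y - (derivative q).eval y with hg
  have hGd : ∀ y, HasDerivAt G (g y) y := fun y => (hF y).sub (q.hasDerivAt y)
  have hdd : (derivative q).natDegree < k := by
    have := natDegree_derivative_le q; omega
  have hgω : ∀ x t : ℝ, 0 < t → 0 ≤ x → x + k * t ≤ 1 → |fd k t g x| ≤ ω := by
    intro y t ht hy hyt
    rw [hg, fd_sub, fd_eval_eq_zero hdd, sub_zero]
    exact hω y t ht hy hyt
  have hG0 : ∀ j ≤ k, G ((j : ℝ) / N) = 0 := by
    intro j hj
    have := Lagrange.eval_interpolate_at_node (fun i => F (x i)) hxi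
      (Finset.mem_univ (⟨j, by omega⟩ : Fin (k + 1)))
    simp only [hG]
    rw [sub_eq_zero]
    exact this.symm
  have hGω : ∀ x, 0 ≤ x → x + ((k + 1 : ℕ) : ℝ) * (1 / N) ≤ 1 → |fd (k + 1) (1 / N) G x| ≤ ω := by
    intro y hy hyN
    have ht : (0 : ℝ) < 1 / N := by positivity
    have h1 := abs_fd_succ_le (k := k) hGd (x := y) ht (ω := ω) fun s hs hst =>
      hgω (y + s) _ ht (by linarith) (by push_cast at hyN; linarith)
    refine h1.trans (mul_le_of_le_one_right hω0 ?_)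
    rw [div_le_one hN0']; exact_mod_cast hN0
  have hgrid := abs_grid_le hω0 hN0 hG0 hGω
  have hGc : Continuous G := continuous_iff_continuousAt.mpr fun y => (hGd y).continuousAt
  obtain ⟨ξ, hξ, hmax⟩ := isCompact_Icc.exists_isMaxOn (Set.nonempty_Icc.mpr (zero_le_one' ℝ))
    (hGc.abs.continuousOn (s := Set.Icc 0 1))
  set M := |G ξ| with hM
  have hM' : ∀ y ∈ Set.Icc (0 : ℝ) 1, |G y| ≤ M := fun y hy => hmax hy
  have hgM : ∀ y ∈ Set.Icc (0 : ℝ) 1, |g y| ≤ ω + c * M := fun y hy =>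
    abs_le_of_antideriv' hk hGd hgω hM' hy
  have hMle : M ≤ 2 * (B + 1) * ω := by
    set j := ⌊ξ * N⌋₊ with hj
    have hξN : 0 ≤ ξ * N := mul_nonneg hξ.1 hN0'.le
    have hj1 : (j : ℝ) ≤ ξ * N := Nat.floor_le hξN
    have hj2 : ξ * N < j + 1 := Nat.lt_floor_add_one _
    have hjN : j ≤ N := by
      have : (j : ℝ) ≤ N := hj1.trans (mul_le_of_le_one_left hN0'.le hξ.2)
      exact_mod_cast this
    have h1 := hgrid j hjN
    have hp : ((2 : ℝ) ^ (k + 1) + 1) ^ j ≤ B :=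
      pow_le_pow_right₀ (by linarith [pow_pos (two_pos : (0:ℝ) < 2) (k + 1)]) hjN
    set a := (j : ℝ) / N with ha
    have ha0 : 0 ≤ a := by positivity
    have ha1 : a ≤ ξ := by rw [ha, div_le_iff₀ hN0']; exact hj1
    have ha2 : ξ - a ≤ 1 / N := by
      rw [ha, sub_le_iff_le_add, ← add_div, le_div_iff₀ hN0']; linarith
    have h2 : |G ξ - G a| ≤ (ω + c * M) * (ξ - a) := by
      have := abs_sub_le_of_deriv_le (θ := fun t => G (a + t)) (θ' := fun t => g (a + t))
        (δ := ξ - a) (ω := ω + c * M)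
        (fun t => by simpa [Function.comp_def] using (hGd (a + t)).comp t ((hasDerivAt_id t).const_add a))
        (by linarith) (fun t ht1 ht2 => hgM _ ⟨by linarith, by linarith [hξ.2]⟩)
      simpa using this
    have hM0 : 0 ≤ M := abs_nonneg _
    have h3 : M ≤ B * ω + (ω + c * M) * (1 / N) := by
      calc M ≤ |G a| + |G ξ - G a| := by
            rw [hM]; have := abs_add_le (G a) (G ξ - G a); simpa using this
        _ ≤ _ := by
            gcongr ?_ + ?_
            · exact h1.trans (by gcongr)
            · exact h2.trans (by gcongr)
    have hN1 : (1 : ℝ) / N ≤ 1 := by rw [div_le_one hN0']; exact_mod_cast hN0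
    have h4 : c * M * (1 / N) = M / 2 := by rw [hcN]; field_simp
    nlinarith [mul_le_mul_of_nonneg_left hN1 hω0]
  refine ⟨derivative q, hdd, fun y hy => (hgM y hy).trans ?_⟩
  nlinarith

/-- **Whitney's inequality**. -/
theorem whitney (k : ℕ) (hk : 1 ≤ k) : ∃ K : ℝ, 0 < K ∧ ∀ f : ℝ → ℝ, Continuous f → ∀ a b ω : ℝ,
    a < b → (∀ x t : ℝ, 0 < t → a ≤ x → x + k * t ≤ b → |fd k t f x| ≤ ω) →
    ∃ w : ℝ[X], w.natDegree < k ∧ ∀ x ∈ Set.Icc a b, |f x - w.eval x| ≤ K * ω := by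
  obtain ⟨K, hK, h⟩ := whitney_unit k hk
  refine ⟨K, hK, fun f hf a b ω hab hω => ?_⟩
  have hL : 0 < b - a := by linarith
  obtain ⟨w, hwd, hw⟩ := h (fun x => f (a + (b - a) * x)) (by fun_prop) ω (fun x t ht hx hxt => by
    have := hω (a + (b - a) * x) ((b - a) * t) (by positivity) (by nlinarith) (by nlinarith)
    have e : ∀ i : ℕ, a + (b - a) * (x + i * t) = a + (b - a) * x + i * ((b - a) * t) :=
      fun i => by ring
    simpa only [fd, e] using this)
  refine ⟨w.comp (C (1 / (b - a)) * X + C (-a / (b - a))), ?_, fun x hx => ?_⟩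
  · refine lt_of_le_of_lt (natDegree_comp_le.trans ?_) hwd
    calc _ ≤ w.natDegree * 1 := Nat.mul_le_mul_left _ natDegree_linear_le
      _ = _ := mul_one _
  · have := hw ((x - a) / (b - a)) ⟨div_nonneg (by linarith [hx.1]) hL.le,
      (div_le_one hL).mpr (by linarith [hx.2])⟩
    have e1 : a + (b - a) * ((x - a) / (b - a)) = x := by field_simp; ring
    have e2 : 1 / (b - a) * x + -a / (b - a) = (x - a) / (b - a) := by ring
    simpa only [eval_comp, eval_add, eval_mul, eval_C, eval_X, e1, e2] using this

lemma fwdDiff_nat_scale {N : ℕ} (k : ℕ) : ∀ (a : ℕ → ℝ) (ω : ℝ) (M : ℕ),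
    (∀ l, l + k ≤ M → |(fwdDiff 1)^[k] a l| ≤ ω) →
    ∀ l, l + k * N ≤ M → |(fwdDiff N)^[k] a l| ≤ (N : ℝ) ^ k * ω := by
  induction k with
  | zero => intro a ω M h l hl; simpa using h l (by simpa using hl)
  | succ k ih =>
    intro a ω M h l hl
    have hb : fwdDiff N a = ∑ j ∈ Finset.range N, fun l => fwdDiff 1 a (l + j) := by
      funext l
      simp only [fwdDiff, Finset.sum_apply]
      have := Finset.sum_range_sub (fun j => a (l + j)) N
      rw [add_zero] at this
      rw [← this]
      exact Finset.sum_congr rfl fun j _ => by rw [add_assoc]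
    rw [Function.iterate_succ_apply]
    have h1 := ih (fwdDiff N a) (N * ω) (M - N) (fun l hl' => ?_) l (by
      rw [Nat.succ_mul] at hl; omega)
    · rw [pow_succ, mul_assoc]; exact h1
    · have e : (N : ℝ) * ω = ∑ _j ∈ Finset.range N, ω := by simp
      rw [hb, fwdDiff_iter_finsetSum, Finset.sum_apply, e]
      refine (Finset.abs_sum_le_sum_abs _ _).trans (Finset.sum_le_sum fun j hj => ?_)
      rw [fwdDiff_iter_comp_add, ← Function.iterate_succ_apply]
      have := Finset.mem_range.mp hj
      rw [Nat.succ_mul] at hl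
      exact h _ (by omega)

lemma fd_eq_fwdDiff_nat (k N : ℕ) (t : ℝ) (g : ℝ → ℝ) (x : ℝ) (l : ℕ) :
    fd k (N * t) g (x + l * t) = (fwdDiff N)^[k] (fun i : ℕ => g (x + i * t)) l := by
  rw [fwdDiff_iter_eq_sum_shift, fd]
  refine Finset.sum_congr rfl fun i _ => ?_
  simp only [smul_eq_mul, zsmul_eq_mul]
  push_cast
  congr 2
  ring

lemma abs_fd_scale_le {k N : ℕ} {t : ℝ} {g : ℝ → ℝ} {x b ω : ℝ} (ht : 0 < t)
    (hb : x + k * (N * t) ≤ b) (h : ∀ y, x ≤ y → y + k * t ≤ b → |fd k t g y| ≤ ω) :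
    |fd k (N * t) g x| ≤ (N : ℝ) ^ k * ω := by
  have h1 := fwdDiff_nat_scale (N := N) k (fun i : ℕ => g (x + i * t)) ω (k * N) (fun l hl => by
    have := fd_eq_fwdDiff_nat k 1 t g x l
    rw [Nat.cast_one, one_mul] at this
    rw [← this]
    have hl' : (l : ℝ) + k ≤ k * N := by exact_mod_cast hl
    exact h _ (by nlinarith [Nat.cast_nonneg (α := ℝ) l]) (by nlinarith)) 0 (by omega)
  rw [← fd_eq_fwdDiff_nat] at h1
  simpa using h1

lemma omegaK_eq (g : ℝ → ℝ) (k : ℕ) (t a b : ℝ) : omegaK g k t a b =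
    sSup {v : ℝ | ∃ h x : ℝ, 0 < h ∧ h ≤ t ∧ a ≤ x ∧ x + (k : ℝ) * h ≤ b ∧ v = |fd k h g x|} := rfl

lemma mem_Icc_of_step {k i : ℕ} {a b x h : ℝ} (hi : i ≤ k) (hh : 0 < h) (hx : a ≤ x)
    (hxb : x + k * h ≤ b) : x + i * h ∈ Set.Icc a b := by
  have hi' : (i : ℝ) ≤ k := by exact_mod_cast hi
  exact ⟨by nlinarith [Nat.cast_nonneg (α := ℝ) i], by nlinarith⟩

lemma omegaK_nonneg (g : ℝ → ℝ) (k : ℕ) (t a b : ℝ) : 0 ≤ omegaK g k t a b := by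
  rw [omegaK_eq]
  refine Real.sSup_nonneg ?_
  rintro v ⟨h, x, -, -, -, -, rfl⟩
  exact abs_nonneg _

lemma abs_fd_le_omegaK {g : ℝ → ℝ} {a b : ℝ} (hg : ContinuousOn g (Set.Icc a b)) {k : ℕ}
    {t h x : ℝ} (hh : 0 < h) (hht : h ≤ t) (hx : a ≤ x) (hxb : x + k * h ≤ b) :
    |fd k h g x| ≤ omegaK g k t a b := by
  rw [omegaK_eq]
  obtain ⟨M, hM⟩ := isCompact_Icc.exists_bound_of_continuousOn hg
  refine le_csSup ⟨2 ^ k * M, ?_⟩ ⟨h, x, hh, hht, hx, hxb, rfl⟩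
  rintro v ⟨h', x', hh', -, hx', hxb', rfl⟩
  calc _ ≤ ∑ i ∈ Finset.range (k + 1), (k.choose i : ℝ) * M := by
        refine (Finset.abs_sum_le_sum_abs _ _).trans (Finset.sum_le_sum fun i hi => ?_)
        rw [abs_mul, abs_mul, abs_pow, abs_neg, abs_one, one_pow, one_mul, Nat.abs_cast]
        have := hM _ (mem_Icc_of_step (Nat.lt_succ_iff.mp (Finset.mem_range.mp hi)) hh' hx' hxb')
        rw [Real.norm_eq_abs] at this
        gcongr
    _ = _ := by rw [← Finset.sum_mul, sum_choose_real]

lemma omegaK_le {g : ℝ → ℝ} {k : ℕ} {t a b M : ℝ} (hM : 0 ≤ M)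
    (h : ∀ h x : ℝ, 0 < h → h ≤ t → a ≤ x → x + k * h ≤ b → |fd k h g x| ≤ M) :
    omegaK g k t a b ≤ M := by
  rw [omegaK_eq]
  refine Real.sSup_le ?_ hM
  rintro v ⟨h', x', h1, h2, h3, h4, rfl⟩
  exact h h' x' h1 h2 h3 h4

lemma omegaK_mono {g : ℝ → ℝ} {a b : ℝ} (hg : ContinuousOn g (Set.Icc a b)) (k : ℕ) {t t' : ℝ}
    (h : t ≤ t') : omegaK g k t a b ≤ omegaK g k t' a b :=
  omegaK_le (omegaK_nonneg ..) fun _ _ h1 h2 h3 h4 => abs_fd_le_omegaK hg h1 (h2.trans h) h3 h4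

lemma omegaK_nat_mul_le {g : ℝ → ℝ} {a b : ℝ} (hg : ContinuousOn g (Set.Icc a b)) (k : ℕ) {N : ℕ}
    (hN : 1 ≤ N) (t : ℝ) : omegaK g k (N * t) a b ≤ (N : ℝ) ^ k * omegaK g k t a b := by
  have hN0 : (0 : ℝ) < N := by exact_mod_cast hN
  refine omegaK_le (mul_nonneg (by positivity) (omegaK_nonneg ..)) fun h x h1 h2 h3 h4 => ?_
  have e : h = N * (h / N) := by field_simp
  rw [e] at h4 ⊢
  refine abs_fd_scale_le (by positivity) h4 fun y hy hyb => ?_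
  exact abs_fd_le_omegaK hg (by positivity) (by rw [div_le_iff₀ hN0]; linarith) (h3.trans hy) hyb

/-- Dilating the step by a real factor `R ≥ 1`. -/
lemma omegaK_mul_le {g : ℝ → ℝ} {a b : ℝ} (hg : ContinuousOn g (Set.Icc a b)) (k : ℕ) {R t : ℝ}
    (hR : 1 ≤ R) (ht : 0 ≤ t) :
    omegaK g k (R * t) a b ≤ 2 ^ k * R ^ k * omegaK g k t a b := by
  have h1 : (⌈R⌉₊ : ℝ) ≤ 2 * R := by linarith [Nat.ceil_lt_add_one (zero_le_one.trans hR)]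
  have h0 : 1 ≤ ⌈R⌉₊ := Nat.one_le_ceil_iff.mpr (by linarith)
  calc _ ≤ omegaK g k (⌈R⌉₊ * t) a b :=
        omegaK_mono hg k (mul_le_mul_of_nonneg_right (Nat.le_ceil R) ht)
    _ ≤ (⌈R⌉₊ : ℝ) ^ k * omegaK g k t a b := omegaK_nat_mul_le hg k h0 t
    _ ≤ (2 * R) ^ k * omegaK g k t a b := by
        have := omegaK_nonneg g k t a b
        gcongr
    _ = _ := by rw [mul_pow]

lemma omegaK_congr {g₁ g₂ : ℝ → ℝ} {a b : ℝ} (h : ∀ x ∈ Set.Icc a b, g₁ x = g₂ x) (k : ℕ) (t : ℝ) :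
    omegaK g₁ k t a b = omegaK g₂ k t a b := by
  have key : ∀ h' x : ℝ, 0 < h' → a ≤ x → x + k * h' ≤ b → fd k h' g₁ x = fd k h' g₂ x := by
    intro h' x h1 h2 h3
    refine Finset.sum_congr rfl fun i hi => ?_
    rw [h _ (mem_Icc_of_step (Nat.lt_succ_iff.mp (Finset.mem_range.mp hi)) h1 h2 h3)]
  rw [omegaK_eq, omegaK_eq]
  congr 1
  ext v
  refine exists_congr fun h' => exists_congr fun x => ?_
  constructor
  · rintro ⟨h1, h2, h3, h4, rfl⟩
    exact ⟨h1, h2, h3, h4, by rw [key h' x h1 h3 h4]⟩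
  · rintro ⟨h1, h2, h3, h4, rfl⟩
    exact ⟨h1, h2, h3, h4, by rw [key h' x h1 h3 h4]⟩

lemma exists_contDiff_extension {a b : ℝ} (hab : a < b) (r : ℕ) : ∀ f : ℝ → ℝ,
    ContDiffOn ℝ r f (Set.Icc a b) → ∃ F : ℝ → ℝ, ContDiff ℝ r F ∧ ∀ x ∈ Set.Icc a b, F x = f x := by
  induction r with
  | zero =>
    intro f hf
    have hf' : ContinuousOn f (Set.Icc a b) := hf.continuousOn
    refine ⟨Set.IccExtend hab.le ((Set.Icc a b).restrict f), ?_, fun x hx => ?_⟩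
    · rw [Nat.cast_zero, contDiff_zero]
      exact hf'.restrict.Icc_extend'
    · rw [Set.IccExtend_of_mem _ _ hx]; rfl
  | succ r ih =>
    intro f hf
    have hu := uniqueDiffOn_Icc hab
    push_cast at hf
    obtain ⟨hd, -, hd'⟩ := (contDiffOn_succ_iff_derivWithin hu).mp hf
    obtain ⟨G, hG, hGf⟩ := ih _ hd'
    obtain ⟨F, hF⟩ := exists_antideriv hG.continuous
    refine ⟨fun x => F x + (f a - F a), ?_, fun x hx => ?_⟩
    · have hd1 : deriv (fun x => F x + (f a - F a)) = G :=
        funext fun x => ((hF x).add_const _).deriv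
      push_cast
      rw [contDiff_succ_iff_deriv, hd1]
      exact ⟨fun x => ((hF x).add_const _).differentiableAt, by simp, hG⟩
    · have := constant_of_derivWithin_zero (f := fun x => F x - f x) (a := a) (b := b)
        (fun y hy => (hF y).differentiableAt.differentiableWithinAt.sub (hd y hy))
        (fun y hy => by
          have hy' := Set.Ico_subset_Icc_self hy
          have := (hF y).hasDerivWithinAt.sub (hd y hy').hasDerivWithinAt
          rw [hGf y hy', sub_self] at this
          exact this.derivWithin (hu y hy')) x hx
      linarith

lemma iteratedDerivWithin_eq_of_extension {a b : ℝ} (hab : a < b) {r i : ℕ} (hi : i ≤ r)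
    {f F : ℝ → ℝ} (hF : ContDiff ℝ r F) (h : ∀ x ∈ Set.Icc a b, F x = f x) {x : ℝ}
    (hx : x ∈ Set.Icc a b) : iteratedDerivWithin i f (Set.Icc a b) x = iteratedDeriv i F x := by
  rw [← iteratedDerivWithin_eq_iteratedDeriv (uniqueDiffOn_Icc hab)
    ((hF.of_le (by exact_mod_cast hi)).contDiffAt) hx]
  exact iteratedDerivWithin_congr (fun y hy => (h y hy).symm) hx

lemma exists_taylor_lift (w : ℝ[X]) (u : ℝ) (r : ℕ) : ∀ F : ℝ → ℝ, ContDiff ℝ r F →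
    ∃ q : ℝ[X], q.natDegree ≤ w.natDegree + r ∧ derivative^[r] q = w ∧
      (∀ i < r, (derivative^[i] q).eval u = iteratedDeriv i F u) ∧
      ∀ (a b κ : ℝ), u ∈ Set.Icc a b →
        (∀ x ∈ Set.Icc a b, |iteratedDeriv r F x - w.eval x| ≤ κ) →
        ∀ x ∈ Set.Icc a b, |F x - q.eval x| ≤ κ * |x - u| ^ r := by
  induction r with
  | zero =>
    intro F _
    refine ⟨w, by simp, rfl, by simp, fun a b κ _ h x hx => ?_⟩
    simpa using h x hx
  | succ r ih =>
    intro F hF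
    push_cast at hF
    obtain ⟨hd, -, hd'⟩ := contDiff_succ_iff_deriv.mp hF
    obtain ⟨q, hqd, hqw, hqi, hq⟩ := ih _ hd'
    obtain ⟨Q, hQ, hQd⟩ := exists_derivative_eq q
    have hQ' : derivative (Q + C (F u - Q.eval u)) = q := by simp [hQ]
    refine ⟨Q + C (F u - Q.eval u), ?_, ?_, fun i hi => ?_, fun a b κ hu h x hx => ?_⟩
    · rw [natDegree_add_C]; omega
    · rw [Function.iterate_succ_apply, hQ', hqw]
    · rcases i with _ | i
      · simp
      · rw [Function.iterate_succ_apply, hQ', iteratedDeriv_succ']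
        exact hqi i (by omega)
    · have hqx := hq a b κ hu (fun y hy => by rw [← iteratedDeriv_succ']; exact h y hy)
      have hκ : 0 ≤ κ := (abs_nonneg _).trans (h u hu)
      have hsub : Set.uIcc u x ⊆ Set.Icc a b := Set.uIcc_subset_Icc hu hx
      have := Convex.norm_image_sub_le_of_norm_hasDerivWithin_le
        (f := fun y => F y - (Q + C (F u - Q.eval u)).eval y)
        (f' := fun y => deriv F y - q.eval y) (s := Set.uIcc u x) (C := κ * |x - u| ^ r)
        (x := u) (y := x)
        (fun y _ => by
          have h1 := (hd y).hasDerivAt.sub ((Q + C (F u - Q.eval u)).hasDerivAt y)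
          rw [hQ'] at h1
          exact h1.hasDerivWithinAt)
        (fun y hy => by
          rw [Real.norm_eq_abs]
          refine (hqx y (hsub hy)).trans ?_
          have : |y - u| ≤ |x - u| := Set.abs_sub_left_of_mem_uIcc hy
          gcongr)
        (convex_uIcc u x) Set.left_mem_uIcc Set.right_mem_uIcc
      simp only [eval_add, eval_C, Real.norm_eq_abs] at this ⊢
      rw [pow_succ, ← mul_assoc]
      convert this using 2
      ring

/-- Local approximation near `u` by a polynomial which interpolates at `u`. -/
theorem exists_local_poly (r k : ℕ) (hk : 1 ≤ k) (R : ℝ) (hR : 1 ≤ R) : ∃ K : ℝ, 0 < K ∧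
    ∀ F : ℝ → ℝ, ContDiff ℝ r F → ∀ u ∈ Set.Icc (-1 : ℝ) 1, ∀ t : ℝ, 0 < t →
    ∃ q : ℝ[X], q.natDegree < k + r ∧ (∀ i < r, (derivative^[i] q).eval u = iteratedDeriv i F u) ∧
      ∀ x ∈ Set.Icc (-1 : ℝ) 1, |x - u| ≤ R * t →
        |iteratedDeriv r F x - (derivative^[r] q).eval x|
          ≤ K * omegaK (iteratedDeriv r F) k t (-1) 1 ∧
        |F x - q.eval x| ≤ K * omegaK (iteratedDeriv r F) k t (-1) 1 * |x - u| ^ r := by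
  obtain ⟨K, hK, hW⟩ := whitney k hk
  refine ⟨K * (2 ^ k * (2 * R) ^ k), by positivity, fun F hF u hu t ht => ?_⟩
  set g := iteratedDeriv r F
  have hg : Continuous g := hF.continuous_iteratedDeriv r le_rfl
  set a := max (-1) (u - R * t)
  set b := min 1 (u + R * t)
  have hRt : 0 < R * t := by positivity
  have hab : a < b := by
    refine max_lt (lt_min (by norm_num) (by linarith [hu.1])) (lt_min ?_ ?_) <;>
      linarith [hu.1, hu.2]
  have hk0 : (1 : ℝ) ≤ k := by exact_mod_cast hk
  obtain ⟨w, hwd, hw⟩ := hW g hg a b (omegaK g k (2 * R * t) (-1) 1) hab (fun x s hs hx hxs => by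
    have h1 : -1 ≤ a := le_max_left _ _
    have h2 : b ≤ 1 := min_le_left _ _
    have h3 : u - R * t ≤ a := le_max_right _ _
    have h4 : b ≤ u + R * t := min_le_right _ _
    exact abs_fd_le_omegaK hg.continuousOn hs
      (by linarith [le_mul_of_one_le_left hs.le hk0]) (h1.trans hx) (hxs.trans h2))
  obtain ⟨q, hqd, hqw, hqi, hq⟩ := exists_taylor_lift w u r F hF
  have hua : u ∈ Set.Icc a b :=
    ⟨max_le hu.1 (by linarith), le_min hu.2 (by linarith)⟩
  have hle : K * omegaK g k (2 * R * t) (-1) 1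
      ≤ K * (2 ^ k * (2 * R) ^ k) * omegaK g k t (-1) 1 := by
    have h2R : 1 ≤ 2 * R := by linarith
    rw [mul_assoc K]
    exact mul_le_mul_of_nonneg_left (omegaK_mul_le hg.continuousOn k h2R ht.le) hK.le
  refine ⟨q, by omega, hqi, fun x hx hxu => ?_⟩
  have hxab : x ∈ Set.Icc a b := by
    rw [abs_le] at hxu
    exact ⟨max_le hx.1 (by linarith), le_min hx.2 (by linarith)⟩
  rw [hqw]
  exact ⟨(hw x hxab).trans hle, (hq a b _ hua hw x hxab).trans
    (mul_le_mul_of_nonneg_right hle (by positivity))⟩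

lemma cubic_fix_unit {ε a b d κ : ℝ} (hε : 0 ≤ ε) (hκ : 0 ≤ κ)
    (H : ∀ t : ℝ, |t| ≤ 1 → -κ * |t| ≤ ε + a * t + b * t ^ 2 + d * t ^ 3) :
    ∃ a', |a' - a| ≤ κ ∧ ∀ t : ℝ, |t| ≤ 1 → 0 ≤ ε + a' * t + (b + 2 * κ) * t ^ 2 + d * t ^ 3 := by
  have hpos : ∀ a b d : ℝ, (∀ t : ℝ, |t| ≤ 1 → -κ * |t| ≤ ε + a * t + b * t ^ 2 + d * t ^ 3) →
      κ < a → ∀ t : ℝ, |t| ≤ 1 → 0 ≤ ε + (a - κ) * t + (b + 2 * κ) * t ^ 2 + d * t ^ 3 := by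
    intro a b d H ha t ht
    have h1 := H t ht
    obtain ⟨l, u⟩ := abs_le.mp ht
    rcases le_total t 0 with h0 | h0
    · rw [abs_of_nonpos h0] at h1
      nlinarith [mul_nonneg hκ (sq_nonneg t)]
    · rcases le_total 0 d with hd | hd
      · have h2 := H (-t) (by rwa [abs_neg])
        rw [abs_neg, abs_of_nonneg h0] at h2
        nlinarith [mul_nonneg hκ (sq_nonneg t), mul_nonneg hd (pow_nonneg h0 3),
          mul_nonneg (sub_nonneg.mpr ha.le) h0]
      · have h2 := H 1 (by norm_num)
        rw [abs_one] at h2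
        have h3 : t ^ 2 * (b + d * t) ≥ t ^ 2 * (-κ - ε - a) := by
          apply mul_le_mul_of_nonneg_left _ (sq_nonneg t)
          nlinarith
        have h4 : 0 ≤ ε * (1 - t ^ 2) := mul_nonneg hε (by nlinarith)
        have h5 : 0 ≤ (a - κ) * (t - t ^ 2) := mul_nonneg (by linarith) (by nlinarith)
        nlinarith
  rcases lt_or_ge κ a with ha | ha
  · exact ⟨a - κ, by rw [sub_sub_cancel_left, abs_neg, abs_of_nonneg hκ], hpos a b d H ha⟩
  rcases lt_or_ge a (-κ) with ha' | ha'
  · refine ⟨a + κ, by rw [add_sub_cancel_left, abs_of_nonneg hκ], fun t ht => ?_⟩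
    have := hpos (-a) b (-d) (fun t ht => by
      have := H (-t) (by rwa [abs_neg])
      rw [abs_neg] at this
      nlinarith) (by linarith) (-t) (by rwa [abs_neg])
    nlinarith
  · refine ⟨0, by rw [zero_sub, abs_neg, abs_le]; exact ⟨ha', ha⟩, fun t ht => ?_⟩
    obtain ⟨l, u⟩ := abs_le.mp ht
    have h1 := H 1 (by norm_num)
    have h2 := H (-1) (by norm_num)
    rw [abs_one] at h1
    rw [abs_neg, abs_one] at h2
    have h3 : -ε - 2 * κ ≤ b + d * t := by
      rcases le_total 0 d with hd | hd <;> nlinarith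
    have h4 : 0 ≤ ε * (1 - t ^ 2) := mul_nonneg hε (by nlinarith)
    nlinarith [mul_le_mul_of_nonneg_left h3 (sq_nonneg t)]

lemma cubic_fix {ε a b d κ δ : ℝ} {J : Set ℝ} (hε : 0 ≤ ε) (hκ : 0 ≤ κ) (hδ : 0 < δ)
    (hJ : ∀ t : ℝ, |t| ≤ δ → t ∈ J)
    (H : ∀ t ∈ J, t ≠ 0 → -κ * |t| ≤ ε + a * t + b * t ^ 2 + d * t ^ 3) :
    ∃ a', |a' - a| ≤ κ ∧ ∀ t ∈ J, 0 ≤ ε + a' * t + (b + 2 * κ / δ) * t ^ 2 + d * t ^ 3 := by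
  obtain ⟨A, hA, hA'⟩ := cubic_fix_unit (ε := ε) (a := a * δ) (b := b * δ ^ 2) (d := d * δ ^ 3)
    (κ := κ * δ) hε (by positivity) (fun t ht => by
      rcases eq_or_ne t 0 with rfl | h0
      · simpa using hε
      have := H (δ * t) (hJ _ (by
        rw [abs_mul, abs_of_pos hδ]; exact mul_le_of_le_one_right hδ.le ht)) (by positivity)
      rw [abs_mul, abs_of_pos hδ] at this
      nlinarith)
  have ha' : |A / δ - a| ≤ κ := by
    have : A / δ - a = (A - a * δ) / δ := by field_simp
    rw [this, abs_div, abs_of_pos hδ, div_le_iff₀ hδ]; exact hA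
  refine ⟨A / δ, ha', fun t ht => ?_⟩
  rcases le_total |t| δ with h | h
  · have := hA' (t / δ) (by rw [abs_div, abs_of_pos hδ, div_le_one hδ]; exact h)
    have e : ε + A * (t / δ) + (b * δ ^ 2 + 2 * (κ * δ)) * (t / δ) ^ 2 + d * δ ^ 3 * (t / δ) ^ 3
        = ε + A / δ * t + (b + 2 * κ / δ) * t ^ 2 + d * t ^ 3 := by field_simp
    rwa [e] at this
  · have h0 : t ≠ 0 := abs_pos.mp (hδ.trans_le h)
    have h1 := H t ht h0
    have h2 : -(κ * |t|) ≤ (A / δ - a) * t := by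
      have := (abs_le.mp (abs_mul (A / δ - a) t).le).1
      nlinarith [mul_le_mul_of_nonneg_right ha' (abs_nonneg t)]
    have h3 : 2 * κ * |t| ≤ 2 * κ / δ * t ^ 2 := by
      rw [← sq_abs t, div_mul_eq_mul_div, le_div_iff₀ hδ]
      nlinarith [mul_nonneg (mul_nonneg hκ (abs_nonneg t)) (sub_nonneg.mpr h)]
    nlinarith

lemma linear_fix {ε a κ δ : ℝ} {J : Set ℝ} (hε : 0 ≤ ε) (hκ : 0 ≤ κ) (hδ : 0 < δ)
    (hJ : ∀ t : ℝ, |t| ≤ δ → t ∈ J) (H : ∀ t ∈ J, t ≠ 0 → -κ ≤ ε + a * t) :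
    ∃ a', |a' - a| ≤ κ / δ ∧ ∀ t ∈ J, 0 ≤ ε + a' * t + 2 * κ / δ ^ 2 * t ^ 2 := by
  have h1 := H δ (hJ _ (abs_of_pos hδ).le) hδ.ne'
  have h2 := H (-δ) (hJ _ (by rw [abs_neg, abs_of_pos hδ])) (by linarith)
  have hκδ : 0 ≤ κ / δ := by positivity
  have hκδ' : κ / δ * δ = κ := by field_simp
  obtain ⟨a', ha, haδ⟩ : ∃ a', |a' - a| ≤ κ / δ ∧ |a'| * δ ≤ ε := by
    rcases lt_or_ge (κ / δ) a with h | h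
    · refine ⟨a - κ / δ, by rw [sub_sub_cancel_left, abs_neg, abs_of_nonneg hκδ], ?_⟩
      rw [abs_of_pos (by linarith)]; nlinarith
    rcases lt_or_ge a (-(κ / δ)) with h' | h'
    · refine ⟨a + κ / δ, by rw [add_sub_cancel_left, abs_of_nonneg hκδ], ?_⟩
      rw [abs_of_neg (by linarith)]; nlinarith
    · exact ⟨0, by rw [zero_sub, abs_neg, abs_le]; exact ⟨h', h⟩, by simpa using hε⟩
  refine ⟨a', ha, fun t ht => ?_⟩
  have h3 : -(|a'| * |t|) ≤ a' * t := (abs_le.mp (abs_mul a' t).le).1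
  rcases le_total |t| δ with h | h
  · have : 0 ≤ 2 * κ / δ ^ 2 * t ^ 2 := by positivity
    nlinarith [mul_le_mul_of_nonneg_left h (abs_nonneg a')]
  · have h4 := H t ht (abs_pos.mp (hδ.trans_le h))
    have h5 : -(κ / δ * |t|) ≤ (a' - a) * t := by
      have := (abs_le.mp (abs_mul (a' - a) t).le).1
      nlinarith [mul_le_mul_of_nonneg_right ha (abs_nonneg t)]
    set s := |t| / δ with hs
    have hs1 : 1 ≤ s := by rw [hs, le_div_iff₀ hδ]; linarith
    have e1 : κ / δ * |t| = κ * s := by rw [hs]; ring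
    have e2 : 2 * κ / δ ^ 2 * t ^ 2 = 2 * κ * s ^ 2 := by
      rw [hs, ← sq_abs t, div_pow]; ring
    rw [e1] at h5
    rw [e2]
    nlinarith [mul_nonneg hκ (sub_nonneg.mpr hs1), mul_nonneg hκ (mul_nonneg (sub_nonneg.mpr hs1)
      (sub_nonneg.mpr hs1))]

lemma linear_fix_end {ε a κ δ σ t : ℝ} (hε : 0 ≤ ε) (hκ : 0 ≤ κ) (hδ : 0 < δ) (hσ : σ ^ 2 = 1)
    (ht : 0 ≤ σ * t) (H : -κ ≤ ε + a * t) (Hδ : -κ ≤ ε + a * (σ * δ)) :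
    0 ≤ ε + (a + σ * (κ / δ)) * t := by
  set s := σ * t / δ with hs
  have hs0 : 0 ≤ s := div_nonneg ht hδ.le
  have e1 : t = s * (σ * δ) := by
    rw [hs]; field_simp; linear_combination (-t) * hσ
  have e2 : ε + (a + σ * (κ / δ)) * t = ε + a * t + κ * s := by rw [hs]; ring
  rw [e2]
  rcases le_total 1 s with h | h
  · nlinarith
  · rw [e1]
    nlinarith [mul_nonneg hε (sub_nonneg.mpr h), mul_nonneg hs0 (by linarith : 0 ≤ ε + a * (σ * δ) + κ)]

lemma eval_iterate_derivative_eq_of_dvd {p q : ℝ[X]} {z : ℝ} {n i : ℕ}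
    (h : (X - C z) ^ n ∣ p - q) (hi : i < n) :
    (derivative^[i] p).eval z = (derivative^[i] q).eval z := by
  have h1 := pow_sub_dvd_iterate_derivative_of_pow_dvd i h
  have h2 : X - C z ∣ derivative^[i] (p - q) := (dvd_pow_self _ (by omega)).trans h1
  rw [iterate_derivative_sub, dvd_iff_isRoot, IsRoot, eval_sub] at h2
  linarith

lemma exists_quartic_expansion {q : ℝ[X]} (hq : q.natDegree < 5) (z : ℝ) : ∃ a b d e : ℝ,
    (derivative q).eval z = a ∧ (∀ x, q.eval x = q.eval z + a * (x - z) + b * (x - z) ^ 2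
      + d * (x - z) ^ 3 + e * (x - z) ^ 4) ∧
    (q.natDegree < 4 → e = 0) ∧ (q.natDegree < 3 → d = 0) ∧ (q.natDegree < 2 → b = 0) := by
  have hd : (taylor z q).natDegree = q.natDegree := natDegree_taylor q z
  refine ⟨(taylor z q).coeff 1, (taylor z q).coeff 2, (taylor z q).coeff 3, (taylor z q).coeff 4,
    (taylor_coeff_one z q).symm, fun x => ?_, fun h => ?_, fun h => ?_, fun h => ?_⟩
  · have h1 : (taylor z q).eval (x - z) = q.eval x := by rw [taylor_eval]; congr 1; ring
    rw [← h1, eval_eq_sum_range' (n := 5) (by rw [hd]; exact hq), Finset.sum_range_succ,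
      Finset.sum_range_succ, Finset.sum_range_succ, Finset.sum_range_succ, Finset.sum_range_one,
      taylor_coeff_zero]
    ring
  all_goals exact coeff_eq_zero_of_natDegree_lt (by omega)

lemma natDegree_C_mul_sub_pow_le (a z : ℝ) (n : ℕ) : (C a * (X - C z) ^ n).natDegree ≤ n := by
  refine (natDegree_C_mul_le _ _).trans ?_
  rw [natDegree_pow, natDegree_X_sub_C, mul_one]

lemma nonneg_of_forall_pos {φ : ℝ → ℝ} (hφ : ContinuousAt φ 0) {δ : ℝ} (hδ : 0 < δ)
    (h : ∀ t, 0 < t → t ≤ δ → 0 ≤ φ t) : 0 ≤ φ 0 := by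
  have h1 : Filter.Tendsto φ (nhdsWithin 0 (Set.Ioi 0)) (nhds (φ 0)) := hφ.mono_left nhdsWithin_le_nhds
  refine ge_of_tendsto h1 ?_
  filter_upwards [Ioo_mem_nhdsGT hδ] with t ht
  exact h t ht.1 ht.2.le

lemma eq_zero_of_sign_change {F : ℝ → ℝ} {z δ : ℝ} (hF : Continuous F) (hδ : 0 < δ)
    (h : ∀ x, |x - z| ≤ δ → 0 ≤ F x * (x - z)) : F z = 0 := by
  have h1 := nonneg_of_forall_pos (φ := fun t => F (z + t)) (by fun_prop) hδ fun t ht htδ => by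
    have := h (z + t) (by rwa [add_sub_cancel_left, abs_of_pos ht])
    rw [add_sub_cancel_left] at this
    exact nonneg_of_mul_nonneg_left this ht
  have h2 := nonneg_of_forall_pos (φ := fun t => -F (z - t)) (by fun_prop) hδ fun t ht htδ => by
    have := h (z - t) (by rwa [sub_sub_cancel_left, abs_neg, abs_of_pos ht])
    rw [sub_sub_cancel_left, mul_neg, ← neg_mul] at this
    exact nonneg_of_mul_nonneg_left this ht
  simp only [add_zero, sub_zero] at h1 h2
  linarith

lemma deriv_nonneg_of_sign_change {F : ℝ → ℝ} {z δ : ℝ} (hF : Differentiable ℝ F) (hδ : 0 < δ)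
    (h : ∀ x, |x - z| ≤ δ → 0 ≤ F x * (x - z)) : 0 ≤ deriv F z := by
  have h0 := eq_zero_of_sign_change hF.continuous hδ h
  have h1 := (hasDerivAt_iff_tendsto_slope.mp (hF z).hasDerivAt).mono_left
    (nhdsGT_le_nhdsNE z)
  refine ge_of_tendsto h1 ?_
  filter_upwards [Ioo_mem_nhdsGT (show z < z + δ by linarith)] with x hx
  have hxz : 0 < x - z := by linarith [hx.1]
  rw [slope_def_field, h0, sub_zero]
  exact div_nonneg (nonneg_of_mul_nonneg_left (h x (by rw [abs_of_pos hxz]; linarith [hx.2])) hxz)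
    hxz.le

/-- `q` is a local approximation to `F` on `J`, interpolating at `z`. -/
structure LocalData (r k : ℕ) (F : ℝ → ℝ) (z h κ : ℝ) (q : ℝ[X]) (J : Set ℝ) : Prop where
  contDiff : ContDiff ℝ r F
  deg : q.natDegree < k + r
  interp : ∀ i < r, (derivative^[i] q).eval z = iteratedDeriv i F z
  top : |iteratedDeriv r F z - (derivative^[r] q).eval z| ≤ κ
  near : ∀ x ∈ J, |F x - q.eval x| ≤ κ * |x - z| ^ r
  sub : ∀ x ∈ J, |x - z| ≤ h
  mem : z ∈ J
  pos : 0 < h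

/-- `p` is a correction of `q` which interpolates `F` at `z` up to the order `μ`. -/
structure Corrects (r k : ℕ) (μ : ℤ) (F : ℝ → ℝ) (z h η : ℝ) (q p : ℝ[X]) : Prop where
  deg : p.natDegree ≤ k + r + 5
  interp : ∀ i : ℕ, (i : ℤ) ≤ μ → (derivative^[i] p).eval z = iteratedDeriv i F z
  close : ∀ x, |x - z| ≤ h → |p.eval x - q.eval x| ≤ η * h ^ r

namespace LocalData

variable {r k : ℕ} {F : ℝ → ℝ} {z h κ : ℝ} {q : ℝ[X]} {J : Set ℝ}

lemma kappa_nonneg (L : LocalData r k F z h κ q J) : 0 ≤ κ := (abs_nonneg _).trans L.top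

/-- Adding a multiple of a power of `X - z`. -/
lemma corrects_add (L : LocalData r k F z h κ q J) {μ : ℤ} {n : ℕ} {c η : ℝ} (hn : n ≤ r + 1)
    (hμ : μ < n) (hμr : μ < r) (hc : |c| * h ^ n ≤ η * h ^ r) :
    Corrects r k μ F z h η q (q + C c * (X - C z) ^ n) where
  deg := (natDegree_add_le _ _).trans (max_le (by have := L.deg; omega)
    ((natDegree_C_mul_sub_pow_le c z n).trans (by omega)))
  interp i hi := by
    rw [← L.interp i (by omega)]
    refine eval_iterate_derivative_eq_of_dvd (n := n) ?_ (by omega)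
    rw [add_sub_cancel_left]; exact dvd_mul_left _ _
  close x hx := by
    simp only [eval_add, eval_mul, eval_C, eval_pow, eval_sub, eval_X, add_sub_cancel_left]
    rw [abs_mul, abs_pow]
    exact (mul_le_mul_of_nonneg_left (pow_le_pow_left₀ (abs_nonneg _) hx n) (abs_nonneg _)).trans hc

lemma exists_nonneg_free (L : LocalData r k F z h κ q J) (hF : ∀ x ∈ J, 0 ≤ F x) :
    ∃ p, Corrects r k (-1) F z h κ q p ∧ ∀ x ∈ J, 0 ≤ p.eval x := by
  have hκ := L.kappa_nonneg
  have hh := L.pos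
  refine ⟨_, L.corrects_add (n := 0) (c := κ * h ^ r) (by omega) (by simp) (by omega) ?_, ?_⟩
  · rw [abs_of_nonneg (by positivity), pow_zero, mul_one]
  · intro x hx
    have h1 := (abs_le.mp (L.near x hx)).2
    have h2 : κ * |x - z| ^ r ≤ κ * h ^ r :=
      mul_le_mul_of_nonneg_left (pow_le_pow_left₀ (abs_nonneg _) (L.sub x hx) r) hκ
    have := hF x hx
    simp only [eval_add, eval_mul, eval_C, eval_pow, pow_zero, mul_one]
    linarith

/-- Common part of the generic corrections: the added term dominates the error. -/
lemma nonneg_add_of_le (L : LocalData r k F z h κ q J) {c : ℝ} {n : ℕ} {S : ℝ → ℝ} {x : ℝ}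
    (hx : x ∈ J) (hF : 0 ≤ F x * S x)
    (hc : κ * |x - z| ^ r * |S x| ≤ c * (x - z) ^ n * S x) :
    0 ≤ (q + C c * (X - C z) ^ n).eval x * S x := by
  have h1 := L.near x hx
  have h2 : |(F x - q.eval x) * S x| ≤ κ * |x - z| ^ r * |S x| := by
    rw [abs_mul]; exact mul_le_mul_of_nonneg_right h1 (abs_nonneg _)
  have h3 := (abs_le.mp h2).2
  simp only [eval_add, eval_mul, eval_C, eval_pow, eval_sub, eval_X]
  nlinarith

lemma abs_pow_le_mul (L : LocalData r k F z h κ q J) {x : ℝ} (hx : x ∈ J) {n : ℕ} (hn : n ≤ r) :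
    κ * |x - z| ^ r ≤ κ * h ^ (r - n) * |x - z| ^ n := by
  have hκ := L.kappa_nonneg
  have e : r = (r - n) + n := by omega
  calc κ * |x - z| ^ r = κ * (|x - z| ^ (r - n) * |x - z| ^ n) := by rw [← pow_add, ← e]
    _ ≤ κ * (h ^ (r - n) * |x - z| ^ n) := by
        have := L.sub x hx
        gcongr
    _ = _ := by ring

lemma corrects_generic (L : LocalData r k F z h κ q J) {μ : ℤ} {n : ℕ} (hn : n ≤ r)
    (hμ : μ < n) {σ : ℝ} (hσ : |σ| = 1) :
    Corrects r k μ F z h κ q (q + C (σ * (κ * h ^ (r - n))) * (X - C z) ^ n) := by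
  have hκ := L.kappa_nonneg
  have hh := L.pos
  refine L.corrects_add (by omega) hμ (by omega) ?_
  rw [abs_mul, hσ, one_mul, abs_of_nonneg (by positivity), mul_assoc, ← pow_add]
  rw [show r - n + n = r by omega]

lemma exists_nonneg_generic (L : LocalData r k F z h κ q J) (hF : ∀ x ∈ J, 0 ≤ F x) {j : ℕ}
    (hj : 2 * j ≤ r) :
    ∃ p, Corrects r k (2 * j - 1) F z h κ q p ∧ ∀ x ∈ J, 0 ≤ p.eval x := by
  refine ⟨_, L.corrects_generic hj (by push_cast; omega) (σ := 1) abs_one, fun x hx => ?_⟩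
  have := L.nonneg_add_of_le (S := fun _ => 1) (c := 1 * (κ * h ^ (r - 2 * j))) (n := 2 * j) hx
    (by simpa using hF x hx) ?_
  · simpa using this
  · have := L.abs_pow_le_mul hx hj
    rw [pow_mul, sq_abs, ← pow_mul] at this
    simpa using this

lemma exists_sign_generic (L : LocalData r k F z h κ q J) (hF : ∀ x ∈ J, 0 ≤ F x * (x - z)) {j : ℕ}
    (hj : 2 * j + 1 ≤ r) :
    ∃ p, Corrects r k (2 * j) F z h κ q p ∧ ∀ x ∈ J, 0 ≤ p.eval x * (x - z) := by
  refine ⟨_, L.corrects_generic hj (by push_cast; omega) (σ := 1) abs_one, fun x hx => ?_⟩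
  refine L.nonneg_add_of_le (S := fun x => x - z) hx (hF x hx) ?_
  have := mul_le_mul_of_nonneg_right (L.abs_pow_le_mul hx hj) (abs_nonneg (x - z))
  refine this.trans (le_of_eq ?_)
  have e : |x - z| ^ (2 * j + 1) * |x - z| = (x - z) ^ (2 * j + 1) * (x - z) := by
    rw [← pow_succ, ← pow_succ, show 2 * j + 1 + 1 = 2 * (j + 1) by ring, pow_mul, sq_abs,
      ← pow_mul]
  rw [mul_assoc, e]; ring

lemma exists_end_generic (L : LocalData r k F z h κ q J) (hF : ∀ x ∈ J, 0 ≤ F x) {σ : ℝ}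
    (hσ : |σ| = 1) (hJ : ∀ x ∈ J, 0 ≤ σ * (x - z)) :
    ∃ p, Corrects r k (r - 1) F z h κ q p ∧ ∀ x ∈ J, 0 ≤ p.eval x := by
  refine ⟨_, L.corrects_generic le_rfl (by omega) (σ := σ ^ r) (by rw [abs_pow, hσ, one_pow]),
    fun x hx => ?_⟩
  have := L.nonneg_add_of_le (S := fun _ => 1) (c := σ ^ r * (κ * h ^ (r - r))) (n := r) hx
    (by simpa using hF x hx) ?_
  · simpa using this
  · have e : |x - z| = σ * (x - z) := by
      rw [← abs_of_nonneg (hJ x hx), abs_mul, hσ, one_mul]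
    rw [e, mul_pow, Nat.sub_self]
    simp only [abs_one, mul_one, pow_zero]
    exact le_of_eq (by ring)

section special

variable {δ M : ℝ}

/-- `M` bounds the ratio of the scales `h` and `δ`. -/
lemma term_le {a b e t : ℝ} (hδ : 0 < δ) (hM : h ≤ M * δ) (ht : |t| ≤ h) {κ : ℝ} (hκ : 0 ≤ κ)
    (ha : |a| ≤ κ) (hb : |b| ≤ 2 * κ / δ) (he : |e| ≤ 4 * κ / δ ^ 2) :
    |a + b * t + e * t ^ 2| ≤ (1 + 2 * M + 4 * M ^ 2) * κ := by
  have hs : |t| / δ ≤ M := by rw [div_le_iff₀ hδ]; linarith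
  have hs0 : 0 ≤ |t| / δ := by positivity
  have h1 : |b * t| ≤ 2 * M * κ := by
    rw [abs_mul]
    calc |b| * |t| ≤ 2 * κ / δ * |t| := by gcongr
      _ = 2 * κ * (|t| / δ) := by ring
      _ ≤ 2 * κ * M := by gcongr
      _ = _ := by ring
  have h2 : |e * t ^ 2| ≤ 4 * M ^ 2 * κ := by
    rw [abs_mul, abs_pow]
    calc |e| * |t| ^ 2 ≤ 4 * κ / δ ^ 2 * |t| ^ 2 := by gcongr
      _ = 4 * κ * (|t| / δ) ^ 2 := by rw [div_pow]; ring
      _ ≤ 4 * κ * M ^ 2 := by gcongr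
      _ = _ := by ring
  calc _ ≤ |a| + |b * t| + |e * t ^ 2| := abs_add_three _ _ _
    _ ≤ κ + 2 * M * κ + 4 * M ^ 2 * κ := by gcongr
    _ = _ := by ring

lemma abs_div_le_of_near {A B κ t : ℝ} {n : ℕ} (ht : t ≠ 0) (h : |A - B * t| ≤ κ * |t| ^ (n + 1))
    (hA : 0 ≤ A * t) : -κ * |t| ^ n ≤ B := by
  have ht' : 0 < |t| := abs_pos.mpr ht
  have h1 : |(A - B * t) * t| ≤ κ * |t| ^ (n + 1) * |t| := by
    rw [abs_mul]; exact mul_le_mul_of_nonneg_right h ht'.le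
  have h2 := (abs_le.mp h1).2
  have h3 : 0 ≤ (B + κ * |t| ^ n) * |t| ^ 2 := by
    have : t * t = |t| ^ 2 := by rw [sq_abs]; ring
    rw [pow_succ] at h2
    have e : (B + κ * |t| ^ n) * |t| ^ 2 = B * (t * t) + κ * (|t| ^ n * |t|) * |t| := by
      rw [this]; ring
    rw [e]; linarith
  have := nonneg_of_mul_nonneg_left h3 (by positivity)
  linarith

lemma pow_term_le {c t : ℝ} (ht : |t| ≤ h) (n : ℕ) {A B : ℝ} (hB : |A| ≤ B) (hc : c = t ^ n * A) :
    |c| ≤ B * h ^ n := by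
  rw [hc, abs_mul, abs_pow, mul_comm]
  have : 0 ≤ B := (abs_nonneg _).trans hB
  gcongr

lemma natDegree_three_le {a b e : ℝ} : (C a + C b * (X - C z) + C e * (X - C z) ^ 2).natDegree ≤ 2 := by
  refine (natDegree_add_le _ _).trans (max_le ((natDegree_add_le _ _).trans (max_le ?_ ?_))
    (natDegree_C_mul_sub_pow_le e z 2))
  · simp
  · have := natDegree_C_mul_sub_pow_le b z 1
    rw [pow_one] at this; omega

lemma exists_nonneg_zero_two (L : LocalData 0 2 F z h κ q J) (hF : ∀ x ∈ J, 0 ≤ F x) (hδ : 0 < δ)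
    (hM : h ≤ M * δ) (hJ : ∀ x, |x - z| ≤ δ → x ∈ J) :
    ∃ p, Corrects 0 2 0 F z h ((1 + 2 * M + 4 * M ^ 2) * κ) q p ∧ ∀ x ∈ J, 0 ≤ p.eval x := by
  have hκ := L.kappa_nonneg
  obtain ⟨a, b, d, e, -, hq, he, hd, hb⟩ := exists_quartic_expansion
    (show q.natDegree < 5 by have := L.deg; omega) z
  rw [he (by have := L.deg; omega), hd (by have := L.deg; omega), hb (by have := L.deg; omega)] at hq
  have hz := abs_le.mp (L.near z L.mem)
  simp only [pow_zero, mul_one] at hz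
  obtain ⟨a', ha', H⟩ := linear_fix (ε := F z) (a := a) (κ := 2 * κ) (J := {t | z + t ∈ J})
    (hF z L.mem) (by positivity) hδ (fun t ht => hJ _ (by simpa using ht)) fun t ht _ => by
      have h1 := (abs_le.mp (L.near _ ht)).2
      have h2 := hF _ ht
      rw [hq, pow_zero, add_sub_cancel_left] at h1
      linarith
  refine ⟨C (F z) + C a' * (X - C z) + C (2 * (2 * κ) / δ ^ 2) * (X - C z) ^ 2,
    ⟨natDegree_three_le.trans (by omega), fun i hi => ?_, fun x hx => ?_⟩, fun x hx => ?_⟩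
  · obtain rfl : i = 0 := by omega
    simp
  · refine pow_term_le hx 0 (A := (F z - q.eval z) + (a' - a) * (x - z)
      + 2 * (2 * κ) / δ ^ 2 * (x - z) ^ 2) (term_le hδ hM hx hκ (abs_le.mpr hz) ha' ?_) ?_
    · rw [abs_of_nonneg (by positivity)]; exact le_of_eq (by ring)
    · rw [hq x]; simp only [eval_add, eval_mul, eval_C, eval_pow, eval_sub, eval_X]; ring
  · have := H (x - z) (by simpa using hx)
    simpa using this

lemma exists_sign_zero_two (L : LocalData 0 2 F z h κ q J) (hF : ∀ x ∈ J, 0 ≤ F x * (x - z))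
    (hδ : 0 < δ) (hM : h ≤ M * δ) (hJ : ∀ x, |x - z| ≤ δ → x ∈ J) :
    ∃ p, Corrects 0 2 0 F z h ((1 + 2 * M + 4 * M ^ 2) * κ) q p ∧
      ∀ x ∈ J, 0 ≤ p.eval x * (x - z) := by
  have hκ := L.kappa_nonneg
  obtain ⟨a, b, d, e, -, hq, he, hd, hb⟩ := exists_quartic_expansion
    (show q.natDegree < 5 by have := L.deg; omega) z
  rw [he (by have := L.deg; omega), hd (by have := L.deg; omega), hb (by have := L.deg; omega)] at hq
  have hFz : F z = 0 := eq_zero_of_sign_change L.contDiff.continuous hδ fun x hx => hF x (hJ x hx)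
  have hz := L.near z L.mem
  rw [hFz, pow_zero, mul_one] at hz
  have ha : 0 ≤ a + 2 * κ / δ := by
    have hm : z + δ ∈ J := hJ _ (by rw [add_sub_cancel_left, abs_of_pos hδ])
    have h1 := (abs_le.mp (L.near _ hm)).2
    have h2 := hF _ hm
    have h3 := (abs_le.mp hz).1
    rw [add_sub_cancel_left] at h2
    have h4 := nonneg_of_mul_nonneg_left h2 hδ
    rw [hq, pow_zero, add_sub_cancel_left] at h1
    have : 0 ≤ (a + 2 * κ / δ) * δ := by
      rw [add_mul, div_mul_cancel₀ _ hδ.ne']; linarith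
    exact nonneg_of_mul_nonneg_left this hδ
  refine ⟨C 0 + C (a + 2 * κ / δ) * (X - C z) + C 0 * (X - C z) ^ 2,
    ⟨natDegree_three_le.trans (by omega), fun i hi => ?_, fun x hx => ?_⟩, fun x hx => ?_⟩
  · obtain rfl : i = 0 := by omega
    simp [hFz]
  · refine pow_term_le hx 0 (A := (0 - q.eval z) + (2 * κ / δ) * (x - z)
      + 0 * (x - z) ^ 2) (term_le hδ hM hx hκ hz ?_ ?_) ?_
    · rw [abs_of_nonneg (by positivity)]
    · rw [abs_zero]; positivity
    · rw [hq x]; simp only [eval_add, eval_mul, eval_C, eval_pow, eval_sub, eval_X]; ring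
  · simp only [eval_add, eval_mul, eval_C, eval_pow, eval_sub, eval_X]
    have := mul_nonneg ha (sq_nonneg (x - z))
    nlinarith

lemma exists_end_zero_two (L : LocalData 0 2 F z h κ q J) (hF : ∀ x ∈ J, 0 ≤ F x) (hδ : 0 < δ)
    (hM : h ≤ M * δ) {σ : ℝ} (hσ : |σ| = 1) (hJ : ∀ x ∈ J, 0 ≤ σ * (x - z)) (hm : z + σ * δ ∈ J) :
    ∃ p, Corrects 0 2 0 F z h ((1 + 2 * M + 4 * M ^ 2) * κ) q p ∧ ∀ x ∈ J, 0 ≤ p.eval x := by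
  have hκ := L.kappa_nonneg
  obtain ⟨a, b, d, e, -, hq, he, hd, hb⟩ := exists_quartic_expansion
    (show q.natDegree < 5 by have := L.deg; omega) z
  rw [he (by have := L.deg; omega), hd (by have := L.deg; omega), hb (by have := L.deg; omega)] at hq
  have hz := L.near z L.mem
  rw [pow_zero, mul_one] at hz
  have hz' := abs_le.mp hz
  have hlow : ∀ x ∈ J, -(2 * κ) ≤ F z + a * (x - z) := fun x hx => by
    have h1 := (abs_le.mp (L.near _ hx)).2
    have h2 := hF _ hx
    rw [hq, pow_zero] at h1
    linarith
  refine ⟨C (F z) + C (a + σ * (2 * κ / δ)) * (X - C z) + C 0 * (X - C z) ^ 2,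
    ⟨natDegree_three_le.trans (by omega), fun i hi => ?_, fun x hx => ?_⟩, fun x hx => ?_⟩
  · obtain rfl : i = 0 := by omega
    simp
  · refine pow_term_le hx 0 (A := (F z - q.eval z) + (σ * (2 * κ / δ)) * (x - z)
      + 0 * (x - z) ^ 2) (term_le hδ hM hx hκ hz ?_ ?_) ?_
    · rw [abs_mul, hσ, one_mul, abs_of_nonneg (by positivity)]
    · rw [abs_zero]; positivity
    · rw [hq x]; simp only [eval_add, eval_mul, eval_C, eval_pow, eval_sub, eval_X]; ring
  · have h1 := hlow _ hm
    rw [add_sub_cancel_left] at h1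
    have := linear_fix_end (hF z L.mem) (by positivity) hδ (by rw [← sq_abs, hσ, one_pow]) (hJ x hx)
      (hlow x hx) h1
    simpa using this

lemma exists_nonneg_one (L : LocalData 1 k F z h κ q J) (hk : k ≤ 3) (hF : ∀ x ∈ J, 0 ≤ F x)
    (hδ : 0 < δ) (hM : h ≤ M * δ) (hJ : ∀ x, |x - z| ≤ δ → x ∈ J) :
    ∃ p, Corrects 1 k 0 F z h ((1 + 2 * M + 4 * M ^ 2) * κ) q p ∧ ∀ x ∈ J, 0 ≤ p.eval x := by
  have hκ := L.kappa_nonneg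
  obtain ⟨a, b, d, e, -, hq, he, -, -⟩ := exists_quartic_expansion
    (show q.natDegree < 5 by have := L.deg; omega) z
  rw [he (by have := L.deg; omega)] at hq
  have hz : q.eval z = F z := by simpa using L.interp 0 (by omega)
  obtain ⟨a', ha', H⟩ := cubic_fix (ε := F z) (a := a) (b := b) (d := d) (κ := κ)
    (J := {t | z + t ∈ J}) (hF z L.mem) hκ hδ (fun t ht => hJ _ (by simpa using ht))
    fun t ht _ => by
      have h1 := (abs_le.mp (L.near _ ht)).2
      have h2 := hF _ ht
      rw [hq, pow_one, add_sub_cancel_left, hz] at h1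
      linarith
  refine ⟨q + (C 0 + C (a' - a) * (X - C z) + C (2 * κ / δ) * (X - C z) ^ 2),
    ⟨(natDegree_add_le _ _).trans (max_le (by have := L.deg; omega)
      (natDegree_three_le.trans (by omega))), fun i hi => ?_, fun x hx => ?_⟩, fun x hx => ?_⟩
  · obtain rfl : i = 0 := by omega
    simp [hz]
  · refine pow_term_le hx 1 (A := (a' - a) + 2 * κ / δ * (x - z) + 0 * (x - z) ^ 2)
      (term_le hδ hM hx hκ ha' ?_ ?_) ?_
    · rw [abs_of_nonneg (by positivity)]
    · rw [abs_zero]; positivity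
    · simp only [eval_add, eval_mul, eval_C, eval_pow, eval_sub, eval_X]; ring
  · have := H (x - z) (by simpa using hx)
    rw [eval_add, hq x, hz]
    simp only [eval_add, eval_mul, eval_C, eval_pow, eval_sub, eval_X]
    linarith

lemma exists_sign_one_two (L : LocalData 1 2 F z h κ q J) (hF : ∀ x ∈ J, 0 ≤ F x * (x - z))
    (hδ : 0 < δ) (hM : h ≤ M * δ) (hJ : ∀ x, |x - z| ≤ δ → x ∈ J) :
    ∃ p, Corrects 1 2 1 F z h ((1 + 2 * M + 4 * M ^ 2) * κ) q p ∧
      ∀ x ∈ J, 0 ≤ p.eval x * (x - z) := by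
  have hκ := L.kappa_nonneg
  obtain ⟨a, b, d, e, haq, hq, he, hd, -⟩ := exists_quartic_expansion
    (show q.natDegree < 5 by have := L.deg; omega) z
  rw [he (by have := L.deg; omega), hd (by have := L.deg; omega)] at hq
  have hFz : F z = 0 := eq_zero_of_sign_change L.contDiff.continuous hδ fun x hx => hF x (hJ x hx)
  have hz : q.eval z = 0 := by simpa [hFz] using L.interp 0 (by omega)
  have hF' : 0 ≤ deriv F z := deriv_nonneg_of_sign_change (L.contDiff.differentiable (by simp)) hδ
    fun x hx => hF x (hJ x hx)
  have htop : |deriv F z - a| ≤ κ := by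
    have := L.top
    rwa [iteratedDeriv_one, Function.iterate_one, haq] at this
  obtain ⟨b', hb', H⟩ := linear_fix (ε := deriv F z) (a := b) (κ := 2 * κ) (J := {t | z + t ∈ J})
    hF' (by positivity) hδ (fun t ht => hJ _ (by simpa using ht)) fun t ht ht0 => by
      have h1 := L.near _ ht
      have h2 := hF _ ht
      rw [add_sub_cancel_left] at h1 h2
      have h3 := abs_div_le_of_near (n := 0) (B := a + b * t) ht0 (by
        refine le_trans (le_of_eq ?_) h1
        rw [hq, hz, add_sub_cancel_left]; congr 1; ring) h2
      have h4 := (abs_le.mp htop).1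
      rw [pow_zero] at h3
      linarith
  refine ⟨(C (deriv F z) + C b' * (X - C z) + C (2 * (2 * κ) / δ ^ 2) * (X - C z) ^ 2) * (X - C z),
    ⟨natDegree_mul_le.trans ?_, fun i hi => ?_, fun x hx => ?_⟩, fun x hx => ?_⟩
  · rw [natDegree_X_sub_C]
    exact (Nat.add_le_add_right natDegree_three_le 1).trans (by omega)
  · obtain rfl | rfl : i = 0 ∨ i = 1 := by omega
    · simp [hFz]
    · simp [iteratedDeriv_one, derivative_mul]
  · refine pow_term_le hx 1 (A := (deriv F z - a) + (b' - b) * (x - z)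
      + 2 * (2 * κ) / δ ^ 2 * (x - z) ^ 2) (term_le hδ hM hx hκ htop hb' ?_) ?_
    · rw [abs_of_nonneg (by positivity)]; exact le_of_eq (by ring)
    · rw [hq x, hz]; simp only [eval_add, eval_mul, eval_C, eval_pow, eval_sub, eval_X]; ring
  · have := mul_nonneg (H (x - z) (by simpa using hx)) (sq_nonneg (x - z))
    simp only [eval_add, eval_mul, eval_C, eval_pow, eval_sub, eval_X]
    linarith

lemma exists_sign_two_three (L : LocalData 2 3 F z h κ q J) (hF : ∀ x ∈ J, 0 ≤ F x * (x - z))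
    (hδ : 0 < δ) (hM : h ≤ M * δ) (hJ : ∀ x, |x - z| ≤ δ → x ∈ J) :
    ∃ p, Corrects 2 3 1 F z h ((1 + 2 * M + 4 * M ^ 2) * κ) q p ∧
      ∀ x ∈ J, 0 ≤ p.eval x * (x - z) := by
  have hκ := L.kappa_nonneg
  obtain ⟨a, b, d, e, haq, hq, -, -, -⟩ := exists_quartic_expansion
    (show q.natDegree < 5 by have := L.deg; omega) z
  have hFz : F z = 0 := eq_zero_of_sign_change L.contDiff.continuous hδ fun x hx => hF x (hJ x hx)
  have hz : q.eval z = 0 := by simpa [hFz] using L.interp 0 (by omega)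
  have ha : a = deriv F z := by
    have := L.interp 1 (by omega)
    rwa [iteratedDeriv_one, Function.iterate_one, haq] at this
  have hF' : 0 ≤ a := ha ▸ deriv_nonneg_of_sign_change (L.contDiff.differentiable (by simp)) hδ
    fun x hx => hF x (hJ x hx)
  obtain ⟨b', hb', H⟩ := cubic_fix (ε := a) (a := b) (b := d) (d := e) (κ := κ)
    (J := {t | z + t ∈ J}) hF' hκ hδ (fun t ht => hJ _ (by simpa using ht)) fun t ht ht0 => by
      have h1 := L.near _ ht
      have h2 := hF _ ht
      rw [add_sub_cancel_left] at h1 h2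
      have h3 := abs_div_le_of_near (n := 1) (B := a + b * t + d * t ^ 2 + e * t ^ 3) ht0 (by
        refine le_trans (le_of_eq ?_) h1
        rw [hq, hz, add_sub_cancel_left]; congr 1; ring) h2
      rwa [pow_one] at h3
  refine ⟨q + (C (b' - b) + C (2 * κ / δ) * (X - C z) + C 0 * (X - C z) ^ 2) * (X - C z) ^ 2,
    ⟨(natDegree_add_le _ _).trans (max_le (by have := L.deg; omega) (natDegree_mul_le.trans ?_)),
    fun i hi => ?_, fun x hx => ?_⟩, fun x hx => ?_⟩
  · rw [natDegree_pow, natDegree_X_sub_C]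
    exact (Nat.add_le_add_right natDegree_three_le _).trans (by omega)
  · rw [← L.interp i (by omega)]
    refine eval_iterate_derivative_eq_of_dvd (n := 2) ?_ (by omega)
    rw [add_sub_cancel_left]; exact dvd_mul_left _ _
  · refine pow_term_le hx 2 (A := (b' - b) + 2 * κ / δ * (x - z) + 0 * (x - z) ^ 2)
      (term_le hδ hM hx hκ hb' ?_ ?_) ?_
    · rw [abs_of_nonneg (by positivity)]
    · rw [abs_zero]; positivity
    · simp only [eval_add, eval_mul, eval_C, eval_pow, eval_sub, eval_X]; ring
  · have := mul_nonneg (H (x - z) (by simpa using hx)) (sq_nonneg (x - z))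
    rw [eval_add, hq x, hz]
    simp only [eval_add, eval_mul, eval_C, eval_pow, eval_sub, eval_X]
    linarith

end special

end LocalData

/-- The admissible smoothness and interpolation orders. -/
def Admissible (r k : ℕ) (m₁ : ℤ) (m₂ m₃ : ℕ) : Prop :=
  (r = 0 ∧ k = 2 ∧ m₁ = 0 ∧ m₂ = 0 ∧ m₃ = 0)
    ∨ (r = 1 ∧ k = 3 ∧ m₁ = 0 ∧ m₂ = 0 ∧ m₃ = 0)
    ∨ (r = 1 ∧ k = 2 ∧ m₁ = 0 ∧ m₂ = 1 ∧ m₃ = 0)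
    ∨ (r = 2 ∧ k = 3 ∧ m₁ = 1 ∧ m₂ = 1 ∧ m₃ = 1)
    ∨ (∃ j : ℕ, 1 ≤ j ∧ 1 ≤ k ∧ r = 2 * j ∧ m₁ = 2 * (j : ℤ) - 1 ∧
        m₂ = 2 * j - 2 ∧ m₃ = 2 * j - 1)
    ∨ (∃ j : ℕ, 1 ≤ k ∧ r = 2 * j + 1 ∧ m₁ = 2 * (j : ℤ) - 1 ∧ m₂ = 2 * j ∧ m₃ = 2 * j)

namespace Admissible

variable {r k m₂ m₃ : ℕ} {m₁ : ℤ}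

lemma one_le (H : Admissible r k m₁ m₂ m₃) : 1 ≤ k := by
  rcases H with H | H | H | H | ⟨j, H⟩ | ⟨j, H⟩ <;> omega

lemma le_end (H : Admissible r k m₁ m₂ m₃) : m₁ ≤ m₃ := by
  rcases H with H | H | H | H | ⟨j, H⟩ | ⟨j, H⟩ <;> omega

lemma end_le (H : Admissible r k m₁ m₂ m₃) : m₃ ≤ r := by
  rcases H with H | H | H | H | ⟨j, H⟩ | ⟨j, H⟩ <;> omega

lemma sign_le (H : Admissible r k m₁ m₂ m₃) : m₂ ≤ r := by
  rcases H with H | H | H | H | ⟨j, H⟩ | ⟨j, H⟩ <;> omega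

end Admissible

lemma Corrects.mono {r k : ℕ} {μ μ' : ℤ} {F : ℝ → ℝ} {z h η η' : ℝ} {q p : ℝ[X]} (hh : 0 < h)
    (H : Corrects r k μ F z h η q p) (hμ : μ' ≤ μ) (hη : η ≤ η') :
    Corrects r k μ' F z h η' q p :=
  ⟨H.deg, fun i hi => H.interp i (hi.trans hμ), fun x hx => (H.close x hx).trans (by gcongr)⟩

namespace LocalData

variable {r k : ℕ} {F : ℝ → ℝ} {z h κ δ M : ℝ} {q : ℝ[X]} {J : Set ℝ} {m₁ : ℤ} {m₂ m₃ : ℕ}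

lemma kappa_le (L : LocalData r k F z h κ q J) (hδ : 0 < δ) (hM : h ≤ M * δ) :
    κ ≤ (1 + 2 * M + 4 * M ^ 2) * κ := by
  have hM0 : 0 < M := pos_of_mul_pos_left (L.pos.trans_le hM) hδ.le
  exact le_mul_of_one_le_left L.kappa_nonneg (by nlinarith)

lemma exists_nonneg (L : LocalData r k F z h κ q J) (H : Admissible r k m₁ m₂ m₃)
    (hF : ∀ x ∈ J, 0 ≤ F x) (hδ : 0 < δ) (hM : h ≤ M * δ) (hJ : ∀ x, |x - z| ≤ δ → x ∈ J) :
    ∃ p, Corrects r k m₁ F z h ((1 + 2 * M + 4 * M ^ 2) * κ) q p ∧ ∀ x ∈ J, 0 ≤ p.eval x := by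
  have hκ := L.kappa_le hδ hM
  rcases H with ⟨rfl, rfl, rfl, -⟩ | ⟨rfl, rfl, rfl, -⟩ | ⟨rfl, rfl, rfl, -⟩ | ⟨rfl, rfl, rfl, -⟩ |
    ⟨j, hj, -, hr, rfl, -⟩ | ⟨j, -, hr, rfl, -⟩
  · exact L.exists_nonneg_zero_two hF hδ hM hJ
  · exact L.exists_nonneg_one le_rfl hF hδ hM hJ
  · exact L.exists_nonneg_one (by norm_num) hF hδ hM hJ
  · obtain ⟨p, h1, h2⟩ := L.exists_nonneg_generic hF (j := 1) le_rfl
    exact ⟨p, h1.mono L.pos (by norm_num) hκ, h2⟩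
  · obtain ⟨p, h1, h2⟩ := L.exists_nonneg_generic hF (j := j) (by omega)
    exact ⟨p, h1.mono L.pos le_rfl hκ, h2⟩
  · obtain ⟨p, h1, h2⟩ := L.exists_nonneg_generic hF (j := j) (by omega)
    exact ⟨p, h1.mono L.pos le_rfl hκ, h2⟩

lemma exists_sign (L : LocalData r k F z h κ q J) (H : Admissible r k m₁ m₂ m₃)
    (hF : ∀ x ∈ J, 0 ≤ F x * (x - z)) (hδ : 0 < δ) (hM : h ≤ M * δ)
    (hJ : ∀ x, |x - z| ≤ δ → x ∈ J) :
    ∃ p, Corrects r k m₂ F z h ((1 + 2 * M + 4 * M ^ 2) * κ) q p ∧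
      ∀ x ∈ J, 0 ≤ p.eval x * (x - z) := by
  have hκ := L.kappa_le hδ hM
  rcases H with ⟨rfl, rfl, -, rfl, -⟩ | ⟨rfl, rfl, -, rfl, -⟩ | ⟨rfl, rfl, -, rfl, -⟩ |
    ⟨rfl, rfl, -, rfl, -⟩ | ⟨j, hj, -, hr, -, rfl, -⟩ | ⟨j, -, hr, -, rfl, -⟩
  · exact L.exists_sign_zero_two hF hδ hM hJ
  · obtain ⟨p, h1, h2⟩ := L.exists_sign_generic hF (j := 0) le_rfl
    exact ⟨p, h1.mono L.pos (by norm_num) hκ, h2⟩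
  · exact L.exists_sign_one_two hF hδ hM hJ
  · exact L.exists_sign_two_three hF hδ hM hJ
  · obtain ⟨p, h1, h2⟩ := L.exists_sign_generic hF (j := j - 1) (by omega)
    exact ⟨p, h1.mono L.pos (by omega) hκ, h2⟩
  · obtain ⟨p, h1, h2⟩ := L.exists_sign_generic hF (j := j) (by omega)
    exact ⟨p, h1.mono L.pos (by omega) hκ, h2⟩

lemma exists_end (L : LocalData r k F z h κ q J) (H : Admissible r k m₁ m₂ m₃)
    (hF : ∀ x ∈ J, 0 ≤ F x) (hδ : 0 < δ) (hM : h ≤ M * δ) {σ : ℝ} (hσ : |σ| = 1)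
    (hJ : ∀ x ∈ J, 0 ≤ σ * (x - z)) (hm : z + σ * δ ∈ J) :
    ∃ p, Corrects r k m₃ F z h ((1 + 2 * M + 4 * M ^ 2) * κ) q p ∧ ∀ x ∈ J, 0 ≤ p.eval x := by
  have hκ := L.kappa_le hδ hM
  have H' := H
  obtain ⟨p, h1, h2⟩ := L.exists_end_generic hF hσ hJ
  rcases H with ⟨rfl, rfl, -, -, rfl⟩ | H | H | H | ⟨j, H⟩ | ⟨j, H⟩
  · exact L.exists_end_zero_two hF hδ hM hσ hJ hm
  all_goals exact ⟨p, h1.mono L.pos (by omega) hκ, h2⟩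

end LocalData

section grid

lemma mul_abs_sub_le_angle (m : ℕ) {x u : ℝ} (hx : x ∈ Set.Icc (-1 : ℝ) 1)
    (hu : u ∈ Set.Icc (-1 : ℝ) 1) : m * |x - u| ≤ π * |angle m x - angle m u| := by
  rw [← mul_abs_arccos_sub]
  have := lipschitzWith_cos.dist_le_mul (arccos x) (arccos u)
  rw [cos_arccos hx.1 hx.2, cos_arccos hu.1 hu.2, Real.dist_eq, Real.dist_eq] at this
  exact mul_le_mul_of_nonneg_left (by simpa using this) (Nat.cast_nonneg m)

/-- `Z` is a subset of `[-1,1]` containing the endpoints, whose points are well separated at the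
scale `1 / m`. -/
structure IsSparse (m : ℕ) (Z : Finset ℝ) : Prop where
  mem : ∀ z ∈ Z, z ∈ Set.Icc (-1 : ℝ) 1
  sep : ∀ z ∈ Z, ∀ z' ∈ Z, z ≠ z' → 8 / (m : ℝ) ≤ |z - z'|
  one_mem : (1 : ℝ) ∈ Z
  neg_one_mem : (-1 : ℝ) ∈ Z

variable {m : ℕ} {Z : Finset ℝ}

lemma IsSparse.two_lt (hZ : IsSparse m Z) (hm : 0 < m) {z z' : ℝ} (hz : z ∈ Z) (hz' : z' ∈ Z)
    (h : z ≠ z') : 2 < |angle m z - angle m z'| := by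
  have h1 := hZ.sep z hz z' hz' h
  have h2 := mul_abs_sub_le_angle m (hZ.mem z hz) (hZ.mem z' hz')
  have hm' : (0 : ℝ) < m := by exact_mod_cast hm
  rw [div_le_iff₀ hm'] at h1
  nlinarith [pi_lt_d2, pi_pos]

lemma angle_cos {m : ℕ} (hm : 0 < m) {t : ℝ} (h0 : 0 ≤ t) (h1 : t ≤ m) :
    angle m (cos (π * t / m)) = t := by
  have hm' : (0 : ℝ) < m := by exact_mod_cast hm
  have hpi := pi_pos
  unfold angle
  rw [arccos_cos (by positivity) (by rw [div_le_iff₀ hm']; gcongr)]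
  field_simp

lemma IsSparse.exists_grid (hZ : IsSparse m Z) (hm : 0 < m) : ∃ v, IsGrid m Z v := by
  classical
  have hm' : (0 : ℝ) < m := by exact_mod_cast hm
  set t : ℕ → ℝ := fun j =>
    if (0 < j ∧ j < m) ∧ ∃ z ∈ Z, |angle m z - j| < 1 / 4 then (j : ℝ) + 1 / 2 else j with ht
  have hlow : ∀ j : ℕ, (j : ℝ) ≤ t j := fun j => by simp only [ht]; split_ifs <;> linarith
  have hupp : ∀ j : ℕ, t j ≤ j + 1 / 2 := fun j => by simp only [ht]; split_ifs <;> linarith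
  have hle : ∀ j ≤ m, t j ≤ m := fun j hj => by
    simp only [ht]
    split_ifs with h
    · have : (j : ℝ) + 1 ≤ m := by exact_mod_cast h.1.2
      linarith
    · exact_mod_cast hj
  have hang : ∀ j ≤ m, angle m (cos (π * t j / m)) = t j := fun j hj =>
    angle_cos hm ((Nat.cast_nonneg j).trans (hlow j)) (hle j hj)
  refine ⟨fun j => cos (π * t j / m), fun j _ => ⟨neg_one_le_cos _, cos_le_one _⟩,
    fun j hj => ?_, fun j hj => ?_, ?_, ?_, fun j h1 h2 z hz => ?_⟩
  · rw [hang j hj]; exact hlow j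
  · rw [hang j hj]; exact hupp j
  · simp [ht]
  · simp [ht, hm'.ne']
  · rw [hang j h2.le]
    by_cases h : ∃ z ∈ Z, |angle m z - j| < 1 / 4
    · have e : t j = j + 1 / 2 := if_pos ⟨⟨h1, h2⟩, h⟩
      rw [e]
      obtain ⟨z₀, hz₀, h₀⟩ := h
      have h₀' := abs_lt.mp h₀
      rcases eq_or_ne z z₀ with rfl | hne
      · rw [abs_sub_comm]; exact le_trans (by linarith) (le_abs_self _)
      · have h3 := hZ.two_lt hm hz hz₀ hne
        rcases lt_abs.mp h3 with h3 | h3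
        · exact le_trans (by linarith) (le_abs_self _)
        · rw [abs_sub_comm]; exact le_trans (by linarith) (le_abs_self _)
    · have e : t j = j := if_neg fun h' => h h'.2
      rw [e]
      push Not at h
      exact h z hz

namespace IsGrid

variable {v : ℕ → ℝ}

lemma rho_le_abs_sub (hm : 0 < m) (hv : IsGrid m Z v) (hZ : IsSparse m Z) {z : ℝ} (hz : z ∈ Z)
    {j : ℕ} (hj : j ≤ m) (hne : z ≠ v j) : rho m z ≤ 27 * |z - v j| := by
  have h : 1 / 4 ≤ |angle m z - angle m (v j)| := by
    rcases Nat.eq_zero_or_pos j with rfl | h0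
    · rw [hv.zero] at hne ⊢
      linarith [hZ.two_lt hm hz hZ.one_mem hne]
    rcases hj.eq_or_lt with rfl | h1
    · rw [hv.last] at hne ⊢
      linarith [hZ.two_lt hm hz hZ.neg_one_mem hne]
    · exact hv.far j h0 h1 z hz
  refine rho_le_of_half_le hm (hZ.mem z hz) (hv.mem j hj) ?_
  rw [mul_abs_arccos_sub]
  nlinarith [pi_gt_three]

lemma eq_one_or_eq_neg_one (hv : IsGrid m Z v) {j : ℕ} (hj : j ≤ m) (hz : v j ∈ Z) :
    v j = 1 ∨ v j = -1 := by
  rcases Nat.eq_zero_or_pos j with rfl | h0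
  · exact Or.inl hv.zero
  rcases hj.eq_or_lt with rfl | h1
  · exact Or.inr hv.last
  · have := hv.far j h0 h1 _ hz
    norm_num at this

/-- A cell of the grid contains at most one point of `Z`. -/
lemma eq_of_mem_piece (hm : 0 < m) (hv : IsGrid m Z v) (hZ : IsSparse m Z) {i : ℕ} (hi : i < m)
    {z z' : ℝ} (hz : z ∈ Z) (hz' : z' ∈ Z) (h : z ∈ Set.Icc (v (i + 1)) (v i))
    (h' : z' ∈ Set.Icc (v (i + 1)) (v i)) : z = z' := by
  by_contra hne
  obtain ⟨-, h1, h2⟩ := hv.angle_mem_of_mem_piece hm hi h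
  obtain ⟨-, h3, h4⟩ := hv.angle_mem_of_mem_piece hm hi h'
  have := hZ.two_lt hm hz hz' hne
  rcases lt_abs.mp this with h | h <;> linarith

lemma mem_piece_of_abs_le (hm : 0 < m) (hv : IsGrid m Z v) (hZ : IsSparse m Z) {i : ℕ} (hi : i < m)
    {z : ℝ} (hz : z ∈ Z) (h1 : z ≠ 1) (h2 : z ≠ -1) (h : z ∈ Set.Icc (v (i + 1)) (v i)) {x : ℝ}
    (hx : |x - z| ≤ rho m z / 27) : x ∈ Set.Icc (v (i + 1)) (v i) := by
  have hne : ∀ j ≤ m, z ≠ v j := fun j hj e => by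
    rcases hv.eq_one_or_eq_neg_one hj (e ▸ hz) with h | h
    · exact h1 (e.trans h)
    · exact h2 (e.trans h)
  have a := hv.rho_le_abs_sub hm hZ hz hi.le (hne i hi.le)
  have b := hv.rho_le_abs_sub hm hZ hz hi (hne (i + 1) hi)
  rw [abs_of_nonpos (by linarith [h.2])] at a
  rw [abs_of_nonneg (by linarith [h.1])] at b
  have := abs_le.mp hx
  constructor <;> linarith

lemma end_mem_piece_one (hm : 0 < m) (hv : IsGrid m Z v) (hZ : IsSparse m Z) {i : ℕ} (hi : i < m)
    (h : (1 : ℝ) ∈ Set.Icc (v (i + 1)) (v i)) : 1 + -1 * (rho m 1 / 27) ∈ Set.Icc (v (i + 1)) (v i) := by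
  have h0 := hv.lt_of_lt hm (Nat.lt_succ_self i) hi
  have h1 := (hv.mem i hi.le).2
  have b := hv.rho_le_abs_sub hm hZ hZ.one_mem hi (by linarith : v (i + 1) < 1).ne'
  rw [abs_of_nonneg (by linarith)] at b
  have := rho_pos hm 1
  constructor <;> linarith [h.2]

lemma end_mem_piece_neg_one (hm : 0 < m) (hv : IsGrid m Z v) (hZ : IsSparse m Z) {i : ℕ} (hi : i < m)
    (h : (-1 : ℝ) ∈ Set.Icc (v (i + 1)) (v i)) :
    -1 + 1 * (rho m (-1) / 27) ∈ Set.Icc (v (i + 1)) (v i) := by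
  have h0 := hv.lt_of_lt hm (Nat.lt_succ_self i) hi
  have h1 := (hv.mem (i + 1) hi).1
  have b := hv.rho_le_abs_sub hm hZ hZ.neg_one_mem hi.le (by linarith : -1 < v i).ne
  rw [abs_of_nonpos (by linarith)] at b
  have := rho_pos hm (-1)
  constructor <;> linarith [h.1]

lemma relDist_le_of_angle (hm : 0 < m) (hv : IsGrid m Z v) {i : ℕ} (hi : i < m) {u x : ℝ}
    (hu : u ∈ Set.Icc (v (i + 1)) (v i)) (h1 : (i : ℝ) ≤ angle m x) (h2 : angle m x ≤ i + 3) :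
    relDist m x u ≤ 11 := by
  obtain ⟨-, h3, h4⟩ := hv.angle_mem_of_mem_piece hm hi hu
  unfold relDist
  rw [mul_abs_arccos_sub]
  have : |angle m x - angle m u| ≤ 3 := by rw [abs_le]; constructor <;> linarith
  nlinarith [pi_lt_d2, pi_pos]

end IsGrid

lemma exists_sign_of_forall_notMem (Y : Finset ℝ) {a b : ℝ} (h : ∀ y ∈ Y, y ∉ Set.Icc a b) :
    ∃ τ : ℝ, τ ^ 2 = 1 ∧ ∀ x ∈ Set.Icc a b, 0 < τ * (signPoly Y).eval x := by
  classical
  induction Y using Finset.induction_on with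
  | empty => exact ⟨1, by norm_num, fun x _ => by simp [signPoly]⟩
  | insert y Y hy ih =>
    obtain ⟨τ, hτ, H⟩ := ih fun y hy => h y (Finset.mem_insert_of_mem hy)
    have hy' := h y (Finset.mem_insert_self _ _)
    have e : ∀ x, (signPoly (insert y Y)).eval x = (x - y) * (signPoly Y).eval x := fun x => by
      unfold signPoly; rw [Finset.prod_insert hy]; simp
    rcases lt_or_ge y a with hya | hya
    · refine ⟨τ, hτ, fun x hx => ?_⟩
      have := mul_pos (H x hx) (sub_pos.mpr (hya.trans_le hx.1))
      rw [e]; linarith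
    · have hyb : b < y := not_le.mp fun h => hy' ⟨hya, h⟩
      refine ⟨-τ, by rw [neg_sq, hτ], fun x hx => ?_⟩
      have := mul_pos (H x hx) (sub_pos.mpr (hx.2.trans_lt hyb))
      rw [e]; linarith

end grid

/-- The pointwise error majorant. -/
noncomputable def majorant (r k m : ℕ) (F : ℝ → ℝ) (x : ℝ) : ℝ :=
  rho m x ^ r * omegaK (iteratedDeriv r F) k (rho m x) (-1) 1

lemma majorant_nonneg {m : ℕ} (hm : 0 < m) (r k : ℕ) (F : ℝ → ℝ) (x : ℝ) :
    0 ≤ majorant r k m F x :=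
  mul_nonneg (pow_nonneg (rho_pos hm x).le r) (omegaK_nonneg _ _ _ _ _)

lemma majorant_le {r m m' : ℕ} {F : ℝ → ℝ} (hF : ContDiff ℝ r F) (k : ℕ) (hm : 0 < m')
    {x u R : ℝ} (hR : 1 ≤ R) (h0 : 0 ≤ rho m u) (h : rho m u ≤ R * rho m' x) :
    majorant r k m F u ≤ 2 ^ k * majorant r k m' F x * R ^ (r + k) := by
  have hc : ContinuousOn (iteratedDeriv r F) (Set.Icc (-1) 1) :=
    (hF.continuous_iteratedDeriv r le_rfl).continuousOn
  have h1 := (omegaK_mono hc k h).trans (omegaK_mul_le hc k hR (rho_pos hm x).le)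
  have h2 := rho_pos hm x
  unfold majorant
  calc _ ≤ (R * rho m' x) ^ r *
        (2 ^ k * R ^ k * omegaK (iteratedDeriv r F) k (rho m' x) (-1) 1) := by
        have := omegaK_nonneg (iteratedDeriv r F) k (rho m u) (-1) 1
        gcongr
    _ = _ := by rw [mul_pow, pow_add]; ring

lemma majorant_le_relDist {r m : ℕ} {F : ℝ → ℝ} (hF : ContDiff ℝ r F) (k : ℕ) (hm : 0 < m)
    (x u : ℝ) : majorant r k m F u ≤ 2 ^ k * majorant r k m F x * relDist m x u ^ (r + k) := by
  refine majorant_le hF k hm (one_le_relDist m x u) (rho_pos hm u).le ?_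
  rw [relDist_comm]; exact rho_le_relDist_mul hm u x

lemma iterate_derivative_const_mul_eval {τ : ℝ} (q : ℝ[X]) (i : ℕ) (z : ℝ) :
    (derivative^[i] (C τ * q)).eval z = τ * (derivative^[i] q).eval z := by
  rw [iterate_derivative_C_mul, eval_mul, eval_C]

section smul

variable {r k : ℕ} {F : ℝ → ℝ} {z h κ η τ : ℝ} {q p : ℝ[X]} {J : Set ℝ} {μ : ℤ}

lemma abs_eq_one_of_sq (hτ : τ ^ 2 = 1) : |τ| = 1 := by
  rw [← sqrt_sq_eq_abs, hτ, sqrt_one]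

lemma iteratedDeriv_smul {i : ℕ} (hF : ContDiff ℝ r F) (hi : i ≤ r) (τ z : ℝ) :
    iteratedDeriv i (fun x => τ * F x) z = τ * iteratedDeriv i F z :=
  iteratedDeriv_const_mul τ ((hF.of_le (by exact_mod_cast hi)).contDiffAt)

lemma LocalData.smul (L : LocalData r k F z h κ q J) (hτ : τ ^ 2 = 1) :
    LocalData r k (fun x => τ * F x) z h κ (C τ * q) J where
  contDiff := contDiff_const.mul L.contDiff
  deg := (natDegree_C_mul_le _ _).trans_lt L.deg
  interp i hi := by
    rw [iteratedDeriv_smul L.contDiff hi.le, iterate_derivative_const_mul_eval, L.interp i hi]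
  top := by
    rw [iteratedDeriv_smul L.contDiff le_rfl, iterate_derivative_const_mul_eval, ← mul_sub, abs_mul,
      abs_eq_one_of_sq hτ, one_mul]
    exact L.top
  near x hx := by
    rw [eval_mul, eval_C, ← mul_sub, abs_mul, abs_eq_one_of_sq hτ, one_mul]
    exact L.near x hx
  sub := L.sub
  mem := L.mem
  pos := L.pos

lemma Corrects.smul (H : Corrects r k μ (fun x => τ * F x) z h η (C τ * q) p)
    (hF : ContDiff ℝ r F) (hμ : μ ≤ r) (hτ : τ ^ 2 = 1) :
    Corrects r k μ F z h η q (C τ * p) where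
  deg := (natDegree_C_mul_le _ _).trans H.deg
  interp i hi := by
    rw [iterate_derivative_const_mul_eval, H.interp i hi, iteratedDeriv_smul hF (by omega),
      ← mul_assoc, ← sq, hτ, one_mul]
  close x hx := by
    have h1 := H.close x hx
    have e : p.eval x - (C τ * q).eval x = τ * ((C τ * p).eval x - q.eval x) := by
      simp only [eval_mul, eval_C]
      linear_combination (- p.eval x) * hτ
    rwa [e, abs_mul, abs_eq_one_of_sq hτ, one_mul] at h1

end smul

/-- The approximation on a single cell of the grid. -/
theorem exists_cell_poly {r k m₂ m₃ : ℕ} {m₁ : ℤ} (H : Admissible r k m₁ m₂ m₃) :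
    ∃ K : ℝ, 0 < K ∧ ∀ m : ℕ, 0 < m → ∀ (Y A Z : Finset ℝ) (v : ℕ → ℝ), IsSparse m Z →
    IsGrid m Z v → Y ⊆ Z → A ⊆ Z → 1 ∉ Y → -1 ∉ Y → Disjoint Y A →
    ∀ F : ℝ → ℝ, ContDiff ℝ r F → (∀ x ∈ Set.Icc (-1 : ℝ) 1, 0 ≤ F x * (signPoly Y).eval x) →
    ∀ i < m, ∃ p : ℝ[X], p.natDegree ≤ k + r + 5 ∧
      (∀ x ∈ Set.Icc (-1 : ℝ) 1, (i : ℝ) ≤ angle m x → angle m x ≤ i + 3 →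
        |F x - p.eval x| ≤ K * majorant r k m F x) ∧
      (∀ x ∈ Set.Icc (v (i + 1)) (v i), 0 ≤ p.eval x * (signPoly Y).eval x) ∧
      ∀ z ∈ Z, z ∈ Set.Icc (v (i + 1)) (v i) → ∀ l : ℕ,
        (z ∈ A → (l : ℤ) ≤ m₁ → (derivative^[l] p).eval z = iteratedDeriv l F z) ∧
        (z ∈ Y → l ≤ m₂ → (derivative^[l] p).eval z = iteratedDeriv l F z) ∧
        (z = 1 ∨ z = -1 → l ≤ m₃ → (derivative^[l] p).eval z = iteratedDeriv l F z) := by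
  classical
  obtain ⟨K, hK, HK⟩ := exists_local_poly r k H.one_le 121 (by norm_num)
  set M : ℝ := 121 * 27 with hM
  set c : ℝ := 1 + 2 * M + 4 * M ^ 2 with hc
  have hc0 : 0 < c := by positivity
  refine ⟨(1 + c) * K * 121 ^ r * (2 ^ k * 11 ^ (r + k)), by positivity, ?_⟩
  intro m hm Y A Z v hZ hv hYZ hAZ h1Y h2Y hYA F hF hsign i hi
  set J := Set.Icc (v (i + 1)) (v i) with hJ
  have hJI : ∀ x ∈ J, x ∈ Set.Icc (-1 : ℝ) 1 := fun x hx => (hv.angle_mem_of_mem_piece hm hi hx).1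
  have hJd : ∀ u ∈ J, ∀ x ∈ Set.Icc (-1 : ℝ) 1, (i : ℝ) ≤ angle m x → angle m x ≤ i + 3 →
      |x - u| ≤ 121 * rho m u := fun u hu x hx h1 h2 => by
    have h3 := hv.relDist_le_of_angle hm hi hu h1 h2
    have h4 := abs_sub_le_rho_mul hm hx (hJI u hu)
    have h5 := rho_pos hm u
    have h6 := relDist_pos m x u
    nlinarith [pow_le_pow_left₀ h6.le h3 2]
  have key : ∀ u ∈ J, ∃ q κ, LocalData r k F u (121 * rho m u) κ q J ∧ ∀ (μ : ℤ) (p : ℝ[X]),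
      Corrects r k μ F u (121 * rho m u) (c * κ) q p →
      ∀ x ∈ Set.Icc (-1 : ℝ) 1, (i : ℝ) ≤ angle m x → angle m x ≤ i + 3 →
        |F x - p.eval x| ≤ (1 + c) * K * 121 ^ r * (2 ^ k * 11 ^ (r + k)) * majorant r k m F x := by
    intro u hu
    have hρ := rho_pos hm u
    obtain ⟨q, hq1, hq2, hq3⟩ := HK F hF u (hJI u hu) (rho m u) hρ
    have hsub : ∀ x ∈ J, |x - u| ≤ 121 * rho m u := fun x hx => by
      obtain ⟨a, b, d⟩ := hv.angle_mem_of_mem_piece hm hi hx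
      exact hJd u hu x a b (by linarith)
    have h0 := omegaK_nonneg (iteratedDeriv r F) k (rho m u) (-1) 1
    refine ⟨q, _, ⟨hF, hq1, hq2, (hq3 u (hJI u hu) (by simp; positivity)).1,
      fun x hx => (hq3 x (hJI x hx) (hsub x hx)).2, hsub, hu, by positivity⟩, ?_⟩
    intro μ p hp x hx h1 h2
    have hd := hJd u hu x hx h1 h2
    have h3 := (hq3 x hx hd).2
    have h4 := hp.close x hd
    have h5 := majorant_le_relDist hF k hm x u
    have h6 := hv.relDist_le_of_angle hm hi hu h1 h2
    have h7 := relDist_pos m x u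
    have h8 := majorant_nonneg hm r k F x
    calc |F x - p.eval x| ≤ |F x - q.eval x| + |p.eval x - q.eval x| := by
          rw [abs_sub_comm (p.eval x)]; exact abs_sub_le _ _ _
      _ ≤ K * omegaK (iteratedDeriv r F) k (rho m u) (-1) 1 * (121 * rho m u) ^ r +
          c * (K * omegaK (iteratedDeriv r F) k (rho m u) (-1) 1) * (121 * rho m u) ^ r := by
          refine add_le_add (h3.trans ?_) h4
          gcongr
      _ = (1 + c) * K * 121 ^ r * majorant r k m F u := by unfold majorant; rw [mul_pow]; ring
      _ ≤ (1 + c) * K * 121 ^ r * (2 ^ k * majorant r k m F x * 11 ^ (r + k)) := by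
          gcongr
          refine h5.trans ?_
          gcongr
      _ = _ := by ring
  have hδ : ∀ u : ℝ, 0 < rho m u / 27 := fun u => by have := rho_pos hm u; positivity
  have hMδ : ∀ u : ℝ, 121 * rho m u ≤ M * (rho m u / 27) := fun u => by rw [hM]; linarith
  have hμ1 : m₁ ≤ r := by have := H.le_end; have := H.end_le; omega
  by_cases hY : ∃ y ∈ Y, y ∈ J
  · obtain ⟨y, hy, hyJ⟩ := hY
    obtain ⟨q, κ, L, hL⟩ := key y hyJ
    obtain ⟨τ, hτ, hτS⟩ := exists_sign_of_forall_notMem (Y.erase y) (a := v (i + 1)) (b := v i)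
      fun y' hy' hy'J => Finset.ne_of_mem_erase hy'
        (hv.eq_of_mem_piece hm hZ hi (hYZ (Finset.mem_of_mem_erase hy')) (hYZ hy) hy'J hyJ)
    have e : ∀ x, (signPoly Y).eval x = (x - y) * (signPoly (Y.erase y)).eval x := fun x => by
      unfold signPoly
      rw [← Finset.mul_prod_erase Y _ hy]; simp
    obtain ⟨p, hp, hps⟩ := (L.smul hτ).exists_sign H (fun x hx => by
        have h1 := hsign x (hJI x hx)
        rw [e] at h1
        refine nonneg_of_mul_nonneg_left (b := τ * (signPoly (Y.erase y)).eval x) ?_ (hτS x hx)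
        calc (0 : ℝ) ≤ τ ^ 2 * (F x * ((x - y) * (signPoly (Y.erase y)).eval x)) := by
              rw [hτ, one_mul]; exact h1
          _ = _ := by ring) (hδ y) (hMδ y)
      fun x hx => hv.mem_piece_of_abs_le hm hZ hi (hYZ hy) (fun h => h1Y (h ▸ hy))
        (fun h => h2Y (h ▸ hy)) hyJ hx
    have hp' := hp.smul hF (by have := H.sign_le; omega) hτ
    refine ⟨_, hp'.deg, hL _ _ hp', fun x hx => ?_, fun z hz hzJ l => ?_⟩
    · have := mul_nonneg (hps x hx) (hτS x hx).le
      rw [e, eval_mul, eval_C]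
      linarith
    · obtain rfl := hv.eq_of_mem_piece hm hZ hi hz (hYZ hy) hzJ hyJ
      refine ⟨fun h => absurd h (Finset.disjoint_left.mp hYA hy), fun _ hl =>
        hp'.interp l (by omega), ?_⟩
      rintro (rfl | rfl)
      · exact absurd hy h1Y
      · exact absurd hy h2Y
  push Not at hY
  obtain ⟨τ, hτ, hτS⟩ := exists_sign_of_forall_notMem Y (a := v (i + 1)) (b := v i) hY
  have hFτ : ∀ x ∈ J, 0 ≤ τ * F x := fun x hx => by
    refine nonneg_of_mul_nonneg_left (b := τ * (signPoly Y).eval x) ?_ (hτS x hx)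
    calc (0 : ℝ) ≤ τ ^ 2 * (F x * (signPoly Y).eval x) := by
          rw [hτ, one_mul]; exact hsign x (hJI x hx)
      _ = _ := by ring
  have fin : ∀ u ∈ J, ∀ q κ, LocalData r k F u (121 * rho m u) κ q J → ∀ (μ : ℤ) (p : ℝ[X]),
      μ ≤ r → Corrects r k μ (fun x => τ * F x) u (121 * rho m u) (c * κ) (C τ * q) p →
      (∀ x ∈ J, 0 ≤ p.eval x) → Corrects r k μ F u (121 * rho m u) (c * κ) q (C τ * p) ∧
      ∀ x ∈ J, 0 ≤ (C τ * p).eval x * (signPoly Y).eval x := by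
    intro u hu q κ L μ p hμ hp hps
    refine ⟨hp.smul hF hμ hτ, fun x hx => ?_⟩
    have := mul_nonneg (hps x hx) (hτS x hx).le
    rw [eval_mul, eval_C]
    linarith
  by_cases hE : ∃ u, (u = 1 ∨ u = -1) ∧ u ∈ J
  · obtain ⟨u, hu1, hu⟩ := hE
    have huZ : u ∈ Z := by
      rcases hu1 with rfl | rfl
      · exact hZ.one_mem
      · exact hZ.neg_one_mem
    obtain ⟨q, κ, L, hL⟩ := key u hu
    obtain ⟨p, hp, hps⟩ : ∃ p, Corrects r k m₃ (fun x => τ * F x) u (121 * rho m u) (c * κ)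
        (C τ * q) p ∧ ∀ x ∈ J, 0 ≤ p.eval x := by
      rcases hu1 with rfl | rfl
      · exact (L.smul hτ).exists_end H hFτ (hδ 1) (hMδ 1) (σ := -1) (by simp)
          (fun x hx => by linarith [(hJI x hx).2]) (hv.end_mem_piece_one hm hZ hi hu)
      · exact (L.smul hτ).exists_end H hFτ (hδ (-1)) (hMδ (-1)) (σ := 1) (by simp)
          (fun x hx => by linarith [(hJI x hx).1]) (hv.end_mem_piece_neg_one hm hZ hi hu)
    obtain ⟨hp', hps'⟩ := fin u hu q κ L _ p (by have := H.end_le; omega) hp hps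
    refine ⟨_, hp'.deg, hL _ _ hp', hps', fun z hz hzJ l => ?_⟩
    obtain rfl := hv.eq_of_mem_piece hm hZ hi hz huZ hzJ hu
    exact ⟨fun _ hl => hp'.interp l (hl.trans H.le_end), fun h => absurd hzJ (hY _ h),
      fun _ hl => hp'.interp l (by omega)⟩
  by_cases hA : ∃ u ∈ A, u ∈ J
  · obtain ⟨u, huA, hu⟩ := hA
    obtain ⟨q, κ, L, hL⟩ := key u hu
    obtain ⟨p, hp, hps⟩ := (L.smul hτ).exists_nonneg H hFτ (hδ u) (hMδ u) fun x hx =>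
      hv.mem_piece_of_abs_le hm hZ hi (hAZ huA) (fun h => hE ⟨u, Or.inl h, hu⟩)
        (fun h => hE ⟨u, Or.inr h, hu⟩) hu hx
    obtain ⟨hp', hps'⟩ := fin u hu q κ L _ p hμ1 hp hps
    refine ⟨_, hp'.deg, hL _ _ hp', hps', fun z hz hzJ l => ?_⟩
    obtain rfl := hv.eq_of_mem_piece hm hZ hi hz (hAZ huA) hzJ hu
    exact ⟨fun _ hl => hp'.interp l hl, fun h => absurd hzJ (hY _ h),
      fun h => absurd ⟨z, h, hzJ⟩ hE⟩
  · have hu : v i ∈ J := Set.right_mem_Icc.mpr (hv.lt_of_lt hm (Nat.lt_succ_self i) hi).le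
    obtain ⟨q, κ, L, hL⟩ := key _ hu
    obtain ⟨p, hp, hps⟩ := (L.smul hτ).exists_nonneg_free hFτ
    obtain ⟨hp', hps'⟩ := fin _ hu q κ L _ p (by omega)
      (hp.mono L.pos le_rfl (L.kappa_le (hδ _) (hMδ _))) hps
    exact ⟨_, hp'.deg, hL _ _ hp', hps', fun z hz hzJ l => ⟨fun h => absurd ⟨z, h, hzJ⟩ hA,
      fun h => absurd hzJ (hY _ h), fun h => absurd ⟨z, h, hzJ⟩ hE⟩⟩

/-- Copositive approximation with interpolation at the points of `Y`, `A` and the endpoints, for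
functions on the real line. -/
theorem exists_copositive_poly {r k m₂ m₃ : ℕ} {m₁ : ℤ} (H : Admissible r k m₁ m₂ m₃) (B : ℕ) :
    ∃ K : ℝ, 0 < K ∧ ∃ L : ℕ, ∀ m : ℕ, 2 ≤ m → ∀ Y A Z : Finset ℝ, IsSparse m Z → Z.card ≤ B →
    Y ⊆ Z → A ⊆ Z → 1 ∉ Y → -1 ∉ Y → Disjoint Y A →
    ∀ F : ℝ → ℝ, ContDiff ℝ r F → (∀ x ∈ Set.Icc (-1 : ℝ) 1, 0 ≤ F x * (signPoly Y).eval x) →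
    ∃ P : ℝ[X], P.natDegree ≤ L * m ∧
      (∀ x ∈ Set.Icc (-1 : ℝ) 1, |F x - P.eval x| ≤ K * majorant r k m F x) ∧
      (∀ x ∈ Set.Icc (-1 : ℝ) 1, 0 ≤ P.eval x * (signPoly Y).eval x) ∧
      ∀ l : ℕ,
        (∀ z ∈ A, (l : ℤ) ≤ m₁ → (derivative^[l] P).eval z = iteratedDeriv l F z) ∧
        (∀ z ∈ Y, l ≤ m₂ → (derivative^[l] P).eval z = iteratedDeriv l F z) ∧
        (∀ z, z = 1 ∨ z = -1 → l ≤ m₃ → (derivative^[l] P).eval z = iteratedDeriv l F z) := by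
  obtain ⟨Kp, hKp, hcell⟩ := exists_cell_poly H
  obtain ⟨K, hK, L, hglue⟩ := exists_glued_poly (r + 1) B (r + k) (k + r + 5) (2 ^ k) Kp
    (by positivity) hKp
  refine ⟨K, hK, L, fun m hm Y A Z hZ hB hYZ hAZ h1 h2 hYA F hF hsign => ?_⟩
  have hm0 : 0 < m := by omega
  obtain ⟨v, hv⟩ := hZ.exists_grid hm0
  have hp := hcell m hm0 Y A Z v hZ hv hYZ hAZ h1 h2 hYA F hF hsign
  choose! p hp1 hp2 hp3 hp4 using hp
  obtain ⟨P, hP1, hP2, hP3, hP4⟩ := hglue m hm Y Z hYZ hB hZ.mem (fun z hz z' hz' hne =>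
      le_trans (by gcongr; norm_num) (hZ.sep z hz z' hz' hne)) v hv (majorant r k m F)
    (fun x _ => majorant_nonneg hm0 r k F x) (fun x _ u _ => majorant_le_relDist hF k hm0 x u) F p
    hp1 hp2 hp3
  have hint : ∀ z ∈ Z, ∃ i < m, z ∈ Set.Icc (v (i + 1)) (v i) ∧
      ∀ l ≤ r, (derivative^[l] P).eval z = (derivative^[l] (p i)).eval z := fun z hz => by
    obtain ⟨i, hi, hzi, -⟩ := hv.exists_piece hm0 (hZ.mem z hz)
    exact ⟨i, hi, hzi, fun l hl => eval_iterate_derivative_eq_of_dvd (hP4 i hi z hz hzi) (by omega)⟩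
  have hr := H.end_le
  have hr' := H.sign_le
  have hr'' := H.le_end
  refine ⟨P, hP1, hP2, hP3, fun l => ⟨fun z hz hl => ?_, fun z hz hl => ?_, fun z hz hl => ?_⟩⟩
  · obtain ⟨i, hi, hzi, h⟩ := hint z (hAZ hz)
    rw [h l (by omega)]
    exact (hp4 i hi z (hAZ hz) hzi l).1 hz hl
  · obtain ⟨i, hi, hzi, h⟩ := hint z (hYZ hz)
    rw [h l (by omega)]
    exact (hp4 i hi z (hYZ hz) hzi l).2.1 hz hl
  · have hzZ : z ∈ Z := by
      rcases hz with rfl | rfl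
      · exact hZ.one_mem
      · exact hZ.neg_one_mem
    obtain ⟨i, hi, hzi, h⟩ := hint z hzZ
    rw [h l (by omega)]
    exact (hp4 i hi z hzZ hzi l).2.2 hz hl

lemma minGap_le {S : Set ℝ} {u v : ℝ} (hu : u ∈ S) (hv : v ∈ S) (h : u ≠ v) :
    minGap S ≤ |u - v| :=
  csInf_le ⟨0, by rintro _ ⟨u, -, v, -, -, rfl⟩; exact abs_nonneg _⟩ ⟨u, hu, v, hv, h, rfl⟩

lemma minGap_pos {S : Set ℝ} (hS : S.Finite) {u v : ℝ} (hu : u ∈ S) (hv : v ∈ S) (h : u ≠ v) :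
    0 < minGap S := by
  have hfin : {d : ℝ | ∃ u ∈ S, ∃ v ∈ S, u ≠ v ∧ d = |u - v|}.Finite :=
    ((hS.prod hS).image fun w => |w.1 - w.2|).subset (by
      rintro _ ⟨u, hu, v, hv, -, rfl⟩
      exact ⟨(u, v), ⟨hu, hv⟩, rfl⟩)
  have hmem : |u - v| ∈ {d : ℝ | ∃ u ∈ S, ∃ v ∈ S, u ≠ v ∧ d = |u - v|} := ⟨u, hu, v, hv, h, rfl⟩
  obtain ⟨u, -, v, -, hne, e⟩ := Set.Nonempty.csInf_mem ⟨_, hmem⟩ hfin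
  unfold minGap
  rw [e]
  exact abs_pos.mpr (sub_ne_zero.mpr hne)

section sign

variable {s : ℕ} {y : Fin (s + 2) → ℝ}

/-- The sign changes, that is, all terms of the extended sequence except the endpoints. -/
noncomputable def interiorNodes (y : Fin (s + 2) → ℝ) : Finset ℝ :=
  Finset.univ.image fun t : Fin s => y t.castSucc.succ

lemma neg_one_pow_mul_signPoly (hy : StrictAnti y) (i : Fin (s + 1)) (x : ℝ) :
    (-1 : ℝ) ^ (i : ℕ) * (signPoly (interiorNodes y)).eval x
      = ∏ t : Fin s, (if (t : ℕ) < i then y t.castSucc.succ - x else x - y t.castSucc.succ) := by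
  have hinj : Function.Injective fun t : Fin s => y t.castSucc.succ :=
    hy.injective.comp ((Fin.succ_injective _).comp (Fin.castSucc_injective _))
  have e1 : (-1 : ℝ) ^ (i : ℕ) = ∏ t : Fin s, (if (t : ℕ) < i then (-1 : ℝ) else 1) := by
    rw [Finset.prod_ite, Finset.prod_const, Finset.prod_const_one, mul_one, Fin.card_filter_val_lt,
      min_eq_right (by omega)]
  rw [e1, eval_signPoly, interiorNodes, Finset.prod_image hinj.injOn, ← Finset.prod_mul_distrib]
  refine Finset.prod_congr rfl fun t _ => ?_
  split_ifs <;> ring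

lemma exists_mem_cell (x : ℝ) (h0 : x ≤ y 0) (h1 : y (Fin.last (s + 1)) ≤ x) :
    ∃ i : Fin (s + 1), x ∈ Set.Icc (y i.succ) (y i.castSucc) := by
  by_contra! h
  have key : ∀ j : Fin (s + 2), x ≤ y j := by
    intro j
    induction j using Fin.induction with
    | zero => exact h0
    | succ i ih =>
      by_contra! hlt
      exact h i ⟨hlt.le, ih⟩
  exact h (Fin.last s) ⟨h1, key _⟩

lemma Delta0.mul_signPoly_nonneg {g : ℝ → ℝ} (hy : StrictAnti y) (hg : Delta0 y g) {x : ℝ}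
    (h0 : x ≤ y 0) (h1 : y (Fin.last (s + 1)) ≤ x) :
    0 ≤ g x * (signPoly (interiorNodes y)).eval x := by
  obtain ⟨i, hi⟩ := exists_mem_cell x h0 h1
  have a := hg i x hi
  have b : 0 ≤ (-1 : ℝ) ^ (i : ℕ) * (signPoly (interiorNodes y)).eval x := by
    rw [neg_one_pow_mul_signPoly hy]
    refine Finset.prod_nonneg fun t _ => ?_
    split_ifs with h
    · have : y i.castSucc ≤ y t.castSucc.succ := hy.antitone (by
        rw [Fin.le_def]; simp only [Fin.val_succ, Fin.val_castSucc]; omega)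
      linarith [hi.2]
    · have : y t.castSucc.succ ≤ y i.succ := hy.antitone (by
        rw [Fin.le_def]; simp only [Fin.val_succ, Fin.val_castSucc]; omega)
      linarith [hi.1]
  have e : (-1 : ℝ) ^ (i : ℕ) * (-1 : ℝ) ^ (i : ℕ) = 1 := by
    rw [← mul_pow]; norm_num
  calc (0 : ℝ) ≤ ((-1 : ℝ) ^ (i : ℕ) * g x) *
        ((-1 : ℝ) ^ (i : ℕ) * (signPoly (interiorNodes y)).eval x) := mul_nonneg a b
    _ = ((-1 : ℝ) ^ (i : ℕ) * (-1 : ℝ) ^ (i : ℕ)) *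
        (g x * (signPoly (interiorNodes y)).eval x) := by ring
    _ = _ := by rw [e, one_mul]

lemma delta0_of_mul_signPoly_nonneg {g : ℝ → ℝ} (hy : StrictAnti y) (hc : Continuous g)
    (h : ∀ x ∈ Set.Icc (y (Fin.last (s + 1))) (y 0),
      0 ≤ g x * (signPoly (interiorNodes y)).eval x) : Delta0 y g := by
  intro i
  have hlt : y i.succ < y i.castSucc := hy Fin.castSucc_lt_succ
  have hcl : IsClosed {x | 0 ≤ (-1 : ℝ) ^ (i : ℕ) * g x} :=
    isClosed_le continuous_const (continuous_const.mul hc)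
  rw [← closure_Ioo hlt.ne]
  refine closure_minimal (fun x hx => ?_) hcl
  have b : 0 < (-1 : ℝ) ^ (i : ℕ) * (signPoly (interiorNodes y)).eval x := by
    rw [neg_one_pow_mul_signPoly hy]
    refine Finset.prod_pos fun t _ => ?_
    split_ifs with h
    · have : y i.castSucc ≤ y t.castSucc.succ := hy.antitone (by
        rw [Fin.le_def]; simp only [Fin.val_succ, Fin.val_castSucc]; omega)
      linarith [hx.2]
    · have : y t.castSucc.succ ≤ y i.succ := hy.antitone (by
        rw [Fin.le_def]; simp only [Fin.val_succ, Fin.val_castSucc]; omega)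
      linarith [hx.1]
  have e : (-1 : ℝ) ^ (i : ℕ) * (-1 : ℝ) ^ (i : ℕ) = 1 := by
    rw [← mul_pow]; norm_num
  have a := h x ⟨(hy.antitone (Fin.le_last _)).trans hx.1.le,
    hx.2.le.trans (hy.antitone (Fin.zero_le _))⟩
  refine nonneg_of_mul_nonneg_left (b := (-1 : ℝ) ^ (i : ℕ) *
    (signPoly (interiorNodes y)).eval x) ?_ b
  calc (0 : ℝ) ≤ ((-1 : ℝ) ^ (i : ℕ) * (-1 : ℝ) ^ (i : ℕ)) *
        (g x * (signPoly (interiorNodes y)).eval x) := by rw [e, one_mul]; exact a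
    _ = _ := by ring

lemma exists_eq_castSucc_succ {j : Fin (s + 2)} (h0 : j ≠ 0) (h1 : j ≠ Fin.last (s + 1)) :
    ∃ t : Fin s, j = t.castSucc.succ := by
  obtain ⟨i, rfl⟩ := Fin.exists_succ_eq.mpr h0
  have : i ≠ Fin.last s := fun h => h1 (by rw [h, Fin.succ_last])
  obtain ⟨t, rfl⟩ := Fin.exists_castSucc_eq.mpr this
  exact ⟨t, rfl⟩

lemma castSucc_succ_ne (t : Fin s) :
    t.castSucc.succ ≠ 0 ∧ t.castSucc.succ ≠ Fin.last (s + 1) := by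
  refine ⟨Fin.succ_ne_zero _, fun h => ?_⟩
  have := congrArg Fin.val h
  simp only [Fin.val_succ, Fin.val_castSucc, Fin.val_last] at this
  omega

end sign

lemma rho_le_rho_div {n m L : ℕ} (hL : 1 ≤ L) (hm : 0 < m) (hmn : n ≤ 2 * L * m) (hn : 0 < n)
    (x : ℝ) : rho m x ≤ 4 * (L : ℝ) ^ 2 * rho n x := by
  have hm' : (0 : ℝ) < m := by exact_mod_cast hm
  have hn' : (0 : ℝ) < n := by exact_mod_cast hn
  have hL' : (1 : ℝ) ≤ L := by exact_mod_cast hL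
  have h : (n : ℝ) ≤ 2 * L * m := by exact_mod_cast hmn
  have h1 : 1 / (m : ℝ) ≤ 2 * L * (1 / n) := by
    rw [← mul_div_assoc, mul_one, div_le_div_iff₀ hm' hn', one_mul]; exact h
  have h2 : (1 / (m : ℝ)) ^ 2 ≤ (2 * L * (1 / n)) ^ 2 := pow_le_pow_left₀ (by positivity) h1 2
  have h3 := sqrt_nonneg (1 - x ^ 2)
  have h4 : (0 : ℝ) ≤ 1 / n := by positivity
  unfold rho
  calc √(1 - x ^ 2) / m + 1 / (m : ℝ) ^ 2 = √(1 - x ^ 2) * (1 / m) + (1 / (m : ℝ)) ^ 2 := by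
        rw [one_div_pow]; ring
    _ ≤ √(1 - x ^ 2) * (4 * (L : ℝ) ^ 2 * (1 / n)) + (2 * L * (1 / n)) ^ 2 := by
        refine add_le_add (mul_le_mul_of_nonneg_left (h1.trans ?_) h3) h2
        refine mul_le_mul_of_nonneg_right ?_ h4
        nlinarith
    _ = _ := by rw [mul_pow, one_div_pow]; ring

end CopositiveApprox

/-- Copositive polynomial approximation with interpolatory constraints, for
`(r,k,m₁,m₂,m₃)` in the admissible index set
`{(0,2,0,0,0), (1,3,0,0,0), (1,2,0,1,0), (2,3,1,1,1)}`
`∪ {(2j,k,2j-1,2j-2,2j-1) : j,k ≥ 1} ∪ {(2j+1,k,2j-1,2j,2j) : j ≥ 0, k ≥ 1}`. -/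
theorem statement3 (p s : ℕ) (hp : 1 ≤ p) (hs : 1 ≤ s)
    (r k : ℕ) (m₁ : ℤ) (m₂ m₃ : ℕ)
    (hm : (r = 0 ∧ k = 2 ∧ m₁ = 0 ∧ m₂ = 0 ∧ m₃ = 0)
        ∨ (r = 1 ∧ k = 3 ∧ m₁ = 0 ∧ m₂ = 0 ∧ m₃ = 0)
        ∨ (r = 1 ∧ k = 2 ∧ m₁ = 0 ∧ m₂ = 1 ∧ m₃ = 0)
        ∨ (r = 2 ∧ k = 3 ∧ m₁ = 1 ∧ m₂ = 1 ∧ m₃ = 1)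
        ∨ (∃ j : ℕ, 1 ≤ j ∧ 1 ≤ k ∧ r = 2 * j ∧ m₁ = 2 * (j : ℤ) - 1 ∧
            m₂ = 2 * j - 2 ∧ m₃ = 2 * j - 1)
        ∨ (∃ j : ℕ, 1 ≤ k ∧ r = 2 * j + 1 ∧ m₁ = 2 * (j : ℤ) - 1 ∧
            m₂ = 2 * j ∧ m₃ = 2 * j)) :
    ∃ c : ℝ, 0 < c ∧ ∃ Nf : ℝ → ℕ,
      ∀ (y : Fin (s + 2) → ℝ), StrictAnti y → y 0 = 1 → y (Fin.last (s + 1)) = -1 →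
      ∀ (α : Fin p → ℝ), StrictAnti α → (∀ j, α j ∈ Set.Icc (-1 : ℝ) 1) →
      (∀ i : Fin (s + 2), i ≠ 0 → i ≠ Fin.last (s + 1) → ∀ j, y i ≠ α j) →
      ∀ f : ℝ → ℝ, ContDiffOn ℝ r f (Set.Icc (-1 : ℝ) 1) → Delta0 y f →
      ∀ n : ℕ, Nf (minGap (Set.range y ∪ Set.range α ∪ {-1, 1})) ≤ n →
      ∃ P : Polynomial ℝ, P.natDegree ≤ n ∧
        Delta0 y (fun x => P.eval x) ∧
        (∀ i : ℕ, (i : ℤ) ≤ m₁ → ∀ j : Fin p,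
          (Polynomial.derivative^[i] P).eval (α j)
            = iteratedDerivWithin i f (Set.Icc (-1 : ℝ) 1) (α j)) ∧
        (∀ i : ℕ, i ≤ m₂ → ∀ jj : Fin (s + 2), jj ≠ 0 → jj ≠ Fin.last (s + 1) →
          (Polynomial.derivative^[i] P).eval (y jj)
            = iteratedDerivWithin i f (Set.Icc (-1 : ℝ) 1) (y jj)) ∧
        (∀ i : ℕ, i ≤ m₃ →
          (Polynomial.derivative^[i] P).eval 1
            = iteratedDerivWithin i f (Set.Icc (-1 : ℝ) 1) 1 ∧
          (Polynomial.derivative^[i] P).eval (-1)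
            = iteratedDerivWithin i f (Set.Icc (-1 : ℝ) 1) (-1)) ∧
        ∀ x ∈ Set.Icc (-1 : ℝ) 1,
          |f x - P.eval x| ≤ c * rho n x ^ r *
            omegaK (iteratedDerivWithin r f (Set.Icc (-1 : ℝ) 1)) k (rho n x) (-1) 1 := by
  obtain ⟨K, hK, L₀, H⟩ := CopositiveApprox.exists_copositive_poly hm (s + p + 2)
  set L := max L₀ 1 with hL
  have hL1 : 1 ≤ L := le_max_right _ _
  have hLr : (1 : ℝ) ≤ 4 * (L : ℝ) ^ 2 := by
    have : (1 : ℝ) ≤ L := by exact_mod_cast hL1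
    nlinarith
  refine ⟨K * (2 ^ k * (4 * (L : ℝ) ^ 2) ^ (r + k)), by positivity,
    fun d => L * max 2 ⌈8 / d⌉₊, ?_⟩
  intro y hy hy0 hyl α hα hαI hyα f hf hfy n hn
  obtain ⟨F, hF, hFf⟩ := CopositiveApprox.exists_contDiff_extension (by norm_num) r f hf
  have hder : ∀ i ≤ r, ∀ x ∈ Set.Icc (-1 : ℝ) 1,
      iteratedDerivWithin i f (Set.Icc (-1 : ℝ) 1) x = iteratedDeriv i F x := fun i hi x hx =>
    CopositiveApprox.iteratedDerivWithin_eq_of_extension (by norm_num) hi hF hFf hx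
  set S := Set.range y ∪ Set.range α ∪ {-1, 1} with hS
  have hSfin : S.Finite :=
    ((Set.finite_range y).union (Set.finite_range α)).union (Set.toFinite _)
  have hd : 0 < minGap S := CopositiveApprox.minGap_pos hSfin (u := -1) (v := 1)
    (Or.inr (Or.inl rfl)) (Or.inr (Or.inr rfl)) (by norm_num)
  set m := n / L with hmdef
  have hmN : max 2 ⌈8 / minGap S⌉₊ ≤ m := (Nat.le_div_iff_mul_le hL1).mpr (by rwa [mul_comm])
  have hm2 : 2 ≤ m := (le_max_left _ _).trans hmN
  have hm' : (0 : ℝ) < m := by exact_mod_cast (by omega : 0 < m)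
  have hmd : 8 / (m : ℝ) ≤ minGap S := by
    have h1 : 8 / minGap S ≤ m :=
      (Nat.le_ceil _).trans (by exact_mod_cast (le_max_right _ _).trans hmN)
    rw [div_le_iff₀ hd] at h1
    rw [div_le_iff₀ hm']
    linarith
  have hLm : L * m ≤ n := Nat.mul_div_le n L
  have hn0 : 0 < n := lt_of_lt_of_le (Nat.mul_pos hL1 (by omega)) hLm
  have hnm : n ≤ 2 * L * m := by
    have h1 : n < L * (m + 1) := Nat.lt_mul_div_succ n hL1
    nlinarith
  set Y := CopositiveApprox.interiorNodes y with hY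
  set A : Finset ℝ := Finset.univ.image α with hA
  have hyI : ∀ i, y i ∈ Set.Icc (-1 : ℝ) 1 := fun i =>
    ⟨hyl ▸ hy.antitone (Fin.le_last i), hy0 ▸ hy.antitone (Fin.zero_le i)⟩
  have hYy : ∀ z ∈ Y, ∃ t : Fin s, z = y t.castSucc.succ := fun z hz => by
    obtain ⟨t, -, h⟩ := Finset.mem_image.mp hz
    exact ⟨t, h.symm⟩
  have hAα : ∀ z ∈ A, ∃ j, z = α j := fun z hz => by
    obtain ⟨j, -, h⟩ := Finset.mem_image.mp hz
    exact ⟨j, h.symm⟩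
  set Z : Finset ℝ := Y ∪ A ∪ {-1, 1} with hZdef
  have hZS : ∀ z ∈ Z, z ∈ S := fun z hz => by
    rw [hZdef, Finset.mem_union, Finset.mem_union, Finset.mem_insert, Finset.mem_singleton] at hz
    rcases hz with (hz | hz) | hz
    · obtain ⟨t, rfl⟩ := hYy z hz
      exact Or.inl (Or.inl ⟨_, rfl⟩)
    · obtain ⟨j, rfl⟩ := hAα z hz
      exact Or.inl (Or.inr ⟨_, rfl⟩)
    · exact Or.inr hz
  have hZ : CopositiveApprox.IsSparse m Z := by
    refine ⟨fun z hz => ?_, fun z hz z' hz' hne =>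
      hmd.trans (CopositiveApprox.minGap_le (hZS z hz) (hZS z' hz') hne), by simp [hZdef],
      by simp [hZdef]⟩
    rcases hZS z hz with (⟨i, rfl⟩ | ⟨j, rfl⟩) | rfl | rfl
    · exact hyI i
    · exact hαI j
    · norm_num
    · norm_num
  have hcard : Z.card ≤ s + p + 2 := by
    have h1 : Y.card ≤ s := Finset.card_image_le.trans (by simp)
    have h2 : A.card ≤ p := Finset.card_image_le.trans (by simp)
    have h3 : ({-1, 1} : Finset ℝ).card ≤ 2 := Finset.card_le_two
    have h4 : Z.card ≤ (Y ∪ A).card + ({-1, 1} : Finset ℝ).card := Finset.card_union_le _ _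
    have h5 : (Y ∪ A).card ≤ Y.card + A.card := Finset.card_union_le _ _
    omega
  have hY1 : (1 : ℝ) ∉ Y := fun h => by
    obtain ⟨t, ht⟩ := hYy _ h
    exact (CopositiveApprox.castSucc_succ_ne t).1 (hy.injective (by rw [hy0, ← ht]))
  have hY2 : (-1 : ℝ) ∉ Y := fun h => by
    obtain ⟨t, ht⟩ := hYy _ h
    exact (CopositiveApprox.castSucc_succ_ne t).2 (hy.injective (by rw [hyl, ← ht]))
  have hYA : Disjoint Y A := Finset.disjoint_left.mpr fun z hz hz' => by
    obtain ⟨t, rfl⟩ := hYy z hz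
    obtain ⟨j, hj⟩ := hAα _ hz'
    exact hyα _ (CopositiveApprox.castSucc_succ_ne t).1 (CopositiveApprox.castSucc_succ_ne t).2 j hj
  obtain ⟨P, hP1, hP2, hP3, hP4⟩ := H m hm2 Y A Z hZ hcard
    (fun z hz => Finset.mem_union_left _ (Finset.mem_union_left _ hz))
    (fun z hz => Finset.mem_union_left _ (Finset.mem_union_right _ hz)) hY1 hY2 hYA F hF
    fun x hx => by
      rw [hFf x hx]
      exact CopositiveApprox.Delta0.mul_signPoly_nonneg hy hfy (by rw [hy0]; exact hx.2)
        (by rw [hyl]; exact hx.1)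
  have hmr : CopositiveApprox.Admissible r k m₁ m₂ m₃ := hm
  have hr1 := hmr.le_end
  have hr2 := hmr.end_le
  have hr3 := hmr.sign_le
  refine ⟨P, hP1.trans (le_trans (Nat.mul_le_mul_right m (le_max_left _ _)) hLm), ?_,
    fun i hi j => ?_, fun i hi j h0 h1 => ?_, fun i hi => ⟨?_, ?_⟩, fun x hx => ?_⟩
  · refine CopositiveApprox.delta0_of_mul_signPoly_nonneg hy P.continuous ?_
    rw [hy0, hyl]; exact hP3
  · rw [hder i (by omega) _ (hαI j)]
    exact (hP4 i).1 _ (Finset.mem_image_of_mem _ (Finset.mem_univ j)) hi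
  · rw [hder i (by omega) _ (hyI j)]
    obtain ⟨t, rfl⟩ := CopositiveApprox.exists_eq_castSucc_succ h0 h1
    exact (hP4 i).2.1 _ (Finset.mem_image.mpr ⟨t, Finset.mem_univ t, rfl⟩) hi
  · rw [hder i (by omega) _ (by norm_num)]
    exact (hP4 i).2.2 1 (Or.inl rfl) hi
  · rw [hder i (by omega) _ (by norm_num)]
    exact (hP4 i).2.2 (-1) (Or.inr rfl) hi
  · rw [← hFf x hx, CopositiveApprox.omegaK_congr (hder r le_rfl) k]
    have h1 := hP2 x hx
    have h2 := CopositiveApprox.majorant_le hF k hn0 hLr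
      (CopositiveApprox.rho_pos (by omega : 0 < m) x).le
      (CopositiveApprox.rho_le_rho_div hL1 (by omega) hnm hn0 x)
    calc _ ≤ K * CopositiveApprox.majorant r k m F x := h1
      _ ≤ K * (2 ^ k * CopositiveApprox.majorant r k n F x * (4 * (L : ℝ) ^ 2) ^ (r + k)) := by
          gcongr
      _ = _ := by unfold CopositiveApprox.majorant; ring
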